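/- The equation 5y^2 = x(x^5 + 10x^4 + 30x^3 + 60x^2 + 45x + 18) has (x,y) = (0,0) as its only rational solution. -/

import Mathlib

namespace FiveYSq

open Polynomial NumberField

/-- `w` generates the quintic field `K` and satisfies `w ^ 5 - 5 * w ^ 3 + 5 * w - 4 = 0`. -/
structure IsGen {K : Type*} [Field K] [NumberField K] (w : K) : Prop where
  root : w ^ 5 = 5 * w ^ 3 - 5 * w + 4
  finrank : Module.finrank ℚ K = 5

/-- The minimal polynomial of the generator. -/
noncomputable def genPoly : ℤ[X] := X ^ 5 - 5 * X ^ 3 + 5 * X - 4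

lemma genPoly_natDegree : genPoly.natDegree = 5 := by unfold genPoly; compute_degree!

lemma genPoly_monic : genPoly.Monic := by unfold genPoly; monicity!

lemma genPoly_irreducible : Irreducible genPoly := by
  have hE : genPoly.comp (X - 1) = X ^ 5 - 5 * X ^ 4 + 5 * X ^ 3 + 5 * X ^ 2 - 5 * X - 5 := by
    simp only [genPoly, sub_comp, add_comp, mul_comp, pow_comp, X_comp, ofNat_comp]
    ring
  have hm : (X ^ 5 - 5 * X ^ 4 + 5 * X ^ 3 + 5 * X ^ 2 - 5 * X - 5 : ℤ[X]).Monic := by monicity!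
  have hd : (X ^ 5 - 5 * X ^ 4 + 5 * X ^ 3 + 5 * X ^ 2 - 5 * X - 5 : ℤ[X]).natDegree = 5 := by
    compute_degree!
  have hc : ∀ n : ℕ, (X ^ 5 - 5 * X ^ 4 + 5 * X ^ 3 + 5 * X ^ 2 - 5 * X - 5 : ℤ[X]).coeff n
      = (if n = 5 then 1 else 0) - 5 * (if n = 4 then 1 else 0) + 5 * (if n = 3 then 1 else 0)
        + 5 * (if n = 2 then 1 else 0) - 5 * (if n = 1 then 1 else 0)
        - 5 * (if n = 0 then 1 else 0) := by
    intro n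
    have e : (X ^ 5 - 5 * X ^ 4 + 5 * X ^ 3 + 5 * X ^ 2 - 5 * X - 5 : ℤ[X])
      = X ^ 5 - C 5 * X ^ 4 + C 5 * X ^ 3 + C 5 * X ^ 2 - C 5 * X ^ 1 - C 5 * X ^ 0 := by
      simp
    rw [e]
    simp only [coeff_add, coeff_sub, coeff_C_mul, coeff_X_pow]
  have h5 : Irreducible (genPoly.comp (X - 1)) := by
    rw [hE]
    refine IsEisensteinAt.irreducible (𝓟 := Ideal.span {(5 : ℤ)}) ⟨?_, ?_, ?_⟩ ?_
      hm.isPrimitive (by rw [hd]; norm_num)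
    · rw [hm.leadingCoeff, Ideal.mem_span_singleton]; norm_num
    · intro n hn
      rw [hd] at hn
      rw [Ideal.mem_span_singleton, hc]
      interval_cases n <;> norm_num
    · rw [hc, Ideal.span_singleton_pow, Ideal.mem_span_singleton]
      norm_num
    · exact (Ideal.span_singleton_prime (by norm_num)).2
        (Int.prime_iff_natAbs_prime.2 (by norm_num))
  rw [← MulEquiv.irreducible_iff (Polynomial.algEquivAevalXAddC (-1 : ℤ))]
  simpa [Polynomial.algEquivAevalXAddC, comp, aeval_def, sub_eq_add_neg] using h5

section
variable {K : Type*} [Field K] [NumberField K] {w : K}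

namespace IsGen

lemma aeval_genPoly (hw : IsGen w) : aeval w genPoly = 0 := by
  have h4 : aeval w (4 : ℤ[X]) = 4 := map_ofNat _ 4
  have h5 : aeval w (5 : ℤ[X]) = 5 := map_ofNat _ 5
  simp only [genPoly, map_add, map_sub, map_mul, map_pow, aeval_X, h4, h5, hw.root]
  ring

lemma minpoly_eq (hw : IsGen w) : minpoly ℚ w = genPoly.map (Int.castRingHom ℚ) := by
  refine (minpoly.eq_of_irreducible_of_monic ?_ ?_ (genPoly_monic.map _)).symm
  · exact (genPoly_monic.irreducible_iff_irreducible_map_fraction_map (K := ℚ)).1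
      genPoly_irreducible
  · have := hw.aeval_genPoly
    rwa [← aeval_map_algebraMap ℚ] at this

lemma minpoly_natDegree (hw : IsGen w) : (minpoly ℚ w).natDegree = 5 := by
  rw [hw.minpoly_eq, genPoly_monic.natDegree_map, genPoly_natDegree]

/-- The basis `1, w, w ^ 2, w ^ 3, w ^ 4`. -/
noncomputable def basis (hw : IsGen w) : Module.Basis (Fin 5) ℚ K :=
  basisOfLinearIndependentOfCardEqFinrank (b := fun i : Fin 5 => w ^ (i : ℕ))
    (by
      have := linearIndependent_pow (K := ℚ) w
      exact this.comp (Fin.cast hw.minpoly_natDegree.symm) (Fin.cast_injective _))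
    (by rw [hw.finrank]; rfl)

@[simp] lemma basis_apply (hw : IsGen w) (i : Fin 5) : hw.basis i = w ^ (i : ℕ) := by
  simp [basis]

lemma exists_coords (hw : IsGen w) (z : K) : ∃ c0 c1 c2 c3 c4 : ℚ,
    z = c0 + c1 * w + c2 * w ^ 2 + c3 * w ^ 3 + c4 * w ^ 4 := by
  refine ⟨hw.basis.repr z 0, hw.basis.repr z 1, hw.basis.repr z 2, hw.basis.repr z 3,
    hw.basis.repr z 4, ?_⟩
  conv_lhs => rw [← hw.basis.sum_repr z]
  simp [Fin.sum_univ_five, Algebra.smul_def]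

lemma coords_eq_zero (hw : IsGen w) {c0 c1 c2 c3 c4 : ℚ}
    (h : (c0 + c1 * w + c2 * w ^ 2 + c3 * w ^ 3 + c4 * w ^ 4 : K) = 0) :
    c0 = 0 ∧ c1 = 0 ∧ c2 = 0 ∧ c3 = 0 ∧ c4 = 0 := by
  have := Fintype.linearIndependent_iff.1 hw.basis.linearIndependent ![c0, c1, c2, c3, c4]
    (by simp [Fin.sum_univ_five, Algebra.smul_def]; exact h)
  exact ⟨this 0, this 1, this 2, this 3, this 4⟩

lemma leftMulMatrix_eq (hw : IsGen w) (c0 c1 c2 c3 c4 : ℚ) :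
    Algebra.leftMulMatrix hw.basis (c0 + c1 * w + c2 * w ^ 2 + c3 * w ^ 3 + c4 * w ^ 4) =
    !![c0, 4*c4, 4*c3, 4*c2 + 20*c4, 4*c1 + 20*c3;
       c1, c0 - 5*c4, -5*c3 + 4*c4, -5*c2 + 4*c3 - 25*c4, -5*c1 + 4*c2 - 25*c3 + 20*c4;
       c2, c1, c0 - 5*c4, -5*c3 + 4*c4, -5*c2 + 4*c3 - 25*c4;
       c3, c2 + 5*c4, c1 + 5*c3, c0 + 5*c2 + 20*c4, 5*c1 + 20*c3 + 4*c4;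
       c4, c3, c2 + 5*c4, c1 + 5*c3, c0 + 5*c2 + 20*c4] := by
  have key : ∀ (j : Fin 5) (v : Fin 5 → ℚ),
      (c0 + c1 * w + c2 * w ^ 2 + c3 * w ^ 3 + c4 * w ^ 4) * w ^ (j : ℕ) =
        ∑ i, v i • hw.basis i → ∀ i, Algebra.leftMulMatrix hw.basis
          (c0 + c1 * w + c2 * w ^ 2 + c3 * w ^ 3 + c4 * w ^ 4) i j = v i := by
    intro j v h i
    rw [Algebra.leftMulMatrix_eq_repr_mul, basis_apply, h, hw.basis.repr_sum_self]
  have r5 := hw.root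
  have r6 : w ^ 6 = 5 * w ^ 4 - 5 * w ^ 2 + 4 * w := by linear_combination w * r5
  have r7 : w ^ 7 = 20 * w ^ 3 + 4 * w ^ 2 - 25 * w + 20 := by
    linear_combination (w ^ 2 + 5) * r5
  have r8 : w ^ 8 = 20 * w ^ 4 + 4 * w ^ 3 - 25 * w ^ 2 + 20 * w := by
    linear_combination (w ^ 3 + 5 * w) * r5
  have k0 := key 0 ![c0, c1, c2, c3, c4] (by
    simp [Fin.sum_univ_five, Algebra.smul_def])
  have k1 := key 1 ![4*c4, c0 - 5*c4, c1, c2 + 5*c4, c3] (by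
    simp [Fin.sum_univ_five, Algebra.smul_def]; linear_combination (c4 : K) * r5)
  have k2 := key 2 ![4*c3, -5*c3 + 4*c4, c0 - 5*c4, c1 + 5*c3, c2 + 5*c4] (by
    simp [Fin.sum_univ_five, Algebra.smul_def]; linear_combination (c3 : K) * r5 + (c4 : K) * r6)
  have k3 := key 3 ![4*c2 + 20*c4, -5*c2 + 4*c3 - 25*c4, -5*c3 + 4*c4, c0 + 5*c2 + 20*c4,
      c1 + 5*c3] (by
    simp [Fin.sum_univ_five, Algebra.smul_def]
    linear_combination (c2 : K) * r5 + (c3 : K) * r6 + (c4 : K) * r7)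
  have k4 := key 4 ![4*c1 + 20*c3, -5*c1 + 4*c2 - 25*c3 + 20*c4, -5*c2 + 4*c3 - 25*c4,
      5*c1 + 20*c3 + 4*c4, c0 + 5*c2 + 20*c4] (by
    simp [Fin.sum_univ_five, Algebra.smul_def]
    linear_combination (c1 : K) * r5 + (c2 : K) * r6 + (c3 : K) * r7 + (c4 : K) * r8)
  ext i j
  fin_cases j
  · rw [show ((⟨0, by decide⟩ : Fin 5)) = 0 from rfl, k0]; fin_cases i <;> rfl
  · rw [show ((⟨1, by decide⟩ : Fin 5)) = 1 from rfl, k1]; fin_cases i <;> rfl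
  · rw [show ((⟨2, by decide⟩ : Fin 5)) = 2 from rfl, k2]; fin_cases i <;> rfl
  · rw [show ((⟨3, by decide⟩ : Fin 5)) = 3 from rfl, k3]; fin_cases i <;> rfl
  · rw [show ((⟨4, by decide⟩ : Fin 5)) = 4 from rfl, k4]; fin_cases i <;> rfl

lemma norm_eq (hw : IsGen w) (c0 c1 c2 c3 c4 : ℚ) :
    Algebra.norm ℚ (c0 + c1 * w + c2 * w ^ 2 + c3 * w ^ 3 + c4 * w ^ 4 : K) =
    !![c0, 4*c4, 4*c3, 4*c2 + 20*c4, 4*c1 + 20*c3;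
       c1, c0 - 5*c4, -5*c3 + 4*c4, -5*c2 + 4*c3 - 25*c4, -5*c1 + 4*c2 - 25*c3 + 20*c4;
       c2, c1, c0 - 5*c4, -5*c3 + 4*c4, -5*c2 + 4*c3 - 25*c4;
       c3, c2 + 5*c4, c1 + 5*c3, c0 + 5*c2 + 20*c4, 5*c1 + 20*c3 + 4*c4;
       c4, c3, c2 + 5*c4, c1 + 5*c3, c0 + 5*c2 + 20*c4].det := by
  rw [Algebra.norm_eq_matrix_det hw.basis, hw.leftMulMatrix_eq]

lemma trace_eq (hw : IsGen w) (c0 c1 c2 c3 c4 : ℚ) :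
    Algebra.trace ℚ K (c0 + c1 * w + c2 * w ^ 2 + c3 * w ^ 3 + c4 * w ^ 4) =
      5 * c0 + 10 * c2 + 30 * c4 := by
  rw [Algebra.trace_eq_matrix_trace hw.basis, hw.leftMulMatrix_eq]
  simp [Matrix.trace, Fin.sum_univ_five]
  ring

end IsGen
end

section
variable {K : Type*} [Field K] [NumberField K] {w : K}

namespace IsGen

lemma isIntegral (hw : IsGen w) : IsIntegral ℤ w :=
  ⟨genPoly, genPoly_monic, by simpa [aeval_def] using hw.aeval_genPoly⟩

/-- The generator as an algebraic integer. -/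
noncomputable def int (hw : IsGen w) : 𝓞 K := ⟨w, hw.isIntegral⟩

@[simp] lemma coe_int (hw : IsGen w) : (hw.int : K) = w := rfl

lemma int_root (hw : IsGen w) : hw.int ^ 5 = 5 * hw.int ^ 3 - 5 * hw.int + 4 := by
  apply RingOfIntegers.ext
  simpa only [map_add, map_sub, map_mul, map_pow, map_ofNat, coe_int] using hw.root

/-- The algebraic integer with the given coordinates. -/
noncomputable def el (hw : IsGen w) (a b c d e : ℤ) : 𝓞 K :=
  a + b * hw.int + c * hw.int ^ 2 + d * hw.int ^ 3 + e * hw.int ^ 4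

lemma coe_el (hw : IsGen w) (a b c d e : ℤ) :
    (hw.el a b c d e : K) = a + b * w + c * w ^ 2 + d * w ^ 3 + e * w ^ 4 := by
  simp [el]

lemma norm_el (hw : IsGen w) (c0 c1 c2 c3 c4 : ℤ) :
    Algebra.norm ℤ (hw.el c0 c1 c2 c3 c4) =
    !![c0, 4*c4, 4*c3, 4*c2 + 20*c4, 4*c1 + 20*c3;
       c1, c0 - 5*c4, -5*c3 + 4*c4, -5*c2 + 4*c3 - 25*c4, -5*c1 + 4*c2 - 25*c3 + 20*c4;
       c2, c1, c0 - 5*c4, -5*c3 + 4*c4, -5*c2 + 4*c3 - 25*c4;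
       c3, c2 + 5*c4, c1 + 5*c3, c0 + 5*c2 + 20*c4, 5*c1 + 20*c3 + 4*c4;
       c4, c3, c2 + 5*c4, c1 + 5*c3, c0 + 5*c2 + 20*c4].det := by
  have h := Algebra.coe_norm_int (hw.el c0 c1 c2 c3 c4)
  have h2 := hw.norm_eq c0 c1 c2 c3 c4
  push_cast at h2
  rw [coe_el, h2] at h
  rw [← Int.cast_inj (α := ℚ), h]
  refine Eq.trans ?_ (RingHom.map_det (Int.castRingHom ℚ) _).symm
  congr 1
  ext i j
  fin_cases i <;> fin_cases j <;> simp

lemma discr_basis (hw : IsGen w) : Algebra.discr ℚ hw.basis = 450000 := by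
  have r5 := hw.root
  have t : ∀ (n : ℕ) (c0 c1 c2 c3 c4 : ℚ),
      w ^ n = c0 + c1 * w + c2 * w ^ 2 + c3 * w ^ 3 + c4 * w ^ 4 →
      Algebra.trace ℚ K (w ^ n) = 5 * c0 + 10 * c2 + 30 * c4 := by
    intro n c0 c1 c2 c3 c4 h
    rw [h, hw.trace_eq]
  have t0 : Algebra.trace ℚ K 1 = 5 := by simpa using t 0 1 0 0 0 0 (by simp)
  have t1 : Algebra.trace ℚ K w = 0 := by simpa using t 1 0 1 0 0 0 (by simp)
  have t2 := t 2 0 0 1 0 0 (by simp)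
  have t3 := t 3 0 0 0 1 0 (by simp)
  have t4 := t 4 0 0 0 0 1 (by simp)
  have t5 := t 5 4 (-5) 0 5 0 (by push_cast; linear_combination r5)
  have t6 := t 6 0 4 (-5) 0 5 (by push_cast; linear_combination w * r5)
  have t7 := t 7 20 (-25) 4 20 0 (by push_cast; linear_combination (w ^ 2 + 5) * r5)
  have t8 := t 8 0 20 (-25) 4 20 (by push_cast; linear_combination (w ^ 3 + 5 * w) * r5)
  have : Algebra.traceMatrix ℚ hw.basis = !![5, 0, 10, 0, 30; 0, 10, 0, 30, 20;
      10, 0, 30, 20, 100; 0, 30, 20, 100, 140; 30, 20, 100, 140, 350] := by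
    ext i j
    rw [Algebra.traceMatrix_apply, Algebra.traceForm_apply, basis_apply, basis_apply, ← pow_add]
    fin_cases i <;> fin_cases j <;> simp [t0, t1, t2, t3, t4, t5, t6, t7, t8] <;>
      norm_num
  rw [Algebra.discr_def, this]
  simp [Matrix.det_succ_row_zero, Fin.sum_univ_succ, Fin.succAbove]
  norm_num

end IsGen
end

section
variable {K : Type*} [Field K] [NumberField K] {w : K}

namespace IsGen

lemma abs_discr_le (hw : IsGen w) : |discr K| ≤ 450000 := by
  classical
  have hcard : Fintype.card (Module.Free.ChooseBasisIndex ℤ (𝓞 K)) = Fintype.card (Fin 5) := by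
    rw [← Module.finrank_eq_card_basis (integralBasis K), hw.finrank]; rfl
  let e := Fintype.equivOfCardEq hcard
  let Z : Matrix (Module.Free.ChooseBasisIndex ℤ (𝓞 K)) (Module.Free.ChooseBasisIndex ℤ (𝓞 K)) ℤ :=
    fun i j => (RingOfIntegers.basis K).repr (hw.int ^ (e i : ℕ)) j
  have hv : (hw.basis ∘ e.symm.symm) =
      ((Z.map (Int.castRingHom ℚ)).map (algebraMap ℚ K)).mulVec (integralBasis K) := by
    funext i
    have h1 := (integralBasis K).sum_repr (algebraMap (𝓞 K) K (hw.int ^ (e i : ℕ)))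
    have h2 : (hw.basis ∘ e.symm.symm) i = algebraMap (𝓞 K) K (hw.int ^ (e i : ℕ)) := by
      simp
    rw [h2, ← h1]
    simp only [integralBasis_repr_apply, Matrix.mulVec, dotProduct, Matrix.map_apply,
      Algebra.smul_def]
    rfl
  have hd : Algebra.discr ℚ (hw.basis ∘ e.symm.symm) = 450000 := by
    rw [Algebra.discr_reindex, hw.discr_basis]
  rw [hv, Algebra.discr_of_matrix_mulVec, ← coe_discr] at hd
  have hdet : (Z.map (Int.castRingHom ℚ)).det = (Z.det : ℚ) :=
    (RingHom.map_det (Int.castRingHom ℚ) Z).symm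
  rw [hdet] at hd
  have hd' : Z.det ^ 2 * discr K = 450000 := by exact_mod_cast hd
  have hne : Z.det ≠ 0 := by rintro h; rw [h] at hd'; norm_num at hd'
  have h1 : 1 ≤ Z.det ^ 2 := by
    have := sq_pos_of_ne_zero hne
    omega
  have hpos : 0 < discr K := by nlinarith
  rw [abs_of_pos hpos]
  nlinarith

lemma nrRealPlaces_eq (hw : IsGen w) : InfinitePlace.nrRealPlaces K = 1 := by
  classical
  have hodd : Odd (Module.finrank ℚ K) := by rw [hw.finrank]; decide
  have hpos := InfinitePlace.nrRealPlaces_pos_of_odd_finrank hodd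
  have hle : InfinitePlace.nrRealPlaces K ≤ 1 := by
    rw [← InfinitePlace.card_real_embeddings, Fintype.card_le_one_iff]
    rintro ⟨φ, hφ⟩ ⟨ψ, hψ⟩
    have real : ∀ χ : K →+* ℂ, ComplexEmbedding.IsReal χ → ∃ x : ℝ, χ w = x ∧
        x ^ 5 = 5 * x ^ 3 - 5 * x + 4 := by
      intro χ hχ
      have hc : (starRingEnd ℂ) (χ w) = χ w := RingHom.congr_fun hχ w
      obtain ⟨x, hx⟩ := Complex.conj_eq_iff_real.1 hc
      refine ⟨x, hx, ?_⟩
      have := congrArg χ hw.root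
      simp only [map_add, map_sub, map_mul, map_pow, map_ofNat, hx] at this
      exact_mod_cast this
    have big : ∀ x : ℝ, x ^ 5 = 5 * x ^ 3 - 5 * x + 4 → 2 < x := by
      intro x hx
      by_contra hc
      have : 0 ≤ (2 - x) * (x ^ 2 + x - 1) ^ 2 := mul_nonneg (by linarith) (sq_nonneg _)
      nlinarith
    obtain ⟨x, hx, hx5⟩ := real φ hφ
    obtain ⟨y, hy, hy5⟩ := real ψ hψ
    have hx2 := big x hx5
    have hy2 := big y hy5
    have hxy : x = y := by
      have hprod : (x - y) * (x ^ 4 + x ^ 3 * y + x ^ 2 * y ^ 2 + x * y ^ 3 + y ^ 4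
          - 5 * (x ^ 2 + x * y + y ^ 2) + 5) = 0 := by linear_combination hx5 - hy5
      have h4 : 4 < x * y := by nlinarith
      have hx4 : 4 < x ^ 2 := by nlinarith
      have hy4 : 4 < y ^ 2 := by nlinarith
      have : 0 < x ^ 4 + x ^ 3 * y + x ^ 2 * y ^ 2 + x * y ^ 3 + y ^ 4
          - 5 * (x ^ 2 + x * y + y ^ 2) + 5 := by
        nlinarith [mul_pos (sub_pos.2 h4) (sub_pos.2 hx4), mul_pos (sub_pos.2 h4) (sub_pos.2 hy4),
          mul_pos (sub_pos.2 h4) (sub_pos.2 h4), mul_pos (sub_pos.2 hx4) (sub_pos.2 hx4),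
          mul_pos (sub_pos.2 hy4) (sub_pos.2 hy4)]
      have := (mul_eq_zero.1 hprod).resolve_right this.ne'
      linarith
    refine Subtype.ext ?_
    have hQ : φ.toRatAlgHom = ψ.toRatAlgHom := by
      refine AlgHom.toLinearMap_injective (hw.basis.ext fun i => ?_)
      simp only [basis_apply, AlgHom.toLinearMap_apply, map_pow]
      have : φ w = ψ w := by rw [hx, hy, hxy]
      exact congrArg (· ^ (i : ℕ)) this
    ext z
    exact AlgHom.congr_fun hQ z
  omega

lemma nrComplexPlaces_eq (hw : IsGen w) : InfinitePlace.nrComplexPlaces K = 2 := by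
  have h := InfinitePlace.card_add_two_mul_card_eq_rank K
  rw [hw.finrank, hw.nrRealPlaces_eq] at h
  omega

lemma minkowski_lt (hw : IsGen w) : (4 / Real.pi) ^ InfinitePlace.nrComplexPlaces K *
    ((Module.finrank ℚ K).factorial / (Module.finrank ℚ K) ^ (Module.finrank ℚ K) *
      √|discr K|) < 42 := by
  rw [hw.nrComplexPlaces_eq, hw.finrank]
  have h1 : √((|discr K| : ℤ) : ℝ) ≤ 670.83 := by
    rw [Real.sqrt_le_left (by norm_num)]
    have : ((|discr K| : ℤ) : ℝ) ≤ 450000 := by exact_mod_cast hw.abs_discr_le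
    norm_num
    push_cast at this
    linarith
  have h2 : 4 / Real.pi ≤ 1.2733 := by
    rw [div_le_iff₀ Real.pi_pos]
    have := Real.pi_gt_d4
    norm_num at this ⊢
    linarith
  have h3 : (4 / Real.pi) ^ 2 ≤ 1.2733 ^ 2 := by
    gcongr
  calc _ ≤ (1.2733 : ℝ) ^ 2 * ((Nat.factorial 5 : ℕ) / ((5 : ℕ) : ℝ) ^ 5 * 670.83) := by
        gcongr
        simpa using h1
    _ < 42 := by norm_num [Nat.factorial]

end IsGen
end

section
variable {K : Type*} [Field K] [NumberField K] {w : K}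

namespace IsGen

lemma map_int_root (hw : IsGen w) {F : Type*} [CommRing F] (φ : 𝓞 K →+* F) :
    φ hw.int ^ 5 = 5 * φ hw.int ^ 3 - 5 * φ hw.int + 4 := by
  simpa only [map_add, map_sub, map_mul, map_pow, map_ofNat] using congrArg φ hw.int_root

lemma map_el (hw : IsGen w) {F : Type*} [CommRing F] (φ : 𝓞 K →+* F) (a b c d e : ℤ) :
    φ (hw.el a b c d e) =
      a + b * φ hw.int + c * φ hw.int ^ 2 + d * φ hw.int ^ 3 + e * φ hw.int ^ 4 := by
  simp [el]

end IsGen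

lemma exists_hom_of_absNorm_eq {P : Ideal (𝓞 K)} {p : ℕ} (hp : p.Prime)
    (h : Ideal.absNorm P = p) : ∃ φ : 𝓞 K →+* ZMod p, ∀ z, φ z = 0 ↔ z ∈ P := by
  have hcard : Nat.card (𝓞 K ⧸ P) = p := by
    rw [← h]; rfl
  have : Finite (𝓞 K ⧸ P) := Nat.finite_of_card_ne_zero (by rw [hcard]; exact hp.ne_zero)
  have := Fintype.ofFinite (𝓞 K ⧸ P)
  rw [Nat.card_eq_fintype_card] at hcard
  refine ⟨(ZMod.ringEquivOfPrime (𝓞 K ⧸ P) hp hcard).symm.toRingHom.comp (Ideal.Quotient.mk P),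
    fun z => ?_⟩
  rw [← Ideal.Quotient.eq_zero_iff_mem]
  simp

lemma prime_of_natAbs_norm {z : 𝓞 K} {p : ℕ} (hp : p.Prime)
    (h : (Algebra.norm ℤ z).natAbs = p) : Prime z := by
  have hz : z ≠ 0 := by
    rintro rfl
    simp at h
    exact hp.ne_zero h.symm
  refine Ideal.prime_of_irreducible_absNorm_span hz ?_
  rw [Ideal.absNorm_span_singleton, h]
  exact hp

lemma eq_span_of_prime_mem {P : Ideal (𝓞 K)} [hP : P.IsPrime] {z : 𝓞 K} (hz : Prime z)
    (h : z ∈ P) : P = Ideal.span {z} := by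
  have h1 : (Ideal.span {z}).IsPrime := (Ideal.span_singleton_prime hz.ne_zero).2 hz
  have h2 : (Ideal.span {z}).IsMaximal := h1.isMaximal (by
    rw [Ne, Ideal.span_singleton_eq_bot]; exact hz.ne_zero)
  exact (h2.eq_of_le hP.ne_top (by rwa [Ideal.span_singleton_le_iff_mem])).symm

/-- An element of norm `p ^ 2` is prime if it maps to a unit under every residue map of degree
one. -/
lemma prime_of_natAbs_norm_sq {z : 𝓞 K} {p : ℕ} (hp : p.Prime)
    (h : (Algebra.norm ℤ z).natAbs = p ^ 2) (hφ : ∀ φ : 𝓞 K →+* ZMod p, φ z ≠ 0) : Prime z := by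
  have hz : z ≠ 0 := by
    rintro rfl
    simp at h
    exact pow_ne_zero 2 hp.ne_zero h.symm
  have hu : ¬ IsUnit z := by
    intro hu
    have := Int.isUnit_iff_natAbs_eq.1 (hu.map (Algebra.norm ℤ))
    rw [h] at this
    exact hp.one_lt.ne' ((Nat.pow_eq_one.1 this).resolve_right two_ne_zero)
  have hnt : Ideal.span {z} ≠ ⊤ := by rwa [Ne, Ideal.span_singleton_eq_top]
  obtain ⟨P, hP, hle⟩ := Ideal.exists_le_maximal _ hnt
  have hdvd := Ideal.absNorm_dvd_absNorm_of_le hle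
  rw [Ideal.absNorm_span_singleton, h, Nat.dvd_prime_pow hp] at hdvd
  obtain ⟨k, hk, hk'⟩ := hdvd
  have hzP : z ∈ P := hle (Ideal.mem_span_singleton_self z)
  interval_cases k
  · rw [pow_zero, Ideal.absNorm_eq_one_iff] at hk'
    exact absurd hk' hP.ne_top
  · rw [pow_one] at hk'
    obtain ⟨φ, hφ'⟩ := exists_hom_of_absNorm_eq hp hk'
    exact absurd ((hφ' z).2 hzP) (hφ φ)
  · obtain ⟨J, hJ⟩ := Ideal.dvd_iff_le.2 hle
    have hn := congrArg Ideal.absNorm hJ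
    rw [map_mul, hk', Ideal.absNorm_span_singleton, h] at hn
    have hJ1 : Ideal.absNorm J = 1 := by
      have := pow_pos hp.pos 2
      exact (Nat.eq_of_mul_eq_mul_left this (by rw [mul_one]; exact hn)).symm
    rw [Ideal.absNorm_eq_one_iff] at hJ1
    rw [hJ1, Ideal.mul_top] at hJ
    rw [← Ideal.span_singleton_prime hz, hJ]
    exact hP.isPrime

namespace IsGen

noncomputable def p2 (hw : IsGen w) : 𝓞 K := hw.el (-2) 1 0 0 0
noncomputable def p4 (hw : IsGen w) : 𝓞 K := hw.el 3 (-1) 2 1 (-1)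
noncomputable def p3 (hw : IsGen w) : 𝓞 K := hw.el (-1) 1 0 0 0
noncomputable def p9 (hw : IsGen w) : 𝓞 K := hw.el (-3) (-1) 2 1 0
noncomputable def p5 (hw : IsGen w) : 𝓞 K := hw.el (-1) (-1) 0 0 0

lemma norm_p2 (hw : IsGen w) : Algebra.norm ℤ hw.p2 = 2 := by
  rw [p2, norm_el]; simp [Matrix.det_succ_row_zero, Fin.sum_univ_succ, Fin.succAbove]
lemma norm_p4 (hw : IsGen w) : Algebra.norm ℤ hw.p4 = 4 := by
  rw [p4, norm_el]; simp [Matrix.det_succ_row_zero, Fin.sum_univ_succ, Fin.succAbove]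
lemma norm_p3 (hw : IsGen w) : Algebra.norm ℤ hw.p3 = 3 := by
  rw [p3, norm_el]; simp [Matrix.det_succ_row_zero, Fin.sum_univ_succ, Fin.succAbove]
lemma norm_p9 (hw : IsGen w) : Algebra.norm ℤ hw.p9 = 9 := by
  rw [p9, norm_el]; simp [Matrix.det_succ_row_zero, Fin.sum_univ_succ, Fin.succAbove]
lemma norm_p5 (hw : IsGen w) : Algebra.norm ℤ hw.p5 = -5 := by
  rw [p5, norm_el]; simp [Matrix.det_succ_row_zero, Fin.sum_univ_succ, Fin.succAbove]

lemma prime_p2 (hw : IsGen w) : Prime hw.p2 :=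
  prime_of_natAbs_norm Nat.prime_two (by rw [norm_p2]; rfl)
lemma prime_p3 (hw : IsGen w) : Prime hw.p3 :=
  prime_of_natAbs_norm Nat.prime_three (by rw [norm_p3]; rfl)
lemma prime_p5 (hw : IsGen w) : Prime hw.p5 :=
  prime_of_natAbs_norm Nat.prime_five (by rw [norm_p5]; rfl)

lemma prime_p4 (hw : IsGen w) : Prime hw.p4 := by
  refine prime_of_natAbs_norm_sq Nat.prime_two (by rw [norm_p4]; rfl) fun φ => ?_
  have h := hw.map_int_root φ
  rw [p4, map_el]
  generalize φ hw.int = r at *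
  revert r; decide

lemma prime_p9 (hw : IsGen w) : Prime hw.p9 := by
  refine prime_of_natAbs_norm_sq Nat.prime_three (by rw [norm_p9]; rfl) fun φ => ?_
  have h := hw.map_int_root φ
  rw [p9, map_el]
  generalize φ hw.int = r at *
  revert r; decide

lemma int_rel (hw : IsGen w) : hw.int ^ 5 - 5 * hw.int ^ 3 + 5 * hw.int - 4 = 0 := by
  rw [hw.int_root]; ring

lemma two_eq (hw : IsGen w) :
    (2 : 𝓞 K) = hw.el 10745 (-8240) (-3981) 11508 5560 * (hw.p2 * hw.p4 ^ 2) := by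
  simp only [p2, p4, el]; push_cast
  linear_combination ((-48353) + (33050) * hw.int ^ 1 + (-69993) * hw.int ^ 2 + (-9640) *
    hw.int ^ 3 + (22205) * hw.int ^ 4 + (-32252) * hw.int ^ 5 + (16653) * hw.int ^ 6 + (10732) *
    hw.int ^ 7 + (-5560) * hw.int ^ 8) * hw.int_rel
lemma three_eq (hw : IsGen w) : (3 : 𝓞 K) = hw.el (-3) 5 (-2) (-4) 2 * (hw.p3 * hw.p9 ^ 2) := by
  simp only [p3, p9, el]; push_cast
  linear_combination ((6) + (-6) * hw.int ^ 1 + (-12) * hw.int ^ 2 + (7) * hw.int ^ 3 + (8) *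
    hw.int ^ 4 + (-2) * hw.int ^ 5 + (-2) * hw.int ^ 6) * hw.int_rel
lemma five_eq (hw : IsGen w) : (5 : 𝓞 K) = hw.el 3 (-5) 2 4 (-2) * hw.p5 ^ 5 := by
  simp only [p5, el]; push_cast
  linear_combination ((-2) + (-5) * hw.int ^ 1 + (-8) * hw.int ^ 2 + (-6) * hw.int ^ 3 + (-2) *
    hw.int ^ 4) * hw.int_rel

/-- A prime containing a rational prime dividing `30` is generated by one of the listed primes. -/
lemma mem_of_dvd_thirty (hw : IsGen w) {P : Ideal (𝓞 K)} [hP : P.IsPrime] (h : (30 : 𝓞 K) ∈ P) :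
    hw.p2 ∈ P ∨ hw.p4 ∈ P ∨ hw.p3 ∈ P ∨ hw.p9 ∈ P ∨ hw.p5 ∈ P := by
  have aux : ∀ {u x : 𝓞 K}, u * x ∈ P → IsUnit u → x ∈ P := fun h hu =>
    (hP.mem_or_mem h).resolve_left fun h' => hP.ne_top (Ideal.eq_top_of_isUnit_mem _ h' hu)
  have unit_of_norm : ∀ a b c d e, (Algebra.norm ℤ (hw.el a b c d e)).natAbs = 1 →
      IsUnit (hw.el a b c d e) := by
    intro a b c d e h
    rw [← Ideal.span_singleton_eq_top, ← Ideal.absNorm_eq_one_iff, Ideal.absNorm_span_singleton, h]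
  have h30 : (30 : 𝓞 K) = 2 * 3 * 5 := by norm_num
  rw [h30] at h
  rcases hP.mem_or_mem h with h | h
  · rcases hP.mem_or_mem h with h | h
    · rw [hw.two_eq] at h
      have := aux h (unit_of_norm _ _ _ _ _ (by
        rw [norm_el]; simp [Matrix.det_succ_row_zero, Fin.sum_univ_succ, Fin.succAbove]))
      rcases hP.mem_or_mem this with h | h
      · exact Or.inl h
      · exact Or.inr (Or.inl (hP.mem_of_pow_mem _ h))
    · rw [hw.three_eq] at h
      have := aux h (unit_of_norm _ _ _ _ _ (by
        rw [norm_el]; simp [Matrix.det_succ_row_zero, Fin.sum_univ_succ, Fin.succAbove]))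
      rcases hP.mem_or_mem this with h | h
      · exact Or.inr (Or.inr (Or.inl h))
      · exact Or.inr (Or.inr (Or.inr (Or.inl (hP.mem_of_pow_mem _ h))))
  · rw [hw.five_eq] at h
    have := aux h (unit_of_norm _ _ _ _ _ (by
        rw [norm_el]; simp [Matrix.det_succ_row_zero, Fin.sum_univ_succ, Fin.succAbove]))
    exact Or.inr (Or.inr (Or.inr (Or.inr (hP.mem_of_pow_mem _ this))))

lemma principal_of_residue (hw : IsGen w) {P : Ideal (𝓞 K)} [hP : P.IsPrime] {p : ℕ}
    (hp : p.Prime) (h : Ideal.absNorm P = p) (a b c d e : ℤ)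
    (hn : (Algebra.norm ℤ (hw.el a b c d e)).natAbs = p)
    (hr : ∀ r : ZMod p, r ^ 5 = 5 * r ^ 3 - 5 * r + 4 →
      (a + b * r + c * r ^ 2 + d * r ^ 3 + e * r ^ 4 : ZMod p) = 0) :
    Submodule.IsPrincipal P := by
  obtain ⟨φ, hφ⟩ := exists_hom_of_absNorm_eq hp h
  have hmem : hw.el a b c d e ∈ P := by
    rw [← hφ, map_el]
    exact hr _ (hw.map_int_root φ)
  exact ⟨_, eq_span_of_prime_mem (prime_of_natAbs_norm hp hn) hmem⟩

lemma no_residue (hw : IsGen w) {P : Ideal (𝓞 K)} {p : ℕ}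
    (hp : p.Prime) (h : Ideal.absNorm P = p)
    (hr : ∀ r : ZMod p, r ^ 5 ≠ 5 * r ^ 3 - 5 * r + 4) : Submodule.IsPrincipal P := by
  obtain ⟨φ, -⟩ := exists_hom_of_absNorm_eq hp h
  exact absurd (hw.map_int_root φ) (hr _)

lemma isPrincipalIdealRing (hw : IsGen w) : IsPrincipalIdealRing (𝓞 K) := by
  refine RingOfIntegers.isPrincipalIdealRing_of_isPrincipal_of_norm_le_of_isPrime ?_
  rintro ⟨P, hP0⟩ hP hle
  have hP : P.IsPrime := hP
  have hlt : Ideal.absNorm P < 42 := by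
    have := hle.trans_lt hw.minkowski_lt
    exact_mod_cast this
  have hmem : ((Ideal.absNorm P : ℕ) : 𝓞 K) ∈ P := Ideal.absNorm_mem P
  have hpos : Ideal.absNorm P ≠ 0 := by
    rw [Ne, Ideal.absNorm_eq_zero_iff]
    exact nonZeroDivisors.ne_zero hP0
  change Submodule.IsPrincipal P
  obtain ⟨p, hp, hpn, hpP⟩ : ∃ p : ℕ, p.Prime ∧ p ∣ Ideal.absNorm P ∧ (p : 𝓞 K) ∈ P := by
    have : ∀ n : ℕ, n ≠ 0 → (n : 𝓞 K) ∈ P → ∃ p : ℕ, p.Prime ∧ p ∣ n ∧ (p : 𝓞 K) ∈ P := by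
      intro n
      induction n using Nat.recOnMul with
      | zero => intro h; exact absurd rfl h
      | one =>
        intro _ h
        rw [Nat.cast_one] at h
        exact absurd ((Ideal.eq_top_iff_one P).2 h) hP.ne_top
      | prime p hp => intro _ h; exact ⟨p, hp, dvd_rfl, h⟩
      | mul a b ha hb =>
        intro h0 h
        rw [Nat.cast_mul] at h
        rcases hP.mem_or_mem h with h | h
        · obtain ⟨p, h1, h2, h3⟩ := ha (left_ne_zero_of_mul h0) h
          exact ⟨p, h1, h2.mul_right _, h3⟩
        · obtain ⟨p, h1, h2, h3⟩ := hb (right_ne_zero_of_mul h0) h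
          exact ⟨p, h1, h2.mul_left _, h3⟩
    exact this _ hpos hmem
  have hp42 : p < 42 := (Nat.le_of_dvd (Nat.pos_of_ne_zero hpos) hpn).trans_lt hlt
  by_cases h30 : p ∣ 30
  · obtain ⟨k, hk⟩ := h30
    have : (30 : 𝓞 K) ∈ P := by
      have h := P.mul_mem_right (k : 𝓞 K) hpP
      rw [← Nat.cast_mul, ← hk] at h
      exact_mod_cast h
    rcases hw.mem_of_dvd_thirty this with h | h | h | h | h
    · exact ⟨_, eq_span_of_prime_mem hw.prime_p2 h⟩
    · exact ⟨_, eq_span_of_prime_mem hw.prime_p4 h⟩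
    · exact ⟨_, eq_span_of_prime_mem hw.prime_p3 h⟩
    · exact ⟨_, eq_span_of_prime_mem hw.prime_p9 h⟩
    · exact ⟨_, eq_span_of_prime_mem hw.prime_p5 h⟩
  · have hnp : Ideal.absNorm P = p := by
      have hd : Ideal.absNorm P ∣ p ^ 5 := by
        have h1 := Ideal.absNorm_dvd_absNorm_of_le ((Ideal.span_singleton_le_iff_mem P).2 hpP)
        rwa [Ideal.absNorm_span_natCast, RingOfIntegers.rank, hw.finrank] at h1
      obtain ⟨k, -, hk⟩ := (Nat.dvd_prime_pow hp).1 hd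
      have h7 : 7 ≤ p := by
        by_contra hc
        have h2 := hp.two_le
        interval_cases p <;> revert hp h30 <;> decide
      have hk2 : k < 2 := by
        by_contra hc
        have h1 : p ^ 2 ≤ p ^ k := Nat.pow_le_pow_right hp.pos (by omega)
        nlinarith
      interval_cases k
      · rw [pow_zero] at hk
        rw [hk, Nat.dvd_one] at hpn
        exact absurd hpn hp.one_lt.ne'
      · rw [hk, pow_one]
    have hcases : p = 7 ∨ p = 11 ∨ p = 13 ∨ p = 17 ∨ p = 19 ∨ p = 23 ∨ p = 29 ∨ p = 31 ∨ p = 37 ∨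
        p = 41 := by
      have : ∀ q < 42, q.Prime → ¬ q ∣ 30 → q ∈ [7, 11, 13, 17, 19, 23, 29, 31, 37, 41] := by
        decide
      simpa using this p hp42 hp h30
    rcases hcases with rfl | rfl | rfl | rfl | rfl | rfl | rfl | rfl | rfl | rfl
    · exact hw.principal_of_residue hp hnp (-3) 1 1 (-2) (-1) (by
        rw [norm_el]; simp [Matrix.det_succ_row_zero, Fin.sum_univ_succ, Fin.succAbove]) (by decide)
    · exact hw.no_residue hp hnp (by decide)
    · exact hw.principal_of_residue hp hnp (-3) 0 1 0 0 (by
        rw [norm_el]; simp [Matrix.det_succ_row_zero, Fin.sum_univ_succ, Fin.succAbove]) (by decide)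
    · exact hw.principal_of_residue hp hnp (-1) 1 (-1) (-1) 0 (by
        rw [norm_el]; simp [Matrix.det_succ_row_zero, Fin.sum_univ_succ, Fin.succAbove]) (by decide)
    · exact hw.no_residue hp hnp (by decide)
    · exact hw.principal_of_residue hp hnp (-1) 3 1 (-1) 0 (by
        rw [norm_el]; simp [Matrix.det_succ_row_zero, Fin.sum_univ_succ, Fin.succAbove]) (by decide)
    · exact hw.no_residue hp hnp (by decide)
    · exact hw.principal_of_residue hp hnp (-1) (-1) 3 1 (-1) (by
        rw [norm_el]; simp [Matrix.det_succ_row_zero, Fin.sum_univ_succ, Fin.succAbove]) (by decide)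
    · exact hw.principal_of_residue hp hnp (-1) 1 1 (-3) 1 (by
        rw [norm_el]; simp [Matrix.det_succ_row_zero, Fin.sum_univ_succ, Fin.succAbove]) (by decide)
    · exact hw.principal_of_residue hp hnp (-1) 2 1 (-1) 0 (by
        rw [norm_el]; simp [Matrix.det_succ_row_zero, Fin.sum_univ_succ, Fin.succAbove]) (by decide)

end IsGen
end

section
variable {K : Type*} [Field K] [NumberField K] {w : K}

namespace IsGen

lemma isUnit_of_norm {z : 𝓞 K} (h : (Algebra.norm ℤ z).natAbs = 1) : IsUnit z := by
  rw [← Ideal.span_singleton_eq_top, ← Ideal.absNorm_eq_one_iff, Ideal.absNorm_span_singleton, h]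

lemma isUnit_u1 (hw : IsGen w) : IsUnit (hw.el 1 (-1) 0 1 0) :=
  isUnit_of_norm (by
    rw [norm_el]; simp [Matrix.det_succ_row_zero, Fin.sum_univ_succ, Fin.succAbove])

lemma isUnit_u2 (hw : IsGen w) : IsUnit (hw.el 1 0 2 3 1) :=
  isUnit_of_norm (by
    rw [norm_el]; simp [Matrix.det_succ_row_zero, Fin.sum_univ_succ, Fin.succAbove])

noncomputable def u1 (hw : IsGen w) : (𝓞 K)ˣ := hw.isUnit_u1.unit
noncomputable def u2 (hw : IsGen w) : (𝓞 K)ˣ := hw.isUnit_u2.unit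

lemma coe_u1 (hw : IsGen w) : (hw.u1 : 𝓞 K) = hw.el 1 (-1) 0 1 0 := rfl
lemma coe_u2 (hw : IsGen w) : (hw.u2 : 𝓞 K) = hw.el 1 0 2 3 1 := rfl

lemma exists_hom_thirteen (hw : IsGen w) : ∃ φ : 𝓞 K →+* ZMod 13,
    φ hw.int ^ 5 = 5 * φ hw.int ^ 3 - 5 * φ hw.int + 4 := by
  obtain ⟨φ, -⟩ := exists_hom_of_absNorm_eq (P := Ideal.span {hw.el (-3) 0 1 0 0})
    (p := 13) (by norm_num) (by
      rw [Ideal.absNorm_span_singleton, norm_el]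
      simp [Matrix.det_succ_row_zero, Fin.sum_univ_succ, Fin.succAbove])
  exact ⟨φ, hw.map_int_root φ⟩

lemma exists_hom_seventeen (hw : IsGen w) : ∃ φ : 𝓞 K →+* ZMod 17,
    φ hw.int ^ 5 = 5 * φ hw.int ^ 3 - 5 * φ hw.int + 4 := by
  obtain ⟨φ, -⟩ := exists_hom_of_absNorm_eq (P := Ideal.span {hw.el (-1) 1 (-1) (-1) 0})
    (p := 17) (by norm_num) (by
      rw [Ideal.absNorm_span_singleton, norm_el]
      simp [Matrix.det_succ_row_zero, Fin.sum_univ_succ, Fin.succAbove])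
  exact ⟨φ, hw.map_int_root φ⟩

end IsGen

/-- `x` is a square up to sign. -/
def IsSqSign {R : Type*} [CommRing R] (x : Rˣ) : Prop := ∃ y : Rˣ, x = y ^ 2 ∨ x = -y ^ 2

namespace IsGen

lemma u1_not_isSqSign (hw : IsGen w) : ¬ IsSqSign hw.u1 := by
  rintro ⟨y, hy⟩
  obtain ⟨φ, hφ⟩ := hw.exists_hom_thirteen
  have hy' : (hw.el 1 (-1) 0 1 0) = (y : 𝓞 K) ^ 2 ∨ (hw.el 1 (-1) 0 1 0) = -(y : 𝓞 K) ^ 2 :=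
    hy.imp (fun h => by rw [← coe_u1, h]; simp) (fun h => by rw [← coe_u1, h]; simp)
  replace hy' := hy'.imp (congrArg φ) (congrArg φ)
  rw [map_el, map_neg, map_pow] at hy'
  generalize φ y = s at hy'
  generalize φ hw.int = r at hy' hφ
  revert r s; decide

lemma u2_not_isSqSign (hw : IsGen w) : ¬ IsSqSign hw.u2 := by
  rintro ⟨y, hy⟩
  obtain ⟨φ, hφ⟩ := hw.exists_hom_thirteen
  have hy' : (hw.el 1 0 2 3 1) = (y : 𝓞 K) ^ 2 ∨ (hw.el 1 0 2 3 1) = -(y : 𝓞 K) ^ 2 :=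
    hy.imp (fun h => by rw [← coe_u2, h]; simp) (fun h => by rw [← coe_u2, h]; simp)
  replace hy' := hy'.imp (congrArg φ) (congrArg φ)
  rw [map_el, map_neg, map_pow] at hy'
  generalize φ y = s at hy'
  generalize φ hw.int = r at hy' hφ
  revert r s; decide

set_option maxRecDepth 4000 in
lemma u1_mul_u2_not_isSqSign (hw : IsGen w) : ¬ IsSqSign (hw.u1 * hw.u2) := by
  rintro ⟨y, hy⟩
  obtain ⟨φ, hφ⟩ := hw.exists_hom_seventeen
  have hy' : (hw.el 1 (-1) 0 1 0) * (hw.el 1 0 2 3 1) = (y : 𝓞 K) ^ 2 ∨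
      (hw.el 1 (-1) 0 1 0) * (hw.el 1 0 2 3 1) = -(y : 𝓞 K) ^ 2 :=
    hy.imp (fun h => by rw [← coe_u1, ← coe_u2, ← Units.val_mul, h]; simp)
      (fun h => by rw [← coe_u1, ← coe_u2, ← Units.val_mul, h]; simp)
  replace hy' := hy'.imp (congrArg φ) (congrArg φ)
  rw [map_mul, map_el, map_el, map_neg, map_pow] at hy'
  generalize φ y = s at hy'
  generalize φ hw.int = r at hy' hφ
  revert r s; decide

lemma exists_fundamental (hw : IsGen w) : ∃ a b : (𝓞 K)ˣ, ∀ x : (𝓞 K)ˣ, ∃ m n : ℤ,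
    x = a ^ m * b ^ n ∨ x = -(a ^ m * b ^ n) := by
  have hr : Units.rank K = 2 := by
    rw [Units.rank, InfinitePlace.card_eq_nrRealPlaces_add_nrComplexPlaces, hw.nrRealPlaces_eq,
      hw.nrComplexPlaces_eq]
  refine ⟨Units.fundSystem K ((finCongr hr).symm 0), Units.fundSystem K ((finCongr hr).symm 1),
    fun x => ?_⟩
  obtain ⟨⟨ζ, e⟩, h, -⟩ := Units.exist_unique_eq_mul_prod K x
  refine ⟨e ((finCongr hr).symm 0), e ((finCongr hr).symm 1), ?_⟩
  have hp : ∏ i, Units.fundSystem K i ^ e i =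
      ∏ j : Fin 2, Units.fundSystem K ((finCongr hr).symm j) ^ e ((finCongr hr).symm j) :=
    (Equiv.prod_comp (finCongr hr).symm fun i => Units.fundSystem K i ^ e i).symm
  rw [Fin.prod_univ_two] at hp
  simp only [hp] at h
  have hodd : Odd (Module.finrank ℚ K) := by rw [hw.finrank]; decide
  rcases Units.torsion_eq_one_or_neg_one_of_odd_finrank hodd ζ with hζ | hζ
  · left; rw [h, hζ, one_mul]
  · right; rw [h, hζ, neg_mul, one_mul]

lemma exists_isSqSign (hw : IsGen w) (x : (𝓞 K)ˣ) : IsSqSign x ∨ IsSqSign (x * hw.u1) ∨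
    IsSqSign (x * hw.u2) ∨ IsSqSign (x * (hw.u1 * hw.u2)) := by
  obtain ⟨a, b, hab⟩ := hw.exists_fundamental
  have key : ∀ (z : (𝓞 K)ˣ) (m n : ℤ), z = a ^ m * b ^ n ∨ z = -(a ^ m * b ^ n) →
      2 ∣ m ∧ 2 ∣ n → IsSqSign z := by
    rintro z m n h ⟨⟨m, rfl⟩, ⟨n, rfl⟩⟩
    refine ⟨a ^ m * b ^ n, ?_⟩
    have : (a ^ m * b ^ n) ^ 2 = a ^ (2 * m) * b ^ (2 * n) := by
      rw [mul_pow, ← zpow_natCast, ← zpow_natCast, ← zpow_mul, ← zpow_mul]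
      congr 2 <;> push_cast <;> ring
    rwa [this]
  have mul : ∀ {y z : (𝓞 K)ˣ} {m n m' n' : ℤ}, (y = a ^ m * b ^ n ∨ y = -(a ^ m * b ^ n)) →
      (z = a ^ m' * b ^ n' ∨ z = -(a ^ m' * b ^ n')) →
      (y * z = a ^ (m + m') * b ^ (n + n') ∨ y * z = -(a ^ (m + m') * b ^ (n + n'))) := by
    intro y z m n m' n' hy hz
    have h0 : a ^ (m + m') * b ^ (n + n') = (a ^ m * b ^ n) * (a ^ m' * b ^ n') := by
      rw [zpow_add, zpow_add]; exact mul_mul_mul_comm _ _ _ _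
    rw [h0]
    rcases hy with hy | hy <;> rcases hz with hz | hz <;> rw [hy, hz]
    · left; rfl
    · right; rw [mul_neg]
    · right; rw [neg_mul]
    · left; rw [neg_mul_neg]
  obtain ⟨m, n, hx⟩ := hab x
  obtain ⟨m1, n1, h1⟩ := hab hw.u1
  obtain ⟨m2, n2, h2⟩ := hab hw.u2
  have k1 := mt (key _ _ _ h1) hw.u1_not_isSqSign
  have k2 := mt (key _ _ _ h2) hw.u2_not_isSqSign
  have k12 := mt (key _ _ _ (mul h1 h2)) hw.u1_mul_u2_not_isSqSign
  have c0 := key _ _ _ hx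
  have c1 := key _ _ _ (mul hx h1)
  have c2 := key _ _ _ (mul hx h2)
  have c12 := key _ _ _ (mul hx (mul h1 h2))
  by_contra! hc
  obtain ⟨d0, d1, d2, d12⟩ := hc
  replace d0 := mt c0 d0
  replace d1 := mt c1 d1
  replace d2 := mt c2 d2
  replace d12 := mt c12 d12
  clear c0 c1 c2 c12 key mul hab hx h1 h2
  omega

end IsGen
end

/-- Induction for divisors `A` of minus a square that are coprime to the cofactor away from `N`. -/
lemma induction_of_mul_eq_neg_sq {R : Type*} [CommRing R] [IsDomain R]
    [UniqueFactorizationMonoid R] {N : R} (T : R → Prop) (hunit : ∀ x, IsUnit x → T x)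
    (hsq : ∀ q x, T x → T (q ^ 2 * x)) (hbad : ∀ q x, Prime q → q ∣ N → T x → T (q * x))
    (A : R) : A ≠ 0 → ∀ E B : R, A * E = -B ^ 2 →
      (∀ q, Prime q → q ∣ A → q ∣ E → q ∣ N) → T A := by
  induction A using IsWellFounded.induction (DvdNotUnit (α := R)) with
  | _ A ih =>
    intro hA E B h hc
    by_cases hu : IsUnit A
    · exact hunit A hu
    obtain ⟨q, hq, A', rfl⟩ : ∃ q, Prime q ∧ q ∣ A := by
      obtain ⟨q, hq, hqA⟩ := WfDvdMonoid.exists_irreducible_factor hu hA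
      exact ⟨q, UniqueFactorizationMonoid.irreducible_iff_prime.1 hq, hqA⟩
    have hA' : A' ≠ 0 := right_ne_zero_of_mul hA
    by_cases hqN : q ∣ N
    · refine hbad q A' hq hqN (ih A' ⟨hA', q, hq.not_isUnit, mul_comm _ _⟩ hA' (q * E) B
        (by rw [← h]; ring) fun r hr hrA hrE => ?_)
      rcases hr.dvd_or_dvd hrE with h1 | h1
      · exact h1.trans hqN
      · exact hc r hr (hrA.mul_left _) h1
    · have hqE : ¬ q ∣ E := fun h1 => hqN (hc q hq (dvd_mul_right _ _) h1)
      obtain ⟨B', rfl⟩ : q ∣ B := hq.dvd_of_dvd_pow (n := 2)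
        (by rw [← dvd_neg, ← h, mul_assoc]; exact dvd_mul_right _ _)
      have h2 : A' * E = q * -B' ^ 2 := by
        apply mul_left_cancel₀ hq.ne_zero
        linear_combination h
      obtain ⟨A'', rfl⟩ : q ∣ A' :=
        (hq.dvd_or_dvd (h2 ▸ dvd_mul_right _ _)).resolve_right hqE
      have hA'' : A'' ≠ 0 := right_ne_zero_of_mul hA'
      rw [← mul_assoc, ← sq]
      refine hsq q A'' (ih A'' ⟨hA'', q ^ 2, ?_, by ring⟩ hA'' E B' ?_ fun r hr hrA hrE => ?_)
      · rw [isUnit_pow_iff two_ne_zero]; exact hq.not_isUnit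
      · apply mul_left_cancel₀ hq.ne_zero
        linear_combination h2
      · exact hc r hr ((hrA.mul_left _).mul_left _) hrE

section
variable {K : Type*} [Field K] [NumberField K] {w : K}

namespace IsGen

lemma exists_associated_of_dvd_thirty (hw : IsGen w) {q : 𝓞 K} (hq : Prime q)
    (h : q ∣ (30 : 𝓞 K)) : Associated hw.p2 q ∨ Associated hw.p4 q ∨ Associated hw.p3 q ∨
      Associated hw.p9 q ∨ Associated hw.p5 q := by
  have : (Ideal.span {q}).IsPrime := (Ideal.span_singleton_prime hq.ne_zero).2 hq
  have key : ∀ {p : 𝓞 K}, Prime p → p ∈ Ideal.span {q} → Associated p q := fun hp h =>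
    (hq.associated_of_dvd hp (Ideal.mem_span_singleton.1 h)).symm
  exact (hw.mem_of_dvd_thirty (P := Ideal.span {q}) (Ideal.mem_span_singleton.2 h)).imp
    (key hw.prime_p2) <| Or.imp (key hw.prime_p4) <| Or.imp (key hw.prime_p3) <|
    Or.imp (key hw.prime_p9) (key hw.prime_p5)

lemma exists_eq_mul_sq (hw : IsGen w) {A E B : 𝓞 K} (hA : A ≠ 0) (h : A * E = -B ^ 2)
    (hc : ∀ q, Prime q → q ∣ A → q ∣ E → q ∣ 30) :
    ∃ (u : (𝓞 K)ˣ) (a b c d e : ℕ) (γ : 𝓞 K),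
      A = u * hw.p2 ^ a * hw.p4 ^ b * hw.p3 ^ c * hw.p9 ^ d * hw.p5 ^ e * γ ^ 2 := by
  have := hw.isPrincipalIdealRing
  refine induction_of_mul_eq_neg_sq (N := 30) (fun A => ∃ (u : (𝓞 K)ˣ) (a b c d e : ℕ) (γ : 𝓞 K),
      A = u * hw.p2 ^ a * hw.p4 ^ b * hw.p3 ^ c * hw.p9 ^ d * hw.p5 ^ e * γ ^ 2)
    ?_ ?_ ?_ A hA E B h hc
  · rintro _ ⟨u, rfl⟩
    exact ⟨u, 0, 0, 0, 0, 0, 1, by simp⟩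
  · rintro q _ ⟨u, a, b, c, d, e, γ, rfl⟩
    exact ⟨u, a, b, c, d, e, q * γ, by ring⟩
  · rintro q _ hq hqN ⟨u, a, b, c, d, e, γ, rfl⟩
    rcases hw.exists_associated_of_dvd_thirty hq hqN with
      ⟨v, rfl⟩ | ⟨v, rfl⟩ | ⟨v, rfl⟩ | ⟨v, rfl⟩ | ⟨v, rfl⟩
    · exact ⟨u * v, a + 1, b, c, d, e, γ, by push_cast; ring⟩
    · exact ⟨u * v, a, b + 1, c, d, e, γ, by push_cast; ring⟩
    · exact ⟨u * v, a, b, c + 1, d, e, γ, by push_cast; ring⟩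
    · exact ⟨u * v, a, b, c, d + 1, e, γ, by push_cast; ring⟩
    · exact ⟨u * v, a, b, c, d, e + 1, γ, by push_cast; ring⟩

lemma norm_u1 (hw : IsGen w) : Algebra.norm ℤ (hw.u1 : 𝓞 K) = 1 := by
  rw [coe_u1, norm_el]; simp [Matrix.det_succ_row_zero, Fin.sum_univ_succ, Fin.succAbove]

lemma norm_u2 (hw : IsGen w) : Algebra.norm ℤ (hw.u2 : 𝓞 K) = 1 := by
  rw [coe_u2, norm_el]; simp [Matrix.det_succ_row_zero, Fin.sum_univ_succ, Fin.succAbove]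

/-- A unit is, up to sign and squares, a product of `u1` and `u2`. -/
lemma exists_unit_eq (hw : IsGen w) (x : (𝓞 K)ˣ) : ∃ i < 2, ∃ j < 2, ∃ y : (𝓞 K)ˣ,
    x = hw.u1 ^ i * hw.u2 ^ j * y ^ 2 ∨ x = -(hw.u1 ^ i * hw.u2 ^ j * y ^ 2) := by
  have key : ∀ v : (𝓞 K)ˣ, IsSqSign (x * v) → ∃ y : (𝓞 K)ˣ, x = v * y ^ 2 ∨ x = -(v * y ^ 2) := by
    rintro v ⟨y, hy⟩
    have hv : v * (y * v⁻¹) ^ 2 * v = y ^ 2 := by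
      rw [mul_comm v, mul_assoc, ← sq, ← mul_pow, inv_mul_cancel_right]
    refine ⟨y * v⁻¹, hy.imp (fun h => ?_) (fun h => ?_)⟩
    · exact mul_right_cancel (h.trans hv.symm)
    · exact mul_right_cancel (b := v) (by rw [h, neg_mul, hv])
  rcases hw.exists_isSqSign x with h | h | h | h
  · obtain ⟨y, hy⟩ := h
    exact ⟨0, by norm_num, 0, by norm_num, y, by simpa using hy⟩
  · obtain ⟨y, hy⟩ := key _ h
    exact ⟨1, by norm_num, 0, by norm_num, y, by simpa using hy⟩
  · obtain ⟨y, hy⟩ := key _ h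
    exact ⟨0, by norm_num, 1, by norm_num, y, by simpa using hy⟩
  · obtain ⟨y, hy⟩ := key _ h
    exact ⟨1, by norm_num, 1, by norm_num, y, by simpa using hy⟩

end IsGen
end

section
variable {K : Type*} [Field K] [NumberField K] {w : K}

namespace IsGen

lemma exists_two_mul_p2 (hw : IsGen w) : ∃ v : (𝓞 K)ˣ, 2 * hw.p2 = v * (hw.p2 * hw.p4) ^ 2 := by
  have hv : IsUnit (hw.el 10745 (-8240) (-3981) 11508 5560) := isUnit_of_norm (by
    rw [norm_el]; simp [Matrix.det_succ_row_zero, Fin.sum_univ_succ, Fin.succAbove])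
  refine ⟨hv.unit, ?_⟩
  rw [hw.two_eq, IsUnit.unit_spec]; ring

lemma exists_three_mul_p3 (hw : IsGen w) : ∃ v : (𝓞 K)ˣ, 3 * hw.p3 = v * (hw.p3 * hw.p9) ^ 2 := by
  have hv : IsUnit (hw.el (-3) 5 (-2) (-4) 2) := isUnit_of_norm (by
    rw [norm_el]; simp [Matrix.det_succ_row_zero, Fin.sum_univ_succ, Fin.succAbove])
  refine ⟨hv.unit, ?_⟩
  rw [hw.three_eq, IsUnit.unit_spec]; ring

lemma exists_five_mul_p5 (hw : IsGen w) : ∃ v : (𝓞 K)ˣ, -5 * hw.p5 = v * (hw.p5 ^ 3) ^ 2 := by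
  have hv : IsUnit (hw.el 3 (-5) 2 4 (-2)) := isUnit_of_norm (by
    rw [norm_el]; simp [Matrix.det_succ_row_zero, Fin.sum_univ_succ, Fin.succAbove])
  refine ⟨-hv.unit, ?_⟩
  rw [hw.five_eq, Units.val_neg, IsUnit.unit_spec]; ring

lemma norm_coe (z : 𝓞 K) : Algebra.norm ℚ (z : K) = Algebra.norm ℤ z :=
  (Algebra.coe_norm_int z).symm

/-- The number `u1 ^ i * u2 ^ j * p4 ^ b * p9 ^ d`. -/
noncomputable def cls (hw : IsGen w) (i j b d : ℕ) : 𝓞 K :=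
  (hw.u1 : 𝓞 K) ^ i * (hw.u2 : 𝓞 K) ^ j * hw.p4 ^ b * hw.p9 ^ d

lemma exists_cls (hw : IsGen w) {A E B : 𝓞 K} (h : A * E = -B ^ 2)
    (hc : ∀ q, Prime q → q ∣ A → q ∣ E → q ∣ 30) {r s : ℚ} {α : K} (hα : α ≠ 0) (hr : r ≠ 0)
    (hA : (A : K) = r * α) (hn : Algebra.norm ℚ α = s ^ 2) :
    ∃ i < 2, ∃ j < 2, ∃ b < 2, ∃ d < 2, ∃ γ : K, α = hw.cls i j b d * γ ^ 2 := by
  have hrK : (r : K) ≠ 0 := by exact_mod_cast hr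
  have hA0 : A ≠ 0 := by
    rintro rfl
    rw [RingOfIntegers.coe_eq_algebraMap, map_zero] at hA
    exact mul_ne_zero hrK hα hA.symm
  have hs : s ≠ 0 := by
    rintro rfl
    rw [zero_pow two_ne_zero, Algebra.norm_eq_zero_iff] at hn
    exact hα hn
  obtain ⟨u, a, b, c, d, e, γ, hAγ⟩ := hw.exists_eq_mul_sq hA0 h hc
  obtain ⟨v2, hv2⟩ := hw.exists_two_mul_p2
  obtain ⟨v3, hv3⟩ := hw.exists_three_mul_p3
  obtain ⟨v5, hv5⟩ := hw.exists_five_mul_p5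
  obtain ⟨n, hn1⟩ : ∃ n : (𝓞 K)ˣ, ∃ k : ℤ, k ≠ 0 ∧ (n : 𝓞 K) = k ∧
      Algebra.norm ℤ (u : 𝓞 K) = k := by
    rcases Int.isUnit_iff.1 (u.isUnit.map (Algebra.norm ℤ)) with h | h
    · exact ⟨1, 1, by norm_num, by simp, h⟩
    · exact ⟨-1, -1, by norm_num, by simp, h⟩
  obtain ⟨k, hk0, hnk, huk⟩ := hn1
  set κ : ℤ := k * 2 ^ a * 3 ^ c * (-5) ^ e with hκ
  have hκ0 : (κ : ℚ) ≠ 0 := by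
    rw [hκ]; push_cast
    have : (k : ℚ) ≠ 0 := by exact_mod_cast hk0
    have h5 : ((-5 : ℚ)) ^ e ≠ 0 := pow_ne_zero _ (by norm_num)
    positivity
  set g : ℤ := Algebra.norm ℤ γ
  have hnA : (r : ℚ) ^ 5 * s ^ 2 = κ * (2 ^ b * 3 ^ d * g) ^ 2 := by
    have h1 : Algebra.norm ℚ (A : K) = r ^ 5 * s ^ 2 := by
      rw [hA, map_mul, hn]
      congr 1
      have := Algebra.norm_algebraMap (S := K) r
      rwa [hw.finrank, eq_ratCast] at this
    rw [← h1, norm_coe, hAγ]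
    simp only [map_mul, map_pow, norm_p2, norm_p4, norm_p3, norm_p9, norm_p5, huk, hκ, g]
    push_cast
    rw [show (4 : ℚ) = 2 ^ 2 by norm_num, show (9 : ℚ) = 3 ^ 2 by norm_num, ← pow_mul, ← pow_mul]
    ring
  obtain ⟨t, ht0, ht⟩ : ∃ t : ℚ, t ≠ 0 ∧ r * κ = t ^ 2 := by
    refine ⟨κ * (2 ^ b * 3 ^ d * g) / (r ^ 2 * s), ?_, ?_⟩
    · intro h0
      rw [div_eq_zero_iff] at h0
      rcases h0 with h0 | h0
      · have : r ^ 5 * s ^ 2 = 0 := by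
          rw [hnA]; rcases mul_eq_zero.1 h0 with h0 | h0 <;> rw [h0] <;> ring
        exact mul_ne_zero (pow_ne_zero 5 hr) (pow_ne_zero 2 hs) this
      · exact mul_ne_zero (pow_ne_zero 2 hr) hs h0
    · field_simp
      linear_combination hnA
  have htK : (t : K) ≠ 0 := by exact_mod_cast ht0
  have hAκ : (A : 𝓞 K) * κ = ((u * n * v2 ^ a * v3 ^ c * v5 ^ e : (𝓞 K)ˣ) : 𝓞 K) *
      hw.p4 ^ b * hw.p9 ^ d * ((hw.p2 * hw.p4) ^ a * (hw.p3 * hw.p9) ^ c * (hw.p5 ^ 3) ^ e * γ) ^ 2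
      := by
    rw [hAγ, hκ]
    push_cast
    rw [hnk]
    have e2 := congrArg (· ^ a) hv2
    have e3 := congrArg (· ^ c) hv3
    have e5 := congrArg (· ^ e) hv5
    simp only [mul_pow, ← pow_mul] at e2 e3 e5 ⊢
    calc _ = (u : 𝓞 K) * k * (2 ^ a * hw.p2 ^ a) * (3 ^ c * hw.p3 ^ c) * ((-5) ^ e * hw.p5 ^ e) *
          hw.p4 ^ b *
        hw.p9 ^ d * γ ^ 2 := by ring
      _ = _ := by rw [e2, e3, e5]; ring
  have hα' : α = (A * κ : 𝓞 K) / (t : K) ^ 2 := by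
    have htK2 : (t : K) ^ 2 = r * κ := by exact_mod_cast ht.symm
    have hκK : (κ : K) ≠ 0 := by exact_mod_cast hκ0
    rw [htK2, RingOfIntegers.coe_eq_algebraMap, map_mul, ← RingOfIntegers.coe_eq_algebraMap, hA,
      map_intCast]
    field_simp
  obtain ⟨i, hi, j, hj, y, hy⟩ := hw.exists_unit_eq (u * n * v2 ^ a * v3 ^ c * v5 ^ e)
  set δ : 𝓞 K := y * hw.p4 ^ (b / 2) * hw.p9 ^ (d / 2) *
    ((hw.p2 * hw.p4) ^ a * (hw.p3 * hw.p9) ^ c * (hw.p5 ^ 3) ^ e * γ) with hδ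
  have hp4 : hw.p4 ^ b = hw.p4 ^ (b % 2) * (hw.p4 ^ (b / 2)) ^ 2 := by
    rw [← pow_mul, ← pow_add]; congr 1; omega
  have hp9 : hw.p9 ^ d = hw.p9 ^ (d % 2) * (hw.p9 ^ (d / 2)) ^ 2 := by
    rw [← pow_mul, ← pow_add]; congr 1; omega
  have hcases : (A * κ : 𝓞 K) = hw.cls i j (b % 2) (d % 2) * δ ^ 2 ∨
      (A * κ : 𝓞 K) = -(hw.cls i j (b % 2) (d % 2) * δ ^ 2) := by
    rw [hAκ, hδ, cls, hp4, hp9]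
    refine hy.imp (fun h => ?_) (fun h => ?_) <;> rw [h] <;> push_cast <;> ring
  have hcls : 0 < Algebra.norm ℤ (hw.cls i j (b % 2) (d % 2)) := by
    simp only [cls, map_mul, map_pow, norm_u1, norm_u2, norm_p4, norm_p9]
    positivity
  refine ⟨i, hi, j, hj, b % 2, Nat.mod_lt _ two_pos, d % 2, Nat.mod_lt _ two_pos, δ / t, ?_⟩
  rcases hcases with h1 | h1
  · rw [hα', h1, RingOfIntegers.coe_eq_algebraMap, map_mul, map_pow, div_pow]
    simp only [RingOfIntegers.coe_eq_algebraMap]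
    rw [mul_div_assoc]
  · exfalso
    have h2 : Algebra.norm ℤ (A * κ : 𝓞 K) ≤ 0 := by
      have : (-(hw.cls i j (b % 2) (d % 2) * δ ^ 2)) =
          ((-1 : ℤ) : 𝓞 K) * (hw.cls i j (b % 2) (d % 2) * δ ^ 2) := by push_cast; ring
      rw [h1, this, map_mul, ← eq_intCast (algebraMap ℤ (𝓞 K)), Algebra.norm_algebraMap,
        RingOfIntegers.rank, hw.finrank, map_mul, map_pow]
      have := sq_nonneg (Algebra.norm ℤ δ)
      nlinarith
    have h3 : (0 : ℚ) < Algebra.norm ℤ (A * κ : 𝓞 K) := by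
      rw [← norm_coe]
      have : ((A * κ : 𝓞 K) : K) = algebraMap ℚ K t ^ 2 * α := by
        rw [hα', eq_ratCast]; field_simp
      rw [this, map_mul, hn, map_pow, Algebra.norm_algebraMap, hw.finrank]
      positivity
    exact absurd (by exact_mod_cast h3) (not_lt.2 h2)

end IsGen
end

lemma exists_nat_prime_dvd {R : Type*} [CommRing R] {q : R} (hq : Prime q) (n : ℕ) :
    n ≠ 0 → q ∣ (n : R) → ∃ p : ℕ, p.Prime ∧ p ∣ n ∧ q ∣ (p : R) := by
  induction n using Nat.recOnMul with
  | zero => intro h; exact absurd rfl h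
  | one =>
    intro _ h
    rw [Nat.cast_one] at h
    exact absurd (isUnit_of_dvd_one h) hq.not_isUnit
  | prime p hp => intro _ h; exact ⟨p, hp, dvd_rfl, h⟩
  | mul a b ha hb =>
    intro h0 h
    rw [Nat.cast_mul] at h
    rcases hq.dvd_or_dvd h with h | h
    · obtain ⟨p, h1, h2, h3⟩ := ha (left_ne_zero_of_mul h0) h
      exact ⟨p, h1, h2.mul_right _, h3⟩
    · obtain ⟨p, h1, h2, h3⟩ := hb (right_ne_zero_of_mul h0) h
      exact ⟨p, h1, h2.mul_left _, h3⟩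

/-- If `a` does not divide `b` but divides `b ^ 2 = -a * e` over a field, with `deg a ≤ 2`, then
`a` and `e` have no common root. -/
lemma no_common_root {k F : Type*} [Field k] [CommRing F] [IsDomain F] (ι : k →+* F) {a b e : k[X]}
    (ha : a ≠ 0) (hdeg : a.natDegree ≤ 2) (h : b ^ 2 = -(a * e)) (hab : ¬ a ∣ b) (t : F)
    (h1 : a.eval₂ ι t = 0) (h2 : e.eval₂ ι t = 0) : False := by
  have hsq : ¬ Squarefree a := fun hs =>
    hab ((hs.dvd_pow_iff_dvd two_ne_zero).1 (h ▸ (dvd_mul_right a e).neg_right))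
  simp only [Squarefree, not_forall] at hsq
  obtain ⟨x, ⟨c, rfl⟩, hx⟩ := hsq
  have hxx := left_ne_zero_of_mul ha
  have hx0 := left_ne_zero_of_mul hxx
  have hc0 := right_ne_zero_of_mul ha
  rw [natDegree_mul hxx hc0, natDegree_mul hx0 hx0] at hdeg
  have hx1 : x.natDegree ≠ 0 := fun h0 => hx (by
    rw [natDegree_eq_zero] at h0
    obtain ⟨r, rfl⟩ := h0
    rw [isUnit_C, isUnit_iff_ne_zero]
    rintro rfl
    simp at hx0)
  have hc : IsUnit c := by
    obtain ⟨r, rfl⟩ := natDegree_eq_zero.1 (show c.natDegree = 0 by omega)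
    rw [isUnit_C, isUnit_iff_ne_zero]
    rintro rfl
    simp at hc0
  have hxd : x.natDegree = 1 := by omega
  have hxp : Irreducible x := irreducible_of_degree_eq_one ((degree_eq_iff_natDegree_eq hx0).2
    (by rw [hxd]; rfl))
  obtain ⟨m, rfl⟩ : x ∣ b :=
    hxp.prime.dvd_of_dvd_pow (n := 2) ⟨-(x * c * e), by rw [h]; ring⟩
  have hm : m ^ 2 = -(c * e) := by
    apply mul_left_cancel₀ (pow_ne_zero 2 hx0)
    linear_combination h
  have hme : m.eval₂ ι t = 0 := by
    have := congrArg (eval₂ ι t) hm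
    rw [eval₂_pow, eval₂_neg, eval₂_mul, h2, mul_zero, neg_zero] at this
    exact pow_eq_zero_iff two_ne_zero |>.1 this
  have hxe : x.eval₂ ι t = 0 := by
    rw [eval₂_mul, eval₂_mul] at h1
    have := (hc.map (eval₂RingHom ι t)).ne_zero
    rw [coe_eval₂RingHom] at this
    exact mul_self_eq_zero.1 ((mul_eq_zero.1 h1).resolve_right this)
  rcases dvd_or_isCoprime x m hxp with ⟨m', rfl⟩ | h3
  · refine hab ?_
    rw [← mul_assoc]
    exact mul_dvd_mul_left _ hc.dvd
  · obtain ⟨u, v, huv⟩ := h3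
    have := congrArg (eval₂ ι t) huv
    simp [hme, hxe] at this

/-- The sextic `5 x (x ^ 5 + 10 x ^ 4 + 30 x ^ 3 + 60 x ^ 2 + 45 x + 18)`. -/
noncomputable def sextic : ℤ[X] :=
  5 * X ^ 6 + 50 * X ^ 5 + 150 * X ^ 4 + 300 * X ^ 3 + 225 * X ^ 2 + 90 * X

section
variable {K : Type*} [Field K] [NumberField K] {w : K}

namespace IsGen

/-- A root of the sextic. -/
noncomputable def th (hw : IsGen w) : 𝓞 K := hw.el (-2) 2 0 (-1) 0

lemma aeval_th (hw : IsGen w) : aeval hw.th sextic = 0 := by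
  have h : hw.th ^ 5 + 10 * hw.th ^ 4 + 30 * hw.th ^ 3 + 60 * hw.th ^ 2 + 45 * hw.th + 18 = 0 := by
    simp only [th, el]; push_cast
    linear_combination (-14 + 20 * hw.int - 15 * hw.int ^ 2 + 15 * hw.int ^ 4 - 4 * hw.int ^ 5 -
      10 * hw.int ^ 6 + 5 * hw.int ^ 8 - hw.int ^ 10) * hw.int_rel
  simp only [sextic, map_add, map_mul, map_pow, aeval_X, map_ofNat]
  linear_combination 5 * hw.th * h

lemma aeval_derivative_th (hw : IsGen w) :
    aeval hw.th (derivative sextic) * hw.el (-20) 8 20 (-1) (-4) = 1800 := by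
  have h : aeval hw.th (derivative sextic) = hw.el (-3050) 2600 650 (-3200) (-1250) := by
    simp only [sextic, derivative_mul, derivative_X_pow, derivative_ofNat,
      derivative_X, map_add, map_mul, map_pow, aeval_X, map_ofNat, map_natCast, map_zero, map_one]
    simp only [th, el]; push_cast
    linear_combination (-1020 + 150 * hw.int - 550 * hw.int ^ 2 - 200 * hw.int ^ 3 +
      350 * hw.int ^ 4 + 30 * hw.int ^ 5 - 300 * hw.int ^ 6 - 50 * hw.int ^ 7 + 150 * hw.int ^ 8 -
      30 * hw.int ^ 10) * hw.int_rel
  rw [h]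
  simp only [el]; push_cast
  linear_combination (-14800 + 600 * hw.int + 14050 * hw.int ^ 2 + 5000 * hw.int ^ 3) * hw.int_rel

lemma dvd_thirty_of_dvd (hw : IsGen w) {q : 𝓞 K} (hq : Prime q)
    (h : q ∣ aeval hw.th (derivative sextic)) : q ∣ 30 := by
  have h1 : q ∣ (30 : 𝓞 K) ^ 3 := (h.mul_right _).trans
    ⟨15, by rw [hw.aeval_derivative_th]; norm_num⟩
  exact hq.dvd_of_dvd_pow h1

lemma exists_coprime_repr (hw : IsGen w) {a : ℤ[X]} (ha : a.IsPrimitive) (hdeg : a.natDegree ≤ 2)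
    (N : ℕ) : N ≠ 0 → ∀ b e : ℤ[X], C (N : ℤ) ^ 2 * sextic = b ^ 2 + a * e →
    ∃ b' e' : ℤ[X], aeval hw.th a * aeval hw.th e' = -(aeval hw.th b') ^ 2 ∧
      ∀ q, Prime q → q ∣ aeval hw.th a → q ∣ aeval hw.th e' → q ∣ 30 := by
  induction N using Nat.strong_induction_on with
  | _ N ih =>
  intro hN b e h
  by_cases hred : ∃ p : ℕ, p.Prime ∧ p ∣ N ∧ a.map (Int.castRingHom (ZMod p)) ∣
      b.map (Int.castRingHom (ZMod p))
  · obtain ⟨p, hp, ⟨N', rfl⟩, c, hc⟩ := hred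
    obtain ⟨c, rfl⟩ := map_surjective (Int.castRingHom (ZMod p)) (ZMod.intCast_surjective) c
    have hpC : Prime (C (p : ℤ)) := prime_C_iff.2 (Nat.prime_iff_prime_int.1 hp)
    have hpa : ¬ C (p : ℤ) ∣ a := fun hd =>
      (Nat.prime_iff_prime_int.1 hp).not_isUnit (ha _ hd)
    obtain ⟨b', hb'⟩ : C (p : ℤ) ∣ b - a * c := by
      rw [C_dvd_iff_dvd_coeff]
      intro i
      rw [← ZMod.intCast_zmod_eq_zero_iff_dvd]
      have := congrArg (fun P => coeff P i) hc
      rw [← Polynomial.map_mul] at this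
      simp only [coeff_map, eq_intCast] at this
      rw [coeff_sub, Int.cast_sub, this, sub_self]
    obtain rfl : b = a * c + C (p : ℤ) * b' := by rw [← hb']; ring
    have h2 : C (p : ℤ) ^ 2 * (C (N' : ℤ) ^ 2 * sextic - b' ^ 2) =
        a * (e + a * c ^ 2 + 2 * c * C (p : ℤ) * b') := by
      push_cast [C_mul] at h ⊢
      linear_combination h
    obtain ⟨e', he'⟩ : C (p : ℤ) ^ 2 ∣ e + a * c ^ 2 + 2 * c * C (p : ℤ) * b' :=
      hpC.pow_dvd_of_dvd_mul_left 2 hpa ⟨_, h2.symm⟩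
    have hN' : N' ≠ 0 := right_ne_zero_of_mul hN
    refine ih N' ?_ hN' b' e' ?_
    · exact lt_mul_of_one_lt_left (Nat.pos_of_ne_zero hN') hp.one_lt
    · rw [he'] at h2
      apply mul_left_cancel₀ (pow_ne_zero 2 hpC.ne_zero)
      linear_combination h2
  · push Not at hred
    have h0 : aeval hw.th a * aeval hw.th e = -(aeval hw.th b) ^ 2 := by
      have := congrArg (aeval hw.th) h
      rw [map_mul, hw.aeval_th] at this
      simp only [map_add, map_mul, map_pow] at this
      linear_combination -this
    refine ⟨b, e, h0, fun q hq hqa hqe => ?_⟩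
    by_cases hqN : q ∣ (N : 𝓞 K)
    · exfalso
      obtain ⟨p, hp, hpN, hqp⟩ := exists_nat_prime_dvd hq N hN hqN
      have hprime : (Ideal.span {q}).IsPrime := (Ideal.span_singleton_prime hq.ne_zero).2 hq
      have hzero : ∀ {z : 𝓞 K}, q ∣ z → Ideal.Quotient.mk (Ideal.span {q}) z = 0 := fun h =>
        Ideal.Quotient.eq_zero_iff_mem.2 (Ideal.mem_span_singleton.2 h)
      have : Fact p.Prime := ⟨hp⟩
      have hp0 : (p : 𝓞 K ⧸ Ideal.span {q}) = 0 := by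
        rw [← map_natCast (Ideal.Quotient.mk (Ideal.span {q}))]; exact hzero hqp
      have : CharP (𝓞 K ⧸ Ideal.span {q}) p :=
        ringChar.of_eq (CharP.ringChar_of_prime_eq_zero hp hp0)
      have hι : ∀ P : ℤ[X], (P.map (Int.castRingHom (ZMod p))).eval₂
          (ZMod.castHom dvd_rfl (𝓞 K ⧸ Ideal.span {q})) (Ideal.Quotient.mk _ hw.th) =
          Ideal.Quotient.mk _ (aeval hw.th P) := by
        intro P
        rw [eval₂_map, aeval_def, hom_eval₂]
        congr 1
        exact RingHom.ext_int _ _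
      refine no_common_root (ZMod.castHom dvd_rfl (𝓞 K ⧸ Ideal.span {q}))
        (a := a.map (Int.castRingHom (ZMod p))) (b := b.map (Int.castRingHom (ZMod p)))
        (e := e.map (Int.castRingHom (ZMod p))) ?_ (natDegree_map_le.trans hdeg) ?_
        (hred p hp hpN) (Ideal.Quotient.mk _ hw.th) ?_ ?_
      · intro hz
        refine (Nat.prime_iff_prime_int.1 hp).not_isUnit (ha _ ?_)
        rw [C_dvd_iff_dvd_coeff]
        intro i
        rw [← ZMod.intCast_zmod_eq_zero_iff_dvd]
        have := congrArg (fun P => coeff P i) hz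
        simpa using this
      · have := congrArg (Polynomial.map (Int.castRingHom (ZMod p))) h
        obtain ⟨N', rfl⟩ := hpN
        simp at this
        linear_combination -this
      · rw [hι]; exact hzero hqa
      · rw [hι]; exact hzero hqe
    · apply hw.dvd_thirty_of_dvd hq
      have hqb : q ∣ aeval hw.th b := hq.dvd_of_dvd_pow (n := 2)
        (by rw [← dvd_neg, ← h0]; exact hqa.mul_right _)
      have h3 := congrArg (fun P => aeval hw.th (derivative P)) h
      have hd : ∀ P : ℤ[X], derivative (C (N : ℤ) ^ 2 * P) = C (N : ℤ) ^ 2 * derivative P := by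
        intro P
        rw [← C_pow, derivative_C_mul]
      simp only [hd] at h3
      simp only [derivative_mul, derivative_pow, map_add, map_mul, map_pow,
        map_natCast] at h3
      have h4 : q ∣ (N : 𝓞 K) ^ 2 * aeval hw.th (derivative sextic) := by
        have : (N : 𝓞 K) ^ 2 * aeval hw.th (derivative sextic) =
          aeval hw.th b * (2 * aeval hw.th (derivative b)) + (aeval hw.th (derivative a) *
          aeval hw.th e + aeval hw.th a * aeval hw.th (derivative e)) := by
          linear_combination h3
        rw [this]
        exact dvd_add (hqb.mul_right _) (dvd_add (hqe.mul_left _) (hqa.mul_right _))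
      rcases hq.dvd_or_dvd h4 with h5 | h5
      · exact absurd (hq.dvd_of_dvd_pow h5) hqN
      · exact h5

lemma exists_int_polynomial (P : ℚ[X]) : ∃ (n : ℤ) (Q : ℤ[X]), n ≠ 0 ∧
    Q.map (Int.castRingHom ℚ) = C (n : ℚ) * P := by
  obtain ⟨b, hb, h⟩ := IsLocalization.integerNormalization_spec (nonZeroDivisors ℤ) P
  refine ⟨b, _, nonZeroDivisors.ne_zero hb, h.trans ?_⟩
  rw [← Int.cast_smul_eq_zsmul ℚ, smul_eq_C_mul]

/-- A factor of `sextic - b ^ 2` of degree at most two, evaluated at the root of the sextic, is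
a square up to a class from an explicit finite list. -/
lemma exists_cls_of_factor (hw : IsGen w) {a b e : ℚ[X]} (hdeg : a.natDegree ≤ 2)
    (h : sextic.map (Int.castRingHom ℚ) = b ^ 2 + a * e)
    (ha : aeval (hw.th : K) a ≠ 0) {s : ℚ} (hn : Algebra.norm ℚ (aeval (hw.th : K) a) = s ^ 2) :
    ∃ i < 2, ∃ j < 2, ∃ k < 2, ∃ l < 2, ∃ γ : K,
      aeval (hw.th : K) a = hw.cls i j k l * γ ^ 2 := by
  obtain ⟨n, a', hn0, ha'⟩ := exists_int_polynomial a
  have hnQ : (n : ℚ) ≠ 0 := by exact_mod_cast hn0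
  have ha'0 : a' ≠ 0 := by
    rintro rfl
    rw [Polynomial.map_zero, eq_comm, mul_eq_zero, C_eq_zero] at ha'
    rw [ha'.resolve_left hnQ, map_zero] at ha
    exact ha rfl
  set c := a'.content with hc
  have hc0 : (c : ℚ) ≠ 0 := by
    rw [hc, Int.cast_ne_zero, Ne, content_eq_zero_iff]; exact ha'0
  have hca : a = C ((c : ℚ) / n) * a'.primPart.map (Int.castRingHom ℚ) := by
    have h1 := congrArg (Polynomial.map (Int.castRingHom ℚ)) a'.eq_C_content_mul_primPart
    rw [ha', Polynomial.map_mul, map_C, eq_intCast, ← hc] at h1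
    rw [div_eq_mul_inv, mul_comm (c : ℚ), C_mul, mul_assoc, ← h1, ← mul_assoc, ← C_mul,
      inv_mul_cancel₀ hnQ, C_1, one_mul]
  obtain ⟨m1, b1, hm1, hb1⟩ := exists_int_polynomial b
  obtain ⟨m2, e1, hm2, he1⟩ := exists_int_polynomial (C ((c : ℚ) / n) * e)
  have hprim : C ((m1 * m2).natAbs : ℤ) ^ 2 * sextic =
      (C m2 * b1) ^ 2 + a'.primPart * (C (m1 ^ 2 * m2) * e1) := by
    apply map_injective (Int.castRingHom ℚ) Int.cast_injective
    rw [← C_pow, Int.natAbs_sq]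
    simp only [Polynomial.map_mul, Polynomial.map_add, Polynomial.map_pow, map_C, hb1, he1, h]
    rw [hca]
    simp only [eq_intCast, Int.cast_pow, Int.cast_mul, C_mul, C_pow]
    ring
  have hda : a'.primPart.natDegree ≤ 2 := by
    rw [← natDegree_map_eq_of_injective (f := Int.castRingHom ℚ) Int.cast_injective]
    rwa [hca, natDegree_C_mul (div_ne_zero hc0 hnQ)] at hdeg
  obtain ⟨b', e', h1, h2⟩ := hw.exists_coprime_repr (isPrimitive_primPart a') hda _
    (Int.natAbs_ne_zero.2 (mul_ne_zero hm1 hm2)) _ _ hprim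
  refine hw.exists_cls h1 h2 ha (r := n / c) (div_ne_zero hnQ hc0) ?_ hn
  have h3 : aeval (hw.th : K) a = ((c / n : ℚ) : K) * (aeval hw.th a'.primPart : 𝓞 K) := by
    rw [hca, map_mul, aeval_C, eq_ratCast, ← algebraMap_int_eq, aeval_map_algebraMap]
    congr 1
    rw [RingOfIntegers.coe_eq_algebraMap, RingOfIntegers.coe_eq_algebraMap, aeval_algebraMap_apply]
  rw [h3]
  have h4 : (c : K) ≠ 0 := by exact_mod_cast hc0
  have h5 : (n : K) ≠ 0 := by exact_mod_cast hn0
  push_cast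
  field_simp

end IsGen
end

/-- Evaluate a natural number before handing it on; this keeps kernel reduction call-by-value. -/
def force (n : ℕ) (k : ℕ → Bool) : Bool :=
  match n with
  | 0 => k 0
  | n + 1 => k (Nat.succ n)

@[simp] lemma force_eq (n : ℕ) (k : ℕ → Bool) : force n k = k n := by cases n <;> rfl

/-- `forceList l k = k l`, evaluating the entries of `l` first. -/
def forceList (l : List ℕ) (k : List ℕ → Bool) : Bool :=
  match l with
  | [] => k []
  | x :: l => force x fun y => forceList l fun t => k (y :: t)

@[simp] lemma forceList_eq (l : List ℕ) (k : List ℕ → Bool) : forceList l k = k l := by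
  induction l generalizing k <;> simp_all [forceList]

/-- The sum `∑ a i * b i` over two lists. -/
noncomputable def natDot (l : List ℕ) : List ℕ → ℕ :=
  List.rec (fun _ => 0) (fun a _ ih m => List.rec 0 (fun b m _ => Nat.add (Nat.mul a b) (ih m)) m) l

/-- The Hankel form `∑ a (i + j) * g i * h j` on lists of natural numbers. -/
noncomputable def natForm (l g h : List ℕ) : ℕ :=
  List.rec (fun _ => 0) (fun x _ ih l => Nat.add (Nat.mul x (natDot l h)) (ih l.tail)) g l

/-- The Hankel form `∑ a (i + j) * g i * h j`. -/
def bil {R : Type*} [CommSemiring R] (a : ℕ → R) (g h : Fin 5 → R) : R :=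
  ∑ i : Fin 5, ∑ j : Fin 5, a (i + j : ℕ) * g i * h j

lemma natForm_eq (a : ℕ → ℕ) (g h : Fin 5 → ℕ) :
    natForm ((List.range 9).map a) (List.ofFn g) (List.ofFn h) = bil a g h := by
  simp [natForm, natDot, bil, Fin.sum_univ_succ, List.range_succ]
  ring

/-- `x` is `k` times a square modulo `M`. -/
def sqTest (k M x : ℕ) : Bool :=
  force (x % M) fun r => (List.range M).any fun y => Nat.beq (Nat.mod (Nat.mul k (Nat.mul y y)) M) r

lemma sqTest_eq_true {k M x y : ℕ} (hM : M ≠ 0) (h : x ≡ k * y ^ 2 [MOD M]) :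
    sqTest k M x = true := by
  simp only [sqTest, force_eq, List.any_eq_true, List.mem_range, Nat.beq_eq]
  refine ⟨y % M, Nat.mod_lt _ (Nat.pos_of_ne_zero hM), ?_⟩
  refine Eq.trans ?_ h.symm
  exact ((Nat.mod_modEq y M).mul (Nat.mod_modEq y M)).mul_left k |>.trans (by rw [sq])

/-- Does `k` hold for all lists obtained from the second list by adding `m` times the given
digits? -/
def extAll (m : ℕ) : List (List ℕ) → List ℕ → (List ℕ → Bool) → Bool
  | d :: ds, x :: xs, k =>
    d.all fun b => force (Nat.add x (Nat.mul m b)) fun y => extAll m ds xs fun t => k (y :: t)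
  | _, _, k => k []

lemma extAll_ofFn {m n : ℕ} {D : Fin n → List ℕ} {x b : Fin n → ℕ} {k : List ℕ → Bool}
    (hb : ∀ i, b i ∈ D i) (h : extAll m (List.ofFn D) (List.ofFn x) k = true) :
    k (List.ofFn fun i => x i + m * b i) = true := by
  induction n generalizing k with
  | zero => simpa [extAll] using h
  | succ n ih =>
    rw [List.ofFn_succ, List.ofFn_succ, extAll, List.all_eq_true] at h
    have h1 := h (b 0) (hb 0)
    rw [force_eq] at h1
    have h2 := ih (fun i => hb i.succ) h1
    rw [List.ofFn_succ]
    exact h2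

/-- A search over pairs of vectors, digit by digit in base `p`, for simultaneous solutions of
the congruences of `IsSol`; the value is `true` if there are none. -/
noncomputable def search (p e : ℕ) (l1 l2 l0 : List ℕ) (dg' dh' : List (List ℕ)) :
    ℕ → List (List ℕ) → List (List ℕ) → ℕ → List ℕ → List ℕ → Bool
  | 0, _, _, _, _, _ => false
  | n + 1, dg, dh, m, g, h =>
    force (Nat.mul m p) fun m' => force (Nat.mul e m') fun M =>
    extAll m dg g fun g =>
      !(Nat.beq (Nat.mod (natForm l1 g g) M) 0 && (Nat.beq (Nat.mod (natForm l2 g g) M) 0 &&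
        sqTest 1 M (natForm l0 g g))) ||
      extAll m dh h fun h =>
        !(Nat.beq (Nat.mod (natForm l1 g h) m') 0 && (Nat.beq (Nat.mod (natForm l2 g h) m') 0 &&
          (Nat.beq (Nat.mod (natForm l2 h h) M) (Nat.mod (Nat.mul 2 (natForm l1 h h)) M) &&
            sqTest 15 M (natForm l1 h h)))) ||
        search p e l1 l2 l0 dg' dh' n dg' dh' m' g h

lemma bil_modEq {m : ℕ} (a : ℕ → ℕ) (g h : Fin 5 → ℕ) :
    bil a (fun i => g i % m) (fun i => h i % m) ≡ bil a g h [MOD m] := by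
  simp only [bil, ← ZMod.natCast_eq_natCast_iff]
  simp

lemma bil_add_mul {R : Type*} [CommSemiring R] (a : ℕ → R) (g h : Fin 5 → R) (m : R) :
    bil a (fun i => g i + m * h i) (fun i => g i + m * h i) =
      bil a g g + 2 * m * bil a g h + m ^ 2 * bil a h h := by
  simp [bil, Fin.sum_univ_succ]
  ring

lemma bil_self_modEq {m e : ℕ} (h2 : e ∣ 2) (hm : e ∣ m) (a : ℕ → ℕ) (g : Fin 5 → ℕ) :
    bil a (fun i => g i % m) (fun i => g i % m) ≡ bil a g g [MOD e * m] := by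
  have h : g = fun i => g i % m + m * (g i / m) := funext fun i => (Nat.mod_add_div _ _).symm
  conv_rhs => rw [h, bil_add_mul]
  obtain ⟨c, hc⟩ := h2
  obtain ⟨d, hd⟩ := hm
  rw [add_assoc]
  refine (Nat.ModEq.trans ((Nat.modEq_zero_iff_dvd.2 ?_).add_left _) (Nat.ModEq.refl _)).symm
  refine dvd_add ?_ ?_
  · exact ⟨c * bil a (fun i => g i % m) fun i => g i / m, by rw [hc]; ring⟩
  · rw [sq]; exact (mul_dvd_mul_right ⟨d, hd⟩ m).mul_right _

/-- The conditions on a pair of vectors tested by the search. -/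
structure IsSol {R : Type*} [CommRing R] (a1 a2 a0 : ℕ → R) (g h : Fin 5 → R) : Prop where
  gg1 : bil a1 g g = 0
  gg2 : bil a2 g g = 0
  gg0 : ∃ t, bil a0 g g = t ^ 2
  gh1 : bil a1 g h = 0
  gh2 : bil a2 g h = 0
  hh2 : bil a2 h h = 2 * bil a1 h h
  hh1 : ∃ s, bil a1 h h = 15 * s ^ 2

lemma natCast_bil {R : Type*} [CommRing R] (a : ℕ → ℕ) (g h : Fin 5 → ℕ) :
    ((bil a g h : ℕ) : R) = bil (fun i => (a i : R)) (fun i => (g i : R)) (fun i => (h i : R)) := by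
  simp [bil]

lemma search_eq_false {p e q : ℕ} [NeZero q] (he : e ∣ 2) (hep : e ∣ p) {a1 a2 a0 : ℕ → ℕ}
    {G H : Fin 5 → ℕ}
    (hs : IsSol (R := ZMod q) (fun i => a1 i) (fun i => a2 i) (fun i => a0 i) (fun i => G i)
      (fun i => H i)) {Dg' Dh' : Fin 5 → List ℕ} (n : ℕ) (m : ℕ) (Dg Dh : Fin 5 → List ℕ)
    (hn : e * (m * p ^ n) ∣ q) (hg : ∀ i, G i / m % p ∈ Dg i) (hh : ∀ i, H i / m % p ∈ Dh i)
    (hg' : ∀ i k, G i / (m * p ^ (k + 1)) % p ∈ Dg' i)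
    (hh' : ∀ i k, H i / (m * p ^ (k + 1)) % p ∈ Dh' i) :
    search p e ((List.range 9).map a1) ((List.range 9).map a2) ((List.range 9).map a0)
      (List.ofFn Dg') (List.ofFn Dh') n (List.ofFn Dg) (List.ofFn Dh) m
      (List.ofFn fun i => G i % m) (List.ofFn fun i => H i % m) = false := by
  induction n generalizing m Dg Dh with
  | zero => rfl
  | succ n ih =>
    have key := ih (m * p) Dg' Dh' (by rwa [mul_assoc m, ← pow_succ'])
      (fun i => by simpa using hg' i 0) (fun i => by simpa using hh' i 0)
      (fun i k => by simpa only [mul_assoc, ← pow_succ'] using hg' i (k + 1))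
      (fun i k => by simpa only [mul_assoc, ← pow_succ'] using hh' i (k + 1))
    have hM : e * (m * p) ∣ q := Dvd.dvd.trans ⟨p ^ n, by ring⟩ hn
    have hm : m * p ∣ q := (Dvd.intro_left _ rfl).trans hM
    have hM0 : e * (m * p) ≠ 0 := fun h => NeZero.ne q (by simpa [h] using hM)
    obtain ⟨t, ht⟩ := hs.gg0
    obtain ⟨s, hs1⟩ := hs.hh1
    rw [← ZMod.natCast_zmod_val t, ← natCast_bil, ← Nat.cast_pow,
      ZMod.natCast_eq_natCast_iff] at ht
    rw [← ZMod.natCast_zmod_val s, ← natCast_bil, ← Nat.cast_pow, ← Nat.cast_ofNat,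
      ← Nat.cast_mul, ZMod.natCast_eq_natCast_iff] at hs1
    have gg1 := hs.gg1
    have gg2 := hs.gg2
    have gh1 := hs.gh1
    have gh2 := hs.gh2
    have hh2 := hs.hh2
    rw [← natCast_bil, ← Nat.cast_zero, ZMod.natCast_eq_natCast_iff] at gg1 gg2 gh1 gh2
    rw [← natCast_bil, ← natCast_bil, ← Nat.cast_ofNat, ← Nat.cast_mul,
      ZMod.natCast_eq_natCast_iff] at hh2
    have d := fun a => bil_self_modEq he (hep.mul_left m) a G
    have d' := fun a => bil_self_modEq he (hep.mul_left m) a H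
    by_contra hne
    rw [Bool.not_eq_false, search, force_eq, force_eq] at hne
    have h1 := extAll_ofFn hg hne
    simp only [Nat.mul_eq, ← Nat.mod_mul] at h1
    rw [Bool.or_eq_true] at h1
    replace h1 := h1.resolve_left (by
      simp only [Bool.not_eq_true', Bool.not_eq_false, Bool.and_eq_true, Nat.beq_eq, natForm_eq]
      refine ⟨(d a1).trans (gg1.of_dvd hM), (d a2).trans (gg2.of_dvd hM), ?_⟩
      exact sqTest_eq_true hM0 (by rw [one_mul]; exact (d a0).trans (ht.of_dvd hM)))
    have h2 := extAll_ofFn hh h1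
    simp only [← Nat.mod_mul] at h2
    rw [Bool.or_eq_true] at h2
    replace h2 := h2.resolve_left (by
      simp only [Bool.not_eq_true', Bool.not_eq_false, Bool.and_eq_true, Nat.beq_eq, natForm_eq]
      refine ⟨(bil_modEq a1 G H).trans (gh1.of_dvd hm), (bil_modEq a2 G H).trans (gh2.of_dvd hm),
        ((d' a2).trans (hh2.of_dvd hM)).trans ((d' a1).symm.mul_left 2), ?_⟩
      exact sqTest_eq_true hM0 ((d' a1).trans (hs1.of_dvd hM)))
    rw [key] at h2
    cases h2

section
variable {R : Type*} [CommRing R]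

lemma bil_comm (a : ℕ → R) (g h : Fin 5 → R) : bil a g h = bil a h g := by
  simp [bil, Fin.sum_univ_succ]; ring

lemma bil_mul_right (a : ℕ → R) (g h : Fin 5 → R) (k : R) :
    bil a g (fun i => k * h i) = k * bil a g h := by
  simp [bil, Fin.sum_univ_succ]; ring

lemma bil_mul_left (a : ℕ → R) (g h : Fin 5 → R) (k : R) :
    bil a (fun i => k * g i) h = k * bil a g h := by
  rw [bil_comm, bil_mul_right, bil_comm]

lemma bil_sub_right (a : ℕ → R) (g h h' : Fin 5 → R) :
    bil a g (fun i => h i - h' i) = bil a g h - bil a g h' := by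
  simp [bil, Fin.sum_univ_succ]; ring

lemma bil_sub_left (a : ℕ → R) (g h h' : Fin 5 → R) :
    bil a (fun i => h i - h' i) g = bil a h g - bil a h' g := by
  rw [bil_comm, bil_sub_right, bil_comm _ g, bil_comm _ g]

namespace IsSol
variable {a1 a2 a0 : ℕ → R} {g h : Fin 5 → R}

lemma mul_left (hs : IsSol a1 a2 a0 g h) (u : R) : IsSol a1 a2 a0 (fun i => u * g i) h := by
  obtain ⟨t, ht⟩ := hs.gg0
  refine ⟨?_, ?_, ⟨u * t, ?_⟩, ?_, ?_, hs.hh2, hs.hh1⟩ <;>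
    simp only [bil_mul_left, bil_mul_right, hs.gg1, hs.gg2, hs.gh1, hs.gh2, ht] <;> ring

lemma mul_right (hs : IsSol a1 a2 a0 g h) (u : R) : IsSol a1 a2 a0 g (fun i => u * h i) := by
  obtain ⟨s, h1⟩ := hs.hh1
  refine ⟨hs.gg1, hs.gg2, hs.gg0, ?_, ?_, ?_, ⟨u * s, ?_⟩⟩ <;>
    simp only [bil_mul_left, bil_mul_right, hs.gh1, hs.gh2, hs.hh2, h1] <;> ring

lemma bil_sub_self (hs : IsSol a1 a2 a0 g h) (k : R) :
    bil a1 (fun i => h i - k * g i) (fun i => h i - k * g i) = bil a1 h h ∧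
    bil a2 (fun i => h i - k * g i) (fun i => h i - k * g i) = bil a2 h h := by
  simp only [bil_sub_left, bil_sub_right, bil_mul_left, bil_mul_right, hs.gg1, hs.gg2, hs.gh1,
    hs.gh2, bil_comm _ h g]
  simp

lemma sub_mul (hs : IsSol a1 a2 a0 g h) (k : R) :
    IsSol a1 a2 a0 g (fun i => h i - k * g i) := by
  obtain ⟨e1, e2⟩ := hs.bil_sub_self k
  refine ⟨hs.gg1, hs.gg2, hs.gg0, ?_, ?_, ?_, ?_⟩
  · simp [bil_sub_right, bil_mul_right, hs.gg1, hs.gh1]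
  · simp [bil_sub_right, bil_mul_right, hs.gg2, hs.gh2]
  · rw [e1, e2]; exact hs.hh2
  · rw [e1]; exact hs.hh1

lemma map {S : Type*} [CommRing S] (f : R →+* S) (hs : IsSol a1 a2 a0 g h) :
    IsSol (fun i => f (a1 i)) (fun i => f (a2 i)) (fun i => f (a0 i)) (fun i => f (g i))
      (fun i => f (h i)) := by
  have hb : ∀ a g h, bil (fun i => f (a i)) (fun i => f (g i)) (fun i => f (h i)) =
      f (bil a g h) := by
    intro a g h
    simp [bil]
  obtain ⟨t, ht⟩ := hs.gg0
  obtain ⟨s, h1⟩ := hs.hh1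
  constructor <;> simp only [hb]
  · simp [hs.gg1]
  · simp [hs.gg2]
  · exact ⟨f t, by rw [ht, map_pow]⟩
  · simp [hs.gh1]
  · simp [hs.gh2]
  · rw [hs.hh2, map_mul, map_ofNat]
  · exact ⟨f s, by rw [h1, map_mul, map_pow, map_ofNat]⟩

end IsSol
end

/-- `forceLists l k = k l`, evaluating the entries of `l` first. -/
def forceLists (l : List (List ℕ)) (k : List (List ℕ) → Bool) : Bool :=
  match l with
  | [] => k []
  | x :: l => forceList x fun y => forceLists l fun t => k (y :: t)

@[simp] lemma forceLists_eq (l : List (List ℕ)) (k : List (List ℕ) → Bool) :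
    forceLists l k = k l := by
  induction l generalizing k <;> simp_all [forceLists]

/-- Lowest digits of a vector whose entry at `i` is `1`, preceded by multiples of `p`, and whose
entries in `z` vanish. -/
def firstDigits (p : ℕ) (z : Fin 5 → Bool) (i k : Fin 5) : List ℕ :=
  if z k || decide (k < i) then [0] else if k = i then [1] else List.range p

/-- Higher digits of a vector as in `firstDigits`. -/
def laterDigits (p : ℕ) (z : Fin 5 → Bool) (i k : Fin 5) : List ℕ :=
  if z k || decide (k = i) then [0] else List.range p

noncomputable def dead (p e n : ℕ) (l1 l2 l0 : List ℕ) : Bool :=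
  (List.finRange 5).all fun i => (List.finRange 5).all fun j => decide (i = j) ||
    forceLists (List.ofFn (firstDigits p (fun _ => false) i)) fun dg =>
    forceLists (List.ofFn (firstDigits p (fun k => decide (k = i)) j)) fun dh =>
    forceLists (List.ofFn (laterDigits p (fun _ => false) i)) fun dg' =>
    forceLists (List.ofFn (laterDigits p (fun k => decide (k = i)) j)) fun dh' =>
    search p e l1 l2 l0 dg' dh' n dg dh 1 [0, 0, 0, 0, 0] [0, 0, 0, 0, 0]

lemma mem_digits {p N : ℕ} [Fact p.Prime] {z : Fin 5 → Bool} {i : Fin 5}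
    {x : Fin 5 → ZMod (p ^ (N + 1))} (hi : x i = 1) (hlt : ∀ k < i, ¬ IsUnit (x k))
    (hz : ∀ k, z k = true → x k = 0) (k : Fin 5) :
    (x k).val / 1 % p ∈ firstDigits p z i k ∧
      ∀ r, (x k).val / (1 * p ^ (r + 1)) % p ∈ laterDigits p z i k := by
  have hp : 1 < p := (Fact.out : p.Prime).one_lt
  have hq : 1 < p ^ (N + 1) := Nat.one_lt_pow (by omega) hp
  have : Fact (1 < p ^ (N + 1)) := ⟨hq⟩
  constructor
  · unfold firstDigits
    split_ifs with h1 h2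
    · rw [Nat.div_one, List.mem_singleton]
      rw [Bool.or_eq_true, decide_eq_true_eq] at h1
      rcases h1 with h1 | h1
      · rw [hz k h1]; simp
      · have h3 := hlt k h1
        rw [← ZMod.natCast_zmod_val (x k), ZMod.isUnit_iff_coprime] at h3
        by_contra h4
        exact h3 (((Nat.Prime.coprime_iff_not_dvd Fact.out).2
          fun h => h4 (Nat.mod_eq_zero_of_dvd h)).symm.pow_right _)
    · rw [h2, hi, ZMod.val_one, Nat.div_one, Nat.mod_eq_of_lt hp]; simp
    · exact List.mem_range.2 (Nat.mod_lt _ (by omega))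
  · intro r
    unfold laterDigits
    split_ifs with h1
    · rw [List.mem_singleton]
      rw [Bool.or_eq_true, decide_eq_true_eq] at h1
      rcases h1 with h1 | rfl
      · rw [hz k h1]; simp
      · rw [hi, ZMod.val_one, one_mul, Nat.div_eq_of_lt (Nat.one_lt_pow (by omega) hp),
          Nat.zero_mod]
    · exact List.mem_range.2 (Nat.mod_lt _ (by omega))

lemma exists_first_unit {R : Type*} [Monoid R] {x : Fin 5 → R} (h : ∃ i, IsUnit (x i)) :
    ∃ i, IsUnit (x i) ∧ ∀ k < i, ¬ IsUnit (x k) := by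
  obtain ⟨i, hi, hm⟩ := WellFounded.has_min (wellFounded_lt (α := Fin 5)) {i | IsUnit (x i)} h
  exact ⟨i, hi, fun k hk h => hm k h hk⟩

lemma false_of_dead {p e n N : ℕ} [Fact p.Prime] (he : e ∣ 2) (hep : e ∣ p)
    (hn : e * p ^ n ∣ p ^ (N + 1)) {a1 a2 a0 : ℕ → ℕ}
    (hd : dead p e n ((List.range 9).map a1) ((List.range 9).map a2) ((List.range 9).map a0) = true)
    {g h : Fin 5 → ZMod (p ^ (N + 1))}
    (hs : IsSol (fun i => (a1 i : ZMod (p ^ (N + 1)))) (fun i => (a2 i : ZMod (p ^ (N + 1))))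
      (fun i => (a0 i : ZMod (p ^ (N + 1)))) g h)
    (hg : ∃ i, IsUnit (g i)) (hh : ∀ k, ∃ i, IsUnit (h i - k * g i)) : False := by
  have hp : 1 < p := (Fact.out : p.Prime).one_lt
  have : Fact (1 < p ^ (N + 1)) := ⟨Nat.one_lt_pow (by omega) hp⟩
  obtain ⟨i, ⟨u, hu⟩, hi⟩ := exists_first_unit hg
  set G : Fin 5 → ZMod (p ^ (N + 1)) := fun k => ↑u⁻¹ * g k with hG
  have hGi : G i = 1 := by simp [hG, ← hu]
  have hGlt : ∀ k < i, ¬ IsUnit (G k) := fun k hk => by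
    simpa [hG] using hi k hk
  obtain ⟨j, ⟨v, hv⟩, hj⟩ := exists_first_unit (hh (h i * ↑u⁻¹))
  set H : Fin 5 → ZMod (p ^ (N + 1)) := fun k => ↑v⁻¹ * (h k - h i * ↑u⁻¹ * g k) with hH
  have hHj : H j = 1 := by simp [hH, ← hv]
  have hHi : H i = 0 := by simp [hH, ← hu, mul_assoc]
  have hHlt : ∀ k < j, ¬ IsUnit (H k) := fun k hk => by
    simpa [hH] using hj k hk
  have hij : i ≠ j := by
    rintro rfl
    rw [hHi] at hHj
    exact zero_ne_one hHj
  have hs' : IsSol (fun i => (a1 i : ZMod (p ^ (N + 1)))) (fun i => (a2 i : ZMod (p ^ (N + 1))))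
      (fun i => (a0 i : ZMod (p ^ (N + 1)))) G H :=
    ((hs.sub_mul (h i * ↑u⁻¹)).mul_right _).mul_left _
  have mg := mem_digits (z := fun _ => false) hGi hGlt (by simp)
  have mh := mem_digits (z := fun k => decide (k = i)) hHj hHlt (fun k hk => by
    rw [of_decide_eq_true hk, hHi])
  have key := search_eq_false (q := p ^ (N + 1)) (a1 := a1) (a2 := a2) (a0 := a0)
    (G := fun k => (G k).val) (H := fun k => (H k).val) he hep
    (by simpa only [ZMod.natCast_zmod_val] using hs') n 1
    (firstDigits p (fun _ => false) i) (firstDigits p (fun k => decide (k = i)) j)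
    (by rwa [one_mul]) (fun k => (mg k).1) (fun k => (mh k).1) (fun k => (mg k).2)
    (fun k => (mh k).2)
  simp only [dead, List.all_eq_true, Bool.or_eq_true, decide_eq_true_eq, forceLists_eq] at hd
  have hd' := (hd i (List.mem_finRange i) j (List.mem_finRange j)).resolve_left hij
  simp only [Nat.mod_one, List.ofFn_const] at key
  exact absurd (key.symm.trans hd') (by simp)

namespace IsSol
variable {a1 a2 a0 : ℕ → ℤ} {g h : Fin 5 → ℤ} {p : ℤ}

lemma of_mul_left (hp : p ≠ 0) (hs : IsSol a1 a2 a0 (fun i => p * g i) h) :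
    IsSol a1 a2 a0 g h := by
  obtain ⟨gg1, gg2, ⟨t, ht⟩, gh1, gh2, hh2, hh1⟩ := hs
  simp only [bil_mul_left, bil_mul_right, mul_eq_zero, hp, false_or] at gg1 gg2 ht gh1 gh2
  obtain ⟨t, rfl⟩ : p ∣ t := (Int.pow_dvd_pow_iff two_ne_zero).1 ⟨bil a0 g g, by rw [← ht]; ring⟩
  exact ⟨gg1, gg2, ⟨t, mul_left_cancel₀ (pow_ne_zero 2 hp) (by linear_combination ht)⟩,
    gh1, gh2, hh2, hh1⟩

lemma of_mul_right (hp : p ≠ 0) (h15 : ∀ s, p ^ 2 ∣ 15 * s ^ 2 → p ∣ s)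
    (hs : IsSol a1 a2 a0 g (fun i => p * h i)) : IsSol a1 a2 a0 g h := by
  obtain ⟨gg1, gg2, gg0, gh1, gh2, hh2, ⟨s, hh1⟩⟩ := hs
  simp only [bil_mul_left, bil_mul_right, mul_eq_zero, hp, false_or] at hh1 hh2 gh1 gh2
  obtain ⟨s, rfl⟩ : p ∣ s := h15 s ⟨bil a1 h h, by rw [← hh1]; ring⟩
  exact ⟨gg1, gg2, gg0, gh1, gh2,
    mul_left_cancel₀ (pow_ne_zero 2 hp) (by linear_combination hh2),
    ⟨s, mul_left_cancel₀ (pow_ne_zero 2 hp) (by linear_combination hh1)⟩⟩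

lemma exists_not_dvd (hp : Prime p) (hs : IsSol a1 a2 a0 g h) (hg : g ≠ 0) :
    ∃ g', IsSol a1 a2 a0 g' h ∧ ∃ i, ¬ p ∣ g' i := by
  obtain ⟨i, hi⟩ := Function.ne_iff.1 hg
  induction hn : (g i).natAbs using Nat.strong_induction_on generalizing g with
  | _ n ih =>
    by_cases hd : ∃ i, ¬ p ∣ g i
    · exact ⟨g, hs, hd⟩
    · push Not at hd
      choose g' hg' using hd
      rw [funext hg'] at hs
      have hi' : g' i ≠ 0 := fun h0 => hi (by rw [hg', h0, mul_zero]; rfl)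
      refine ih _ ?_ (of_mul_left hp.ne_zero hs) (fun h0 => hi' (congrFun h0 i)) hi' rfl
      rw [← hn, hg', Int.natAbs_mul]
      have h1 := Int.natAbs_pos.2 hi'
      have h2 := (Int.prime_iff_natAbs_prime.1 hp).two_le
      nlinarith

lemma exists_independent (hp : Prime p) (h15 : ∀ s, p ^ 2 ∣ 15 * s ^ 2 → p ∣ s)
    (hs : IsSol a1 a2 a0 g h) (hh : bil a1 h h ≠ 0) :
    ∃ h', IsSol a1 a2 a0 g h' ∧ ∀ k, ∃ i, ¬ p ∣ h' i - k * g i := by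
  induction hn : (bil a1 h h).natAbs using Nat.strong_induction_on generalizing h with
  | _ n ih =>
    by_cases hd : ∀ k, ∃ i, ¬ p ∣ h i - k * g i
    · exact ⟨h, hs, hd⟩
    · push Not at hd
      obtain ⟨k, hd⟩ := hd
      choose h' hh' using hd
      have hs' := hs.sub_mul k
      have e := (hs.bil_sub_self k).1
      rw [funext hh'] at hs' e
      rw [bil_mul_left, bil_mul_right, ← mul_assoc] at e
      have h0 : bil a1 h' h' ≠ 0 := fun h0 => hh (by rw [← e, h0, mul_zero])
      refine ih _ ?_ (of_mul_right hp.ne_zero h15 hs') h0 rfl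
      rw [← hn, ← e, Int.natAbs_mul, Int.natAbs_mul]
      have h1 := Int.natAbs_pos.2 h0
      have h2 := (Int.prime_iff_natAbs_prime.1 hp).two_le
      have h3 := Nat.mul_le_mul h2 h2
      nlinarith

end IsSol

/-- The linear recurrent sequence satisfied by the powers of the generator. -/
def wseq (a b c d e : ℤ) : ℕ → ℤ
  | 0 => a
  | n + 1 => wseq b c d e (5 * d - 5 * b + 4 * a) n

/-- The number `φ (c * w ^ k)`, where `φ` is the functional with `φ (w ^ i) = s i` for all `i`. -/
def hankel (s : ℕ → ℤ) (c0 c1 c2 c3 c4 : ℤ) (k : ℕ) : ℤ :=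
  c0 * s k + c1 * s (k + 1) + c2 * s (k + 2) + c3 * s (k + 3) + c4 * s (k + 4)

def seq1 : ℕ → ℤ := wseq 0 0 1 0 1

def seq2 : ℕ → ℤ := wseq 0 1 0 2 (-4)

def seq0 : ℕ → ℤ := wseq 1 0 0 (-2) 4

def hankelMod (q : ℕ) (s : ℕ → ℤ) (c0 c1 c2 c3 c4 : ℤ) : List ℕ :=
  (List.range 9).map fun k => (hankel s c0 c1 c2 c3 c4 k % q).toNat

noncomputable def deadClass (p e n q : ℕ) (c0 c1 c2 c3 c4 : ℤ) : Bool :=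
  forceList (hankelMod q seq1 c0 c1 c2 c3 c4) fun l1 =>
  forceList (hankelMod q seq2 c0 c1 c2 c3 c4) fun l2 =>
  forceList (hankelMod q seq0 c0 c1 c2 c3 c4) fun l0 => dead p e n l1 l2 l0

lemma isUnit_intCast {p N : ℕ} [Fact p.Prime] {x : ℤ} (hx : ¬ (p : ℤ) ∣ x) :
    IsUnit (x : ZMod (p ^ (N + 1))) := by
  rw [ZMod.coe_int_isUnit_iff_isCoprime]
  push_cast
  exact ((Nat.prime_iff_prime_int.1 Fact.out).irreducible.coprime_iff_not_dvd.2 hx).pow_left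

lemma not_isSol_of_deadClass {p e n : ℕ} (N : ℕ) [Fact p.Prime] (he : e ∣ 2) (hep : e ∣ p)
    (hn : e * p ^ n ∣ p ^ (N + 1)) (h15 : ∀ s : ℤ, (p : ℤ) ^ 2 ∣ 15 * s ^ 2 → (p : ℤ) ∣ s)
    {c0 c1 c2 c3 c4 : ℤ} (hd : deadClass p e n (p ^ (N + 1)) c0 c1 c2 c3 c4 = true)
    {g h : Fin 5 → ℤ} (hs : IsSol (hankel seq1 c0 c1 c2 c3 c4) (hankel seq2 c0 c1 c2 c3 c4)
      (hankel seq0 c0 c1 c2 c3 c4) g h) (hg : g ≠ 0)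
    (hh : bil (hankel seq1 c0 c1 c2 c3 c4) h h ≠ 0) : False := by
  have hp : Prime (p : ℤ) := Nat.prime_iff_prime_int.1 Fact.out
  obtain ⟨g, hs, i, hi⟩ := hs.exists_not_dvd hp hg
  obtain ⟨h, hs, hh⟩ := hs.exists_independent hp h15 hh
  have hs' := hs.map (Int.castRingHom (ZMod (p ^ (N + 1))))
  have hq : ((p ^ (N + 1) : ℕ) : ℤ) ≠ 0 := by
    exact_mod_cast pow_ne_zero _ (Fact.out : p.Prime).ne_zero
  have hc : ∀ x : ℤ, (Int.castRingHom (ZMod (p ^ (N + 1)))) x =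
      ((x % (p ^ (N + 1) : ℕ)).toNat : ZMod (p ^ (N + 1))) := by
    intro x
    rw [eq_intCast, ← Int.cast_natCast, Int.toNat_of_nonneg (Int.emod_nonneg x hq),
      ZMod.intCast_mod]
  simp only [deadClass, forceList_eq, hankelMod] at hd
  refine false_of_dead he hep hn hd ?_ (g := fun i => Int.castRingHom _ (g i))
    (h := fun i => Int.castRingHom _ (h i)) ⟨i, isUnit_intCast hi⟩ fun k => ?_
  · simpa only [hc] using hs'
  · have : NeZero (p ^ (N + 1)) := ⟨pow_ne_zero _ (Fact.out : p.Prime).ne_zero⟩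
    obtain ⟨j, hj⟩ := hh k.val
    refine ⟨j, ?_⟩
    have := isUnit_intCast (N := N) hj
    simpa using this

lemma deadClass_three : deadClass 3 1 2 9 (-9) (-4) 2 1 0 = true := by decide +kernel

/-- Coordinates of the classes excluded by the search modulo powers of `2`. -/
def deadList : List (ℤ × ℤ × ℤ × ℤ × ℤ) :=
  [(-3, -1, 2, 1, 0),
    (3, -1, 2, 1, -1),
    (1, 0, 2, 3, 1),
    (45, -41, -25, 45, 23),
    (-9, 6, 10, -1, -2),
    (27, -29, -37, 6, 8),
    (1, -1, 0, 1, 0),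
    (5, -4, -2, 6, 3),
    (-5, 10, -6, -3, 2),
    (-1, -1, 1, 0, 0),
    (25, -19, -9, 27, 13),
    (313, -241, -117, 335, 162),
    (-1, 1, 1, 0, 0),
    (7, -7, -6, 5, 3)]

lemma deadClass_two : ∀ c ∈ deadList,
    deadClass 2 2 5 64 c.1 c.2.1 c.2.2.1 c.2.2.2.1 c.2.2.2.2 = true := by decide +kernel

section
variable {K : Type*} [Field K] [NumberField K] {w : K}

namespace IsGen

lemma el_mul (hw : IsGen w) (a0 a1 a2 a3 a4 b0 b1 b2 b3 b4 : ℤ) :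
    hw.el a0 a1 a2 a3 a4 * hw.el b0 b1 b2 b3 b4 =
      have q3 := a4 * b4
      have q2 := a3 * b4 + a4 * b3
      have q1 := a2 * b4 + a3 * b3 + a4 * b2 + 5 * q3
      have q0 := a1 * b4 + a2 * b3 + a3 * b2 + a4 * b1 + 5 * q2
      hw.el (a0 * b0 + 4 * q0) (a0 * b1 + a1 * b0 - 5 * q0 + 4 * q1)
        (a0 * b2 + a1 * b1 + a2 * b0 - 5 * q1 + 4 * q2)
        (a0 * b3 + a1 * b2 + a2 * b1 + a3 * b0 + 5 * q0 - 5 * q2 + 4 * q3)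
        (a0 * b4 + a1 * b3 + a2 * b2 + a3 * b1 + a4 * b0 + 5 * q1 - 5 * q3) := by
  simp only [el]
  push_cast
  linear_combination (a1 * b4 + a2 * b3 + a3 * b2 + a4 * b1 + 5 * (a3 * b4 + a4 * b3) +
    (a2 * b4 + a3 * b3 + a4 * b2 + 5 * (a4 * b4)) * hw.int + (a3 * b4 + a4 * b3) * hw.int ^ 2 +
    a4 * b4 * hw.int ^ 3) * hw.int_root

lemma cls_eq (hw : IsGen w) {i j k l : ℕ} (hi : i < 2) (hj : j < 2) (hk : k < 2) (hl : l < 2) :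
    hw.cls i j k l = 1 ∨ hw.cls i j k l = hw.el (-9) (-4) 2 1 0 ∨
    ∃ c ∈ deadList, hw.cls i j k l = hw.el c.1 c.2.1 c.2.2.1 c.2.2.2.1 c.2.2.2.2 := by
  simp only [cls, coe_u1, coe_u2, p4, p9, deadList, List.exists_mem_cons_iff]
  interval_cases i <;> interval_cases j <;> interval_cases k <;> interval_cases l <;>
    simp [el_mul]

lemma th_inv (hw : IsGen w) :
    ((hw.th : 𝓞 K) : K)⁻¹ = 1 / 6 - 4 / 3 * w - 5 / 6 * w ^ 2 + 1 / 3 * w ^ 3 + 1 / 6 * w ^ 4 := by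
  rw [th, coe_el]
  refine inv_eq_of_mul_eq_one_right ?_
  push_cast
  linear_combination (1 / 3 - 1 / 3 * w - w ^ 2 / 6) * hw.root

/-- The linear functional with the given values at `1, w, w ^ 2, w ^ 3, w ^ 4`. -/
noncomputable def fn (hw : IsGen w) (a b c d e : ℤ) : K →ₗ[ℚ] ℚ :=
  hw.basis.constr ℚ ![(a : ℚ), b, c, d, e]

lemma fn_pow (hw : IsGen w) (a b c d e : ℤ) (n : ℕ) :
    hw.fn a b c d e (w ^ n) = wseq a b c d e n := by
  have key : ∀ n (φ : K →ₗ[ℚ] ℚ) (z : K) (a b c d e : ℤ), φ z = a → φ (z * w) = b →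
      φ (z * w ^ 2) = c → φ (z * w ^ 3) = d → φ (z * w ^ 4) = e →
      φ (z * w ^ n) = wseq a b c d e n := by
    intro n φ
    induction n with
    | zero => intro z a b c d e h0 _ _ _ _; simpa [wseq] using h0
    | succ n ih =>
      intro z a b c d e h0 h1 h2 h3 h4
      rw [pow_succ', ← mul_assoc, wseq]
      refine ih _ _ _ _ _ _ h1 (by rw [← h2]; ring_nf) (by rw [← h3]; ring_nf)
        (by rw [← h4]; ring_nf) ?_
      have : z * w * w ^ 4 = (5 : ℚ) • (z * w ^ 3) - (5 : ℚ) • (z * w) + (4 : ℚ) • z := by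
        simp only [Algebra.smul_def, map_ofNat]
        linear_combination z * hw.root
      rw [this, map_add, map_sub, map_smul, map_smul, map_smul, h0, h1, h3]
      push_cast
      simp only [smul_eq_mul]
  have hb : ∀ i : Fin 5, hw.fn a b c d e (w ^ (i : ℕ)) = ![(a : ℚ), b, c, d, e] i := fun i => by
    rw [← hw.basis_apply, fn, Module.Basis.constr_basis]
  rw [← one_mul (w ^ n)]
  exact key n _ 1 _ _ _ _ _ (by simpa using hb 0) (by simpa using hb 1)
    (by simpa using hb 2) (by simpa using hb 3) (by simpa using hb 4)

lemma fn_el_mul_pow (hw : IsGen w) (a b c d e c0 c1 c2 c3 c4 : ℤ) (k : ℕ) :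
    hw.fn a b c d e (hw.el c0 c1 c2 c3 c4 * w ^ k) =
      hankel (wseq a b c d e) c0 c1 c2 c3 c4 k := by
  have : (hw.el c0 c1 c2 c3 c4 : K) * w ^ k = (c0 : ℚ) • w ^ k + (c1 : ℚ) • w ^ (k + 1) +
      (c2 : ℚ) • w ^ (k + 2) + (c3 : ℚ) • w ^ (k + 3) + (c4 : ℚ) • w ^ (k + 4) := by
    rw [coe_el]
    simp only [Algebra.smul_def, map_intCast]
    ring
  rw [this, hankel]
  simp only [map_add, map_smul, fn_pow, smul_eq_mul]
  push_cast
  ring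

lemma fn_el_mul_mul (hw : IsGen w) (a b c d e c0 c1 c2 c3 c4 : ℤ) (g h : Fin 5 → ℚ) :
    hw.fn a b c d e (hw.el c0 c1 c2 c3 c4 * (∑ i, (g i : K) * w ^ (i : ℕ)) *
      (∑ i, (h i : K) * w ^ (i : ℕ))) =
      bil (fun k => (hankel (wseq a b c d e) c0 c1 c2 c3 c4 k : ℚ)) g h := by
  have : (hw.el c0 c1 c2 c3 c4 : K) * (∑ i, (g i : K) * w ^ (i : ℕ)) *
      (∑ i, (h i : K) * w ^ (i : ℕ)) =
      ∑ i : Fin 5, ∑ j : Fin 5, (g i * h j : ℚ) • (hw.el c0 c1 c2 c3 c4 * w ^ (i + j : ℕ)) := by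
    simp only [Finset.mul_sum, Finset.sum_mul, Algebra.smul_def, eq_ratCast]
    rw [Finset.sum_comm]
    refine Finset.sum_congr rfl fun i _ => Finset.sum_congr rfl fun j _ => ?_
    push_cast
    ring
  rw [this, bil]
  simp only [map_sum, map_smul, fn_el_mul_pow, smul_eq_mul]
  refine Finset.sum_congr rfl fun i _ => Finset.sum_congr rfl fun j _ => ?_
  ring

lemma fn_span (hw : IsGen w) (a b c d e : ℤ) (x0 x1 x2 x3 : ℚ) :
    hw.fn a b c d e (x0 + x1 * hw.th + x2 * hw.th ^ 2 + x3 * (hw.th : K)⁻¹) =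
      x0 * a + x1 * (-2 * a + 2 * b - d) + x2 * (4 * a - 4 * b - c + 4 * d + e) +
      x3 * (1 / 6 * a - 4 / 3 * b - 5 / 6 * c + 1 / 3 * d + 1 / 6 * e) := by
  have h := hw.fn_pow a b c d e
  have : (x0 + x1 * hw.th + x2 * hw.th ^ 2 + x3 * (hw.th : K)⁻¹ : K) =
      (x0 - 2 * x1 + 4 * x2 + 1 / 6 * x3 : ℚ) • w ^ 0 +
      (2 * x1 - 4 * x2 - 4 / 3 * x3 : ℚ) • w ^ 1 + (-x2 - 5 / 6 * x3 : ℚ) • w ^ 2 +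
      (-x1 + 4 * x2 + 1 / 3 * x3 : ℚ) • w ^ 3 + (x2 + 1 / 6 * x3 : ℚ) • w ^ 4 := by
    rw [th_inv, th, coe_el]
    simp only [Algebra.smul_def, eq_ratCast]
    push_cast
    linear_combination x2 * w * hw.root
  rw [this]
  simp only [map_add, map_smul, h, wseq, smul_eq_mul]
  ring

end IsGen
end

lemma exists_int_vector (g : Fin 5 → ℚ) :
    ∃ n : ℚ, n ≠ 0 ∧ ∃ G : Fin 5 → ℤ, ∀ i, (G i : ℚ) = n * g i := by
  obtain ⟨b, hb⟩ := IsLocalization.exist_integer_multiples_of_finite (nonZeroDivisors ℤ) g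
  choose G hG using hb
  refine ⟨(b : ℤ), Int.cast_ne_zero.2 (nonZeroDivisors.ne_zero b.2), G, fun i => ?_⟩
  have := hG i
  rw [algebraMap_int_eq, eq_intCast] at this
  rw [this, zsmul_eq_mul]

lemma exists_int_sq {x : ℤ} {t : ℚ} (h : (x : ℚ) = t ^ 2) : ∃ t : ℤ, x = t ^ 2 := by
  obtain ⟨r, hr⟩ := Rat.isSquare_intCast_iff.1 ⟨t, by rw [h, sq]⟩
  exact ⟨r, by rw [hr, sq]⟩

lemma dvd_of_dvd_sq {p x : ℤ} (hp : Prime p) (h : p ∣ x ^ 2) : p ∣ x := hp.dvd_of_dvd_pow h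

lemma exists_int_fifteen_mul_sq {x : ℤ} {t : ℚ} (h : (x : ℚ) = 15 * t ^ 2) :
    ∃ t : ℤ, x = 15 * t ^ 2 := by
  obtain ⟨r, hr⟩ := exists_int_sq (x := 15 * x) (t := 15 * t) (by push_cast; rw [h]; ring)
  have h3 : (3 : ℤ) ∣ r := dvd_of_dvd_sq Int.prime_three ⟨5 * x, by rw [← hr]; ring⟩
  have h5 : (5 : ℤ) ∣ r := dvd_of_dvd_sq (Nat.prime_iff_prime_int.1 (by norm_num : Nat.Prime 5))
    ⟨3 * x, by rw [← hr]; ring⟩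
  obtain ⟨u, rfl⟩ : (15 : ℤ) ∣ r := by omega
  exact ⟨u, by linarith⟩

lemma IsSol.exists_int {a1 a2 a0 : ℕ → ℤ} {g h : Fin 5 → ℚ}
    (hs : IsSol (fun i => (a1 i : ℚ)) (fun i => (a2 i : ℚ)) (fun i => (a0 i : ℚ)) g h)
    (hg : g ≠ 0) (hh : bil (fun i => (a1 i : ℚ)) h h ≠ 0) :
    ∃ G H : Fin 5 → ℤ, IsSol a1 a2 a0 G H ∧ G ≠ 0 ∧ bil a1 H H ≠ 0 := by
  obtain ⟨n, hn, G, hG⟩ := exists_int_vector g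
  obtain ⟨m, hm, H, hH⟩ := exists_int_vector h
  have hs' := (hs.mul_left n).mul_right m
  have hb : ∀ (a : ℕ → ℤ) (g h : Fin 5 → ℤ),
      bil (fun i => (a i : ℚ)) (fun i => (g i : ℚ)) (fun i => (h i : ℚ)) = (bil a g h : ℤ) := by
    intro a g h
    simp [bil]
  have hh' : bil (fun i => (a1 i : ℚ)) (fun i => m * h i) (fun i => m * h i) ≠ 0 := by
    rw [bil_mul_left, bil_mul_right]
    exact mul_ne_zero hm (mul_ne_zero hm hh)
  simp only [← hG, ← hH] at hs' hh'
  rw [hb, Int.cast_ne_zero] at hh'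
  obtain ⟨gg1, gg2, ⟨t, ht⟩, gh1, gh2, hh2, ⟨s, hs1⟩⟩ := hs'
  rw [hb] at gg1 gg2 ht gh1 gh2 hh2 hs1
  rw [hb] at hh2
  refine ⟨G, H, ⟨by exact_mod_cast gg1, by exact_mod_cast gg2, exists_int_sq ht,
    by exact_mod_cast gh1, by exact_mod_cast gh2, by exact_mod_cast hh2,
    exists_int_fifteen_mul_sq hs1⟩, ?_, hh'⟩
  rintro rfl
  refine hg (funext fun i => ?_)
  have := hG i
  simpa [hn] using this.symm

section
variable {K : Type*} [Field K] [NumberField K] {w : K}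

namespace IsGen

lemma bil_eq_of_mul_eq (hw : IsGen w) {c0 c1 c2 c3 c4 : ℤ} {γ γ' : K} {g h : Fin 5 → ℚ}
    (hg : γ = ∑ i, (g i : K) * w ^ (i : ℕ)) (hh : γ' = ∑ i, (h i : K) * w ^ (i : ℕ))
    {x0 x1 x2 x3 : ℚ} (hm : hw.el c0 c1 c2 c3 c4 * γ * γ' =
      x0 + x1 * hw.th + x2 * hw.th ^ 2 + x3 * (hw.th : K)⁻¹) (a b c d e : ℤ) :
    bil (fun k => (hankel (wseq a b c d e) c0 c1 c2 c3 c4 k : ℚ)) g h =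
      x0 * a + x1 * (-2 * a + 2 * b - d) + x2 * (4 * a - 4 * b - c + 4 * d + e) +
      x3 * (1 / 6 * a - 4 / 3 * b - 5 / 6 * c + 1 / 3 * d + 1 / 6 * e) := by
  rw [← hw.fn_el_mul_mul, ← hg, ← hh, hm, hw.fn_span]

lemma exists_isSol (hw : IsGen w) {c0 c1 c2 c3 c4 : ℤ} {γ γ' : K} (hγ : γ ≠ 0)
    {t x1 x2 y0 y1 y2 z0 z1 z2 : ℚ}
    (h1 : hw.el c0 c1 c2 c3 c4 * γ * γ =
      ((t ^ 2 : ℚ) : K) + x1 * hw.th + x2 * hw.th ^ 2)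
    (h2 : hw.el c0 c1 c2 c3 c4 * γ * γ' = (y0 : K) + y1 * hw.th + y2 * hw.th ^ 2)
    (h3 : hw.el c0 c1 c2 c3 c4 * γ' * γ' =
      (z0 : K) + z1 * hw.th + z2 * hw.th ^ 2 - 90 * (hw.th : K)⁻¹) :
    ∃ G H : Fin 5 → ℤ, IsSol (hankel seq1 c0 c1 c2 c3 c4) (hankel seq2 c0 c1 c2 c3 c4)
      (hankel seq0 c0 c1 c2 c3 c4) G H ∧ G ≠ 0 ∧
      bil (hankel seq1 c0 c1 c2 c3 c4) H H ≠ 0 := by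
  obtain ⟨g0, g1, g2, g3, g4, hg⟩ := hw.exists_coords γ
  obtain ⟨k0, k1, k2, k3, k4, hk⟩ := hw.exists_coords γ'
  have hg' : γ = ∑ i, ((![g0, g1, g2, g3, g4] i : ℚ) : K) * w ^ (i : ℕ) := by
    rw [hg]; simp [Fin.sum_univ_succ]; ring
  have hk' : γ' = ∑ i, ((![k0, k1, k2, k3, k4] i : ℚ) : K) * w ^ (i : ℕ) := by
    rw [hk]; simp [Fin.sum_univ_succ]; ring
  have b1 := hw.bil_eq_of_mul_eq hg' hg' (x0 := t ^ 2) (x1 := x1) (x2 := x2) (x3 := 0)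
    (h1.trans (by simp))
  have b2 := hw.bil_eq_of_mul_eq hg' hk' (x3 := 0) (by simpa using h2)
  have b3 := hw.bil_eq_of_mul_eq hk' hk' (x3 := -90) (by simpa [sub_eq_add_neg] using h3)
  have hh : bil (fun i => (hankel seq1 c0 c1 c2 c3 c4 i : ℚ)) ![k0, k1, k2, k3, k4]
      ![k0, k1, k2, k3, k4] = 60 := by
    rw [seq1, b3]; norm_num
  refine IsSol.exists_int (g := ![g0, g1, g2, g3, g4]) (h := ![k0, k1, k2, k3, k4])
    ⟨?_, ?_, ⟨t, ?_⟩, ?_, ?_, ?_, ⟨2, ?_⟩⟩ ?_ ?_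
  · rw [seq1, b1]; norm_num
  · rw [seq2, b1]; norm_num
  · rw [seq0, b1]; norm_num
  · rw [seq1, b2]; norm_num
  · rw [seq2, b2]; norm_num
  · rw [hh, seq2, b3]; norm_num
  · rw [hh]; norm_num
  · intro h0
    refine hγ (hg'.trans ?_)
    rw [h0]; simp
  · rw [hh]; norm_num

/-- Only the trivial class is represented. -/
lemma cls_eq_one (hw : IsGen w) {i j k l : ℕ} (hi : i < 2) (hj : j < 2) (hk : k < 2) (hl : l < 2)
    {γ γ' : K} (hγ : γ ≠ 0) {t x1 x2 y0 y1 y2 z0 z1 z2 : ℚ}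
    (h1 : hw.cls i j k l * γ * γ = ((t ^ 2 : ℚ) : K) + x1 * hw.th + x2 * hw.th ^ 2)
    (h2 : hw.cls i j k l * γ * γ' = (y0 : K) + y1 * hw.th + y2 * hw.th ^ 2)
    (h3 : hw.cls i j k l * γ' * γ' =
      (z0 : K) + z1 * hw.th + z2 * hw.th ^ 2 - 90 * (hw.th : K)⁻¹) :
    hw.cls i j k l = 1 := by
  rcases hw.cls_eq hi hj hk hl with h | h | ⟨c, hc, h⟩
  · exact h
  · rw [h] at h1 h2 h3
    obtain ⟨G, H, hs, hG, hH⟩ := hw.exists_isSol hγ h1 h2 h3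
    have : Fact (Nat.Prime 3) := ⟨Nat.prime_three⟩
    refine (not_isSol_of_deadClass (p := 3) (e := 1) (n := 2) 1 (by norm_num) (by norm_num)
      (by norm_num) (fun s hs => ?_) deadClass_three hs hG hH).elim
    exact dvd_of_dvd_sq Int.prime_three (by push_cast at hs; omega)
  · rw [h] at h1 h2 h3
    obtain ⟨G, H, hs, hG, hH⟩ := hw.exists_isSol hγ h1 h2 h3
    refine (not_isSol_of_deadClass (p := 2) (e := 2) (n := 5) 5 (by norm_num) (by norm_num)
      (by norm_num) (fun s hs => ?_) (deadClass_two c hc) hs hG hH).elim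
    exact dvd_of_dvd_sq Int.prime_two (by push_cast at hs; omega)

end IsGen
end

/-- The numbers `s, p, b1, b0` are the coefficients of a Mumford representation
`y = b1 * t + b0` on `t ^ 2 - s * t + p = 0` of the curve
`y ^ 2 = 90 * t ^ 5 + 225 * t ^ 4 + 300 * t ^ 3 + 150 * t ^ 2 + 50 * t + 5`, with cofactor
`90 * t ^ 3 + e2 * t ^ 2 + e1 * t + e0`. -/
structure IsMumford (s p b1 b0 e2 e1 e0 : ℚ) : Prop where
  coeff_four : e2 - s * 90 = 225
  coeff_three : e1 - s * e2 + p * 90 = 300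
  coeff_two : b1 ^ 2 + e0 - s * e1 + p * e2 = 150
  coeff_one : 2 * b1 * b0 - s * e0 + p * e1 = 50
  coeff_zero : b0 ^ 2 + p * e0 = 5

/-- The point `(t, y)` lies on the curve. -/
def IsPoint (t y : ℚ) : Prop :=
  y ^ 2 = 90 * t ^ 5 + 225 * t ^ 4 + 300 * t ^ 3 + 150 * t ^ 2 + 50 * t + 5

section
variable {K : Type*} [Field K] [NumberField K] {w : K}

namespace IsGen

lemma th_coord (hw : IsGen w) (a b c : ℚ) : (a + b * hw.th + c * hw.th ^ 2 : K) =
    (a - 2 * b + 4 * c : ℚ) + (2 * b - 4 * c : ℚ) * w + (-c : ℚ) * w ^ 2 +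
      (-b + 4 * c : ℚ) * w ^ 3 + (c : ℚ) * w ^ 4 := by
  rw [th, coe_el]
  push_cast
  linear_combination c * w * hw.root

lemma quadratic_eq_zero (hw : IsGen w) {a b c : ℚ} (h : (a + b * hw.th + c * hw.th ^ 2 : K) = 0) :
    a = 0 ∧ b = 0 ∧ c = 0 := by
  rw [th_coord] at h
  obtain ⟨h0, h1, h2, h3, h4⟩ := hw.coords_eq_zero h
  exact ⟨by linarith, by linarith, by linarith⟩

lemma th_root (hw : IsGen w) : (hw.th : K) ^ 5 + 10 * (hw.th : K) ^ 4 + 30 * (hw.th : K) ^ 3 +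
    60 * (hw.th : K) ^ 2 + 45 * hw.th + 18 = 0 := by
  simp only [th, coe_el]; push_cast
  linear_combination (-14 + 20 * w - 15 * w ^ 2 + 15 * w ^ 4 - 4 * w ^ 5 -
    10 * w ^ 6 + 5 * w ^ 8 - w ^ 10) * hw.root

lemma aeval_coe_th (hw : IsGen w) : aeval (hw.th : K) sextic = 0 := by
  simp only [sextic, map_add, map_mul, map_pow, aeval_X, map_ofNat]
  linear_combination 5 * (hw.th : K) * hw.th_root

lemma th_ne_zero (hw : IsGen w) : (hw.th : K) ≠ 0 := fun h => by
  have := hw.th_root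
  rw [h] at this
  norm_num at this

lemma norm_quadratic (hw : IsGen w) (a b c : ℚ) :
    Algebra.norm ℚ (a + b * hw.th + c * hw.th ^ 2 : K) =
      a ^ 5 - a ^ 4 * b * 10 + a ^ 4 * c * 40 + a ^ 3 * b ^ 2 * 30 - a ^ 3 * b * c * 120 -
      a ^ 3 * c ^ 2 * 210 - a ^ 2 * b ^ 3 * 60 + a ^ 2 * b ^ 2 * c * 420 -
      a ^ 2 * b * c ^ 2 * 540 + a ^ 2 * c ^ 3 * 1260 + a * b ^ 4 * 45 - a * b ^ 3 * c * 360 +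
      a * b ^ 2 * c ^ 2 * 630 - a * b * c ^ 3 * 1080 - a * c ^ 4 * 135 - b ^ 5 * 18 +
      b ^ 4 * c * 180 - b ^ 3 * c ^ 2 * 540 + b ^ 2 * c ^ 3 * 1080 - b * c ^ 4 * 810 +
      c ^ 5 * 324 := by
  rw [th_coord, hw.norm_eq]
  simp [Matrix.det_succ_row_zero, Fin.sum_univ_succ, Fin.succAbove]
  ring

lemma norm_of_isMumford (hw : IsGen w) {s p b1 b0 e2 e1 e0 : ℚ}
    (h : IsMumford s p b1 b0 e2 e1 e0) :
    Algebra.norm ℚ (((1 : ℚ) : K) + (-s : ℚ) * hw.th + p * hw.th ^ 2) =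
      ((b1 ^ 2 * p + b1 * b0 * s + b0 ^ 2) / 5) ^ 2 := by
  obtain ⟨h4, h3, h2, h1, h0⟩ := h
  obtain rfl : e2 = 225 + s * 90 := by linear_combination h4
  obtain rfl : e1 = 300 + s * (225 + s * 90) - p * 90 := by linear_combination h3
  have hG1 : 2 * b1 * b0 + s * b1 ^ 2 = 50 + s * (150 + s * (300 + s * (225 + s * 90) - p * 90) -
      p * (225 + s * 90)) - p * (300 + s * (225 + s * 90) - p * 90) := by
    linear_combination h1 + s * h2
  have hG0 : b0 ^ 2 - p * b1 ^ 2 = 5 - p * (150 + s * (300 + s * (225 + s * 90) - p * 90) -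
      p * (225 + s * 90)) := by
    linear_combination h0 - p * h2
  have : ((b1 ^ 2 * p + b1 * b0 * s + b0 ^ 2) / 5) ^ 2 =
      ((2 * b1 * b0 + s * b1 ^ 2) ^ 2 * p + (2 * b1 * b0 + s * b1 ^ 2) * (b0 ^ 2 - p * b1 ^ 2) * s +
      (b0 ^ 2 - p * b1 ^ 2) ^ 2) / 25 := by ring
  rw [this, hG1, hG0, hw.norm_quadratic]
  ring

lemma exists_sq_of_isMumford (hw : IsGen w) {s p b1 b0 e2 e1 e0 : ℚ}
    (h : IsMumford s p b1 b0 e2 e1 e0) : ∃ γ : K, (1 - s * hw.th + p * hw.th ^ 2 : K) = γ ^ 2 := by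
  have hn := hw.norm_of_isMumford h
  obtain ⟨h4, h3, h2, h1, h0⟩ := h
  have hp : sextic.map (Int.castRingHom ℚ) = (C b1 * X ^ 2 + C b0 * X ^ 3) ^ 2 +
      (1 - C s * X + C p * X ^ 2) * (C e0 * X ^ 4 + C e1 * X ^ 3 + C e2 * X ^ 2 + C 90 * X) := by
    replace h4 := congrArg (C : ℚ → ℚ[X]) h4
    replace h3 := congrArg (C : ℚ → ℚ[X]) h3
    replace h2 := congrArg (C : ℚ → ℚ[X]) h2
    replace h1 := congrArg (C : ℚ → ℚ[X]) h1
    replace h0 := congrArg (C : ℚ → ℚ[X]) h0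
    simp only [C_add, C_sub, C_mul, C_pow, map_ofNat] at h4 h3 h2 h1 h0 ⊢
    simp only [sextic, Polynomial.map_add, Polynomial.map_mul, Polynomial.map_pow, map_X,
      Polynomial.map_ofNat]
    linear_combination -X ^ 2 * h4 - X ^ 3 * h3 - X ^ 4 * h2 - X ^ 5 * h1 - X ^ 6 * h0
  have ha : aeval (hw.th : K) (1 - C s * X + C p * X ^ 2 : ℚ[X]) =
      ((1 : ℚ) : K) + (-s : ℚ) * hw.th + p * hw.th ^ 2 := by
    simp only [map_add, map_sub, map_mul, map_pow, map_one, aeval_X, aeval_C, eq_ratCast]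
    push_cast
    ring
  have ha0 : ((1 : ℚ) : K) + (-s : ℚ) * hw.th + p * hw.th ^ 2 ≠ 0 := fun h =>
    one_ne_zero (hw.quadratic_eq_zero h).1
  obtain ⟨i, hi, j, hj, k, hk, l, hl, γ, hγ⟩ := hw.exists_cls_of_factor (s := _) (by
    compute_degree) hp (ha ▸ ha0) (ha ▸ hn)
  rw [ha] at hγ
  have hcγ : (hw.cls i j k l : K) ≠ 0 ∧ γ ≠ 0 := by
    rw [hγ] at ha0
    exact ⟨left_ne_zero_of_mul ha0, fun h => ha0 (by simp [h])⟩
  obtain ⟨hc, hγ0⟩ := hcγ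
  have hθ := hw.th_ne_zero
  have hβ : (b1 * hw.th + b0 * hw.th ^ 2 : K) ^ 2 = -((hw.cls i j k l : K) * γ ^ 2) *
      (e0 * hw.th ^ 2 + e1 * hw.th + e2 + 90 * (hw.th : K)⁻¹) := by
    have hr := hw.aeval_coe_th
    rw [← aeval_map_algebraMap ℚ, algebraMap_int_eq, hp, map_add, map_mul, ha, hγ] at hr
    simp only [map_add, map_mul, map_pow, aeval_X, aeval_C, eq_ratCast] at hr
    apply mul_left_cancel₀ (pow_ne_zero 2 hθ)
    push_cast at hr
    linear_combination hr + 90 * (hw.cls i j k l : K) * γ ^ 2 * hw.th * mul_inv_cancel₀ hθ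
  have hone := hw.cls_eq_one hi hj hk hl hγ0 (t := 1) (x1 := -s) (x2 := p) (y0 := 0) (y1 := b1)
    (y2 := b0) (z0 := -e2) (z1 := -e1) (z2 := -e0)
    (γ' := (b1 * hw.th + b0 * hw.th ^ 2) / (hw.cls i j k l * γ))
    (by rw [mul_assoc, ← sq, ← hγ]; norm_num)
    (by field_simp; push_cast; ring)
    (by
      rw [mul_assoc, div_mul_div_comm, ← sq, hβ]
      field_simp
      push_cast
      ring)
  refine ⟨γ, ?_⟩
  rw [hone] at hγ
  push_cast at hγ
  linear_combination hγ

lemma exists_sq_of_isPoint (hw : IsGen w) {t y : ℚ} (h : IsPoint t y) :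
    ∃ γ : K, (-90 * (hw.th - t * hw.th ^ 2) : K) = γ ^ 2 := by
  have hp : sextic.map (Int.castRingHom ℚ) = (C y * X ^ 3) ^ 2 +
      (-90 * (X - C t * X ^ 2)) * (-(X ^ 4 * C (90 * t ^ 4 + 225 * t ^ 3 + 300 * t ^ 2 +
        150 * t + 50) + X ^ 3 * C (90 * t ^ 3 + 225 * t ^ 2 + 300 * t + 150) +
        X ^ 2 * C (90 * t ^ 2 + 225 * t + 300) + X * C (90 * t + 225) + 90) * C (1 / 90)) := by
    replace h := congrArg (C : ℚ → ℚ[X]) h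
    have h90 : (C (1 / 90) : ℚ[X]) * 90 = 1 := by
      rw [← map_ofNat C, ← C_mul]; norm_num
    simp only [C_add, C_mul, C_pow, map_ofNat] at h ⊢
    simp only [sextic, Polynomial.map_add, Polynomial.map_mul, Polynomial.map_pow, map_X,
      Polynomial.map_ofNat]
    linear_combination -X ^ 6 * h - (X - C t * X ^ 2) * (X ^ 4 * (90 * C t ^ 4 + 225 * C t ^ 3 +
      300 * C t ^ 2 + 150 * C t + 50) + X ^ 3 * (90 * C t ^ 3 + 225 * C t ^ 2 + 300 * C t + 150) +
      X ^ 2 * (90 * C t ^ 2 + 225 * C t + 300) + X * (90 * C t + 225) + 90) * h90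
  have ha : aeval (hw.th : K) (-90 * (X - C t * X ^ 2) : ℚ[X]) =
      ((0 : ℚ) : K) + (-90 : ℚ) * hw.th + (90 * t : ℚ) * hw.th ^ 2 := by
    simp only [map_neg, map_sub, map_mul, map_pow, map_ofNat, aeval_X, aeval_C, eq_ratCast]
    push_cast
    ring
  have ha0 : ((0 : ℚ) : K) + (-90 : ℚ) * hw.th + (90 * t : ℚ) * hw.th ^ 2 ≠ 0 := fun h => by
    have := (hw.quadratic_eq_zero h).2.1
    norm_num at this
  have hn : Algebra.norm ℚ (((0 : ℚ) : K) + (-90 : ℚ) * hw.th + (90 * t : ℚ) * hw.th ^ 2) =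
      (90 ^ 2 * 18 * y) ^ 2 := by
    rw [hw.norm_quadratic]
    unfold IsPoint at h
    linear_combination -(90 ^ 4 * 18 ^ 2) * h
  obtain ⟨i, hi, j, hj, k, hk, l, hl, γ, hγ⟩ := hw.exists_cls_of_factor (s := _) (by
    compute_degree) hp (ha ▸ ha0) (ha ▸ hn)
  rw [ha] at hγ
  have hcγ : (hw.cls i j k l : K) ≠ 0 ∧ γ ≠ 0 := by
    rw [hγ] at ha0
    exact ⟨left_ne_zero_of_mul ha0, fun h => ha0 (by simp [h])⟩
  obtain ⟨hc, hγ0⟩ := hcγ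
  have hθ := hw.th_ne_zero
  have hone := hw.cls_eq_one hi hj hk hl hγ0 (t := 0) (x1 := -90) (x2 := 90 * t) (y0 := -90)
    (y1 := 90 * t) (y2 := 0) (z0 := 90 * t) (z1 := 0) (z2 := 0) (γ' := γ / hw.th)
    (by rw [mul_assoc, ← sq, ← hγ]; norm_num)
    (by
      rw [mul_assoc, mul_div_assoc', ← sq, mul_div_assoc', ← hγ]
      field_simp
      push_cast
      ring)
    (by
      rw [mul_assoc, div_mul_div_comm, ← sq, mul_div_assoc', ← hγ]
      field_simp
      push_cast
      ring)
  refine ⟨γ, ?_⟩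
  rw [hone] at hγ
  push_cast at hγ
  linear_combination hγ

end IsGen
end

/-- The quartic form cutting out the Kummer surface. -/
def kummer {R : Type*} [CommRing R] (a b c d : R) : R :=
  -500 * a ^ 4 - 6000 * a ^ 3 * b - 30000 * a ^ 3 * c - 20 * a ^ 3 * d - 4500 * a ^ 2 * b ^ 2 -
    43200 * a ^ 2 * b * c - 100 * a ^ 2 * b * d - 36000 * a ^ 2 * c ^ 2 - 600 * a ^ 2 * c * d -
    1800 * a * b ^ 3 - 18000 * a * b ^ 2 * c - 54000 * a * b * c ^ 2 - 600 * a * b * c * d - 54000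
    * a * c ^ 3 - 900 * a * c ^ 2 * d - 4 * a * c * d ^ 2 + b ^ 2 * d ^ 2 - 180 * b * c ^ 2 * d +
    8100 * c ^ 4

/-- A coordinate of the duplication map on the Kummer surface. -/
def dup1 {R : Type*} [CommRing R] (a b c d : R) : R :=
  1350000 * a ^ 4 - 360000 * a ^ 3 * b - 2160000 * a ^ 3 * c + 42000 * a ^ 3 * d - 1080000 * a ^
    2 * b ^ 2 - 7020000 * a ^ 2 * b * c - 14400 * a ^ 2 * b * d - 7452000 * a ^ 2 * c ^ 2 - 36000
    * a ^ 2 * c * d + 600 * a ^ 2 * d ^ 2 - 648000 * a * b ^ 2 * c - 18000 * a * b ^ 2 * d -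
    3240000 * a * b * c ^ 2 - 108000 * a * b * c * d - 108000 * a * c ^ 2 * d + 4 * a * d ^ 3 +
    162000 * b ^ 4 + 1620000 * b ^ 3 * c + 4860000 * b ^ 2 * c ^ 2 + 9720000 * b * c ^ 3 - 360 * b
    * c * d ^ 2 + 7290000 * c ^ 4 + 64800 * c ^ 3 * d

/-- A coordinate of the duplication map on the Kummer surface. -/
def dup2 {R : Type*} [CommRing R] (a b c d : R) : R :=
  636000 * a ^ 4 + 7560000 * a ^ 3 * b + 24840000 * a ^ 3 * c + 36000 * a ^ 3 * d + 6300000 * a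
    ^ 2 * b ^ 2 + 40500000 * a ^ 2 * b * c + 198000 * a ^ 2 * b * d + 40500000 * a ^ 2 * c ^ 2 +
    532800 * a ^ 2 * c * d + 200 * a ^ 2 * d ^ 2 + 2160000 * a * b ^ 3 + 19440000 * a * b ^ 2 * c
    + 93600 * a * b ^ 2 * d + 49896000 * a * b * c ^ 2 + 612000 * a * b * c * d + 1200 * a * b * d
    ^ 2 + 38880000 * a * c ^ 3 + 756000 * a * c ^ 2 * d + 3600 * a * c * d ^ 2 + 324000 * b ^ 3 *
    c + 18000 * b ^ 3 * d + 1620000 * b ^ 2 * c ^ 2 + 108000 * b ^ 2 * c * d + 324000 * b * c ^ 2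
    * d + 1800 * b * c * d ^ 2 + 4 * b * d ^ 3 - 9720000 * c ^ 4 + 360 * c ^ 2 * d ^ 2

/-- A coordinate of the duplication map on the Kummer surface. -/
def dup3 {R : Type*} [CommRing R] (a b c d : R) : R :=
  210000 * a ^ 4 - 672000 * a ^ 3 * b - 3960000 * a ^ 3 * c - 4000 * a ^ 3 * d - 630000 * a ^ 2
    * b ^ 2 - 7200000 * a ^ 2 * b * c - 36000 * a ^ 2 * b * d - 6210000 * a ^ 2 * c ^ 2 - 78000 *
    a ^ 2 * c * d - 60 * a ^ 2 * d ^ 2 - 180000 * a * b ^ 3 - 3240000 * a * b ^ 2 * c - 18000 * a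
    * b ^ 2 * d - 7020000 * a * b * c ^ 2 - 100800 * a * b * c * d - 200 * a * b * d ^ 2 - 648000
    * a * c ^ 3 - 36000 * a * c ^ 2 * d - 3600 * b ^ 3 * d + 486000 * b ^ 2 * c ^ 2 - 18000 * b ^
    2 * c * d + 3240000 * b * c ^ 3 + 4860000 * c ^ 4 + 108000 * c ^ 3 * d + 900 * c ^ 2 * d ^ 2 +
    4 * c * d ^ 3

/-- A coordinate of the duplication map on the Kummer surface. -/
def dup4 {R : Type*} [CommRing R] (a b c d : R) : R :=
  -98550000 * a ^ 4 - 37800000 * a ^ 3 * b + 60480000 * a ^ 3 * c - 2700000 * a ^ 3 * d +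
    30240000 * a ^ 2 * b ^ 2 + 356400000 * a ^ 2 * b * c + 540000 * a ^ 2 * b * d + 291600000 * a
    ^ 2 * c ^ 2 + 2160000 * a ^ 2 * c * d - 21000 * a ^ 2 * d ^ 2 + 1080000 * a * b ^ 2 * d -
    97200000 * a * b * c ^ 2 + 5400000 * a * b * c * d + 3600 * a * b * d ^ 2 - 486000000 * a * c
    ^ 3 - 324000 * a * c ^ 2 * d - 4050000 * b ^ 4 - 97200000 * b ^ 3 * c - 388800000 * b ^ 2 * c
    ^ 2 - 648000 * b ^ 2 * c * d - 758160000 * b * c ^ 3 - 4860000 * b * c ^ 2 * d - 437400000 * c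
    ^ 4 - 9720000 * c ^ 3 * d - 54000 * c ^ 2 * d ^ 2 + d ^ 4

lemma kummer_eq {s p d u v w e2 e1 e0 : ℚ} (h4 : e2 = 225 + 90 * s)
    (h3 : e1 = 300 + s * e2 - 90 * p) (hd : e0 = -(d + e2 * p))
    (hu : u = 150 + s * e1 - p * e2 - e0)
    (hv : v = 50 + s * e0 - p * e1) (hw : w = 5 - p * e0) :
    kummer 1 s p d = v ^ 2 - 4 * u * w := by
  subst hu hv hw hd h3 h4
  rw [kummer]
  ring

lemma dup_eq_of_kummer_eq_zero {s p d u v w e2 e1 e0 : ℚ} (h4 : e2 = 225 + 90 * s)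
    (h3 : e1 = 300 + s * e2 - 90 * p) (hd : e0 = -(d + e2 * p))
    (hu : u = 150 + s * e1 - p * e2 - e0)
    (hv : v = 50 + s * e0 - p * e1) (hw : w = 5 - p * e0) (h : kummer 1 s p d = 0)
    {x0 x1 y0 y1 E0 E1 r a2 a1 a0 : ℚ} (hE1 : E1 = e1 + s * e2 + 90 * (s ^ 2 - p))
    (hE0 : E0 = e0 - p * e2 - 90 * s * p)
    (hx0 : x0 = p * E1 + s * E0) (hx1 : x1 = -E0) (hy0 : y0 = E0) (hy1 : y1 = E1)
    (hr : r = 2 * u * p + v * s + 2 * w)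
    (ha2 : a2 = x1 ^ 2 * u + x1 * y1 * v + y1 ^ 2 * w)
    (ha1 : a1 = 2 * x1 * x0 * u + (x1 * y0 + x0 * y1) * v + 2 * y1 * y0 * w - 90 * r ^ 2)
    (ha0 : a0 = x0 ^ 2 * u + x0 * y0 * v + y0 ^ 2 * w - r ^ 2 * (e2 + 90 * s) +
      r * (2 * x1 * u + y1 * v)) :
    dup1 1 s p d = 4 * a2 ∧ dup2 1 s p d = -4 * a1 ∧ dup3 1 s p d = 4 * a0 := by
  subst ha2 ha1 ha0 hr hx0 hx1 hy0 hy1 hE1 hE0 hu hv hw hd h3 h4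
  rw [kummer] at h
  simp only [dup1, dup2, dup3]
  refine ⟨?_, ?_, ?_⟩
  · linear_combination (720 * s + 900) * h
  · linear_combination (1440 * p - 1200) * h
  · linear_combination (8 * d + 600) * h

lemma dup4_eq_of_kummer_eq_zero {s p d u v w e2 e1 e0 : ℚ} (h4 : e2 = 225 + 90 * s)
    (h3 : e1 = 300 + s * e2 - 90 * p) (hd : e0 = -(d + e2 * p))
    (hu : u = 150 + s * e1 - p * e2 - e0)
    (hv : v = 50 + s * e0 - p * e1) (hw : w = 5 - p * e0) (h : kummer 1 s p d = 0)
    {x0 x1 y0 y1 E0 E1 r a2 a1 a0 : ℚ} (hE1 : E1 = e1 + s * e2 + 90 * (s ^ 2 - p))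
    (hE0 : E0 = e0 - p * e2 - 90 * s * p)
    (hx0 : x0 = p * E1 + s * E0) (hx1 : x1 = -E0) (hy0 : y0 = E0) (hy1 : y1 = E1)
    (hr : r = 2 * u * p + v * s + 2 * w)
    (ha2 : a2 = x1 ^ 2 * u + x1 * y1 * v + y1 ^ 2 * w)
    (ha1 : a1 = 2 * x1 * x0 * u + (x1 * y0 + x0 * y1) * v + 2 * y1 * y0 * w - 90 * r ^ 2)
    (ha0 : a0 = x0 ^ 2 * u + x0 * y0 * v + y0 ^ 2 * w - r ^ 2 * (e2 + 90 * s) +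
      r * (2 * x1 * u + y1 * v))
    {X0 X1 X2 X3 Y0 Y1 Y2 Y3 : ℚ}
    (hX0 : X0 = p * x0) (hX1 : X1 = r + p * x1 - s * x0) (hX2 : X2 = x0 - s * x1)
    (hX3 : X3 = x1) (hY0 : Y0 = r + p * y0) (hY1 : Y1 = p * y1 - s * y0)
    (hY2 : Y2 = y0 - s * y1) (hY3 : Y3 = y1) :
    r ^ 2 * dup4 1 s p d =
      4 * (-((2 * X0 * X2 * u + (X0 * Y2 + X2 * Y0) * v + 2 * Y0 * Y2 * w) * a2 +
        (2 * X1 * X3 * u + (X1 * Y3 + X3 * Y1) * v + 2 * Y1 * Y3 * w) * a0 -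
        (2 * X0 * X3 * u + (X0 * Y3 + X3 * Y0) * v + 2 * Y0 * Y3 * w) * a1) +
      p ^ 2 * a2 ^ 2 + (s ^ 2 + 2 * p) * a0 * a2 + a0 ^ 2) := by
  subst hX0 hX1 hX2 hX3 hY0 hY1 hY2 hY3
  subst ha2 ha1 ha0 hr hx0 hx1 hy0 hy1 hE1 hE0 hu hv hw hd h3 h4
  rw [kummer] at h
  rw [dup4]
  linear_combination (182250000 * s ^ 6 + 2187000000 * s ^ 5 * p - 108000 * s ^ 5 * d ^ 2 +
    680400000 * s ^ 5 +
      19440000 * s ^ 4 * p ^ 2 * d + 13122000000 * s ^ 4 * p ^ 2 - 432000 * s ^ 4 * p * d ^ 2 +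
      64800000 * s ^ 4 * p * d + 7484400000 * s ^ 4 * p - 117000 * s ^ 4 * d ^ 2 + 10800000 * s ^
      4 * d + 1161540000 * s ^ 4 - 874800000 * s ^ 3 * p ^ 4 + 77760000 * s ^ 3 * p ^ 3 * d +
      40095000000 * s ^ 3 * p ^ 3 - 648000 * s ^ 3 * p ^ 2 * d ^ 2 + 377460000 * s ^ 3 * p ^ 2 * d
      + 31444200000 * s ^ 3 * p ^ 2 + 1440 * s ^ 3 * p * d ^ 3 + 486000 * s ^ 3 * p * d ^ 2 +
      178200000 * s ^ 3 * p * d + 8650800000 * s ^ 3 * p + 1200 * s ^ 3 * d ^ 3 + 50400 * s ^ 3 *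
      d ^ 2 + 13860000 * s ^ 3 * d + 793800000 * s ^ 3 - 3499200000 * s ^ 2 * p ^ 5 + 116640000 *
      s ^ 2 * p ^ 4 * d + 68671800000 * s ^ 2 * p ^ 4 - 777600 * s ^ 2 * p ^ 3 * d ^ 2 + 767880000
      * s ^ 2 * p ^ 3 * d + 57202200000 * s ^ 2 * p ^ 3 + 1188000 * s ^ 2 * p ^ 2 * d ^ 2 +
      387828000 * s ^ 2 * p ^ 2 * d + 15584400000 * s ^ 2 * p ^ 2 + 3600 * s ^ 2 * p * d ^ 3 +
      126000 * s ^ 2 * p * d ^ 2 + 43200000 * s ^ 2 * p * d + 1367280000 * s ^ 2 * p - 3 * s ^ 2 *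
      d ^ 4 - 81000 * s ^ 2 * d ^ 2 - 2700000 * s ^ 2 * d + 63450000 * s ^ 2 - 5248800000 * s * p
      ^ 6 + 104976000 * s * p ^ 5 * d + 64735200000 * s * p ^ 5 + 884520000 * s * p ^ 4 * d +
      59019840000 * s * p ^ 4 + 1134000 * s * p ^ 3 * d ^ 2 + 181440000 * s * p ^ 3 * d +
      340200000 * s * p ^ 3 - 5400 * s * p ^ 2 * d ^ 3 - 3294000 * s * p ^ 2 * d ^ 2 - 277020000 *
      s * p ^ 2 * d - 9768600000 * s * p ^ 2 - 3600 * s * p * d ^ 3 - 1033200 * s * p * d ^ 2 -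
      67320000 * s * p * d - 1744200000 * s * p + 200 * s * d ^ 3 - 18000 * s * d ^ 2 - 1908000 *
      s * d - 37800000 * s - 4199040000 * p ^ 7 + 27993600000 * p ^ 6 + 524880000 * p ^ 5 * d +
      26244000000 * p ^ 5 + 2332800 * p ^ 4 * d ^ 2 + 106920000 * p ^ 4 * d + 48600000 * p ^ 4 -
      3510000 * p ^ 3 * d ^ 2 - 425736000 * p ^ 3 * d - 17285400000 * p ^ 3 - 12600 * p ^ 2 * d ^
      3 - 2844000 * p ^ 2 * d ^ 2 - 197100000 * p ^ 2 * d - 5009040000 * p ^ 2 + 12 * p * d ^ 4 +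
      1200 * p * d ^ 3 - 90000 * p * d ^ 2 - 11520000 * p * d - 345600000 * p + 40 * d ^ 3 -
      180000 * d - 5400000) * h

lemma IsMumford.kummer_eq_zero {s p b1 b0 e2 e1 e0 : ℚ} (h : IsMumford s p b1 b0 e2 e1 e0) :
    kummer 1 s p (-(e0 + e2 * p)) = 0 := by
  obtain ⟨h4, h3, h2, h1, h0⟩ := h
  rw [kummer_eq (e2 := e2) (e1 := e1) (e0 := e0) (u := b1 ^ 2) (v := 2 * b1 * b0) (w := b0 ^ 2)
    (by linear_combination h4) (by linear_combination h3) (by ring) (by linear_combination h2)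
    (by linear_combination h1) (by linear_combination h0)]
  ring

/-- Doubling on the Jacobian is compatible with the duplication map: `B ^ 2 - A ^ 2 * a`, with
`A = t ^ 2 - s * t + p` and `B = b + A * m`, exhibits `a` as the polynomial of twice the class
with Mumford representation `(A, b)`. -/
lemma IsMumford.dup_eq {s p b1 b0 e2 e1 e0 : ℚ} (h : IsMumford s p b1 b0 e2 e1 e0)
    {m1 m0 a2 a1 a0 r d : ℚ} (hr : r = 2 * (b1 ^ 2 * p + b1 * b0 * s + b0 ^ 2)) (hr0 : r ≠ 0)
    (hd : d = -(e0 + e2 * p)) (ha2 : m1 ^ 2 = a2) (ha1 : 2 * m1 * m0 - a1 = 90)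
    (he2 : e2 = 2 * b1 * m1 + (m0 ^ 2 - a0) - 90 * s)
    (he1 : e1 = 2 * (b1 * m0 + b0 * m1) - s * (m0 ^ 2 - a0) + 90 * p)
    (he0 : e0 = 2 * b0 * m0 + p * (m0 ^ 2 - a0)) :
    dup1 1 s p d = 4 * r ^ 2 * a2 ∧ dup2 1 s p d = -4 * r ^ 2 * a1 ∧
    dup3 1 s p d = 4 * r ^ 2 * a0 ∧
    dup4 1 s p d = 4 * r ^ 2 * (-(2 * (b0 + p * m0) * (m0 - s * m1) * a2 +
      2 * (b1 + p * m1 - s * m0) * m1 * a0 - 2 * (b0 + p * m0) * m1 * a1) +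
      p ^ 2 * a2 ^ 2 + (s ^ 2 + 2 * p) * a0 * a2 + a0 ^ 2) := by
  have hK := h.kummer_eq_zero
  rw [← hd] at hK
  obtain ⟨h4, h3, h2, h1, h0⟩ := h
  obtain ⟨E1, hE1⟩ : ∃ E1, E1 = e1 + s * e2 + 90 * (s ^ 2 - p) := ⟨_, rfl⟩
  obtain ⟨E0, hE0⟩ : ∃ E0, E0 = e0 - p * e2 - 90 * s * p := ⟨_, rfl⟩
  have hE1' : E1 = 2 * (b1 * m0 + b0 * m1 + s * b1 * m1) := by
    linear_combination hE1 + he1 + s * he2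
  have hE0' : E0 = 2 * (b0 * m0 - p * b1 * m1) := by
    linear_combination hE0 + he0 - p * he2
  have hm1 : E1 * b0 - E0 * b1 = r * m1 := by rw [hE1', hE0', hr]; ring
  have hm0 : (p * E1 + s * E0) * b1 + E0 * b0 = r * m0 := by rw [hE1', hE0', hr]; ring
  have g4 : e2 = 225 + 90 * s := by linear_combination h4
  have g3 : e1 = 300 + s * e2 - 90 * p := by linear_combination h3
  have gd : e0 = -(d + e2 * p) := by linear_combination hd
  have gu : b1 ^ 2 = 150 + s * e1 - p * e2 - e0 := by linear_combination h2
  have gv : 2 * b1 * b0 = 50 + s * e0 - p * e1 := by linear_combination h1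
  have gw : b0 ^ 2 = 5 - p * e0 := by linear_combination h0
  have gr : r = 2 * b1 ^ 2 * p + 2 * b1 * b0 * s + 2 * b0 ^ 2 := by rw [hr]; ring
  have G2 : r ^ 2 * a2 = (-E0) ^ 2 * b1 ^ 2 + (-E0) * E1 * (2 * b1 * b0) + E1 ^ 2 * b0 ^ 2 := by
    linear_combination -r ^ 2 * ha2 - (E1 * b0 - E0 * b1 + r * m1) * hm1
  have G1 : r ^ 2 * a1 = 2 * (-E0) * (p * E1 + s * E0) * b1 ^ 2 +
      ((-E0) * E0 + (p * E1 + s * E0) * E1) * (2 * b1 * b0) + 2 * E1 * E0 * b0 ^ 2 -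
      90 * r ^ 2 := by
    linear_combination -r ^ 2 * ha1 - 2 * ((p * E1 + s * E0) * b1 + E0 * b0) * hm1 -
      2 * r * m1 * hm0
  have G0 : r ^ 2 * a0 = (p * E1 + s * E0) ^ 2 * b1 ^ 2 + (p * E1 + s * E0) * E0 * (2 * b1 * b0) +
      E0 ^ 2 * b0 ^ 2 - r ^ 2 * (e2 + 90 * s) + r * (2 * (-E0) * b1 ^ 2 + E1 * (2 * b1 * b0)) := by
    linear_combination r ^ 2 * he2 - 2 * r * b1 * hm1 -
      ((p * E1 + s * E0) * b1 + E0 * b0 + r * m0) * hm0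
  obtain ⟨D1, D2, D3⟩ := dup_eq_of_kummer_eq_zero g4 g3 gd gu gv gw hK hE1 hE0 rfl rfl rfl rfl gr
    G2 G1 G0
  refine ⟨by rw [D1]; ring, by rw [D2]; ring, by rw [D3]; ring, ?_⟩
  have D4 := dup4_eq_of_kummer_eq_zero g4 g3 gd gu gv gw hK hE1 hE0 rfl rfl rfl rfl gr
    G2 G1 G0 rfl rfl rfl rfl rfl rfl rfl rfl
  have k0 : p * (p * E1 + s * E0) * b1 + (r + p * E0) * b0 = r * (b0 + p * m0) := by
    linear_combination p * hm0
  have k1 : (r + p * (-E0) - s * (p * E1 + s * E0)) * b1 + (p * E1 - s * E0) * b0 =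
      r * (b1 + p * m1 - s * m0) := by
    linear_combination p * hm1 - s * hm0
  have k2 : (p * E1 + s * E0 - s * (-E0)) * b1 + (E0 - s * E1) * b0 = r * (m0 - s * m1) := by
    linear_combination hm0 - s * hm1
  have k3 : -E0 * b1 + E1 * b0 = r * m1 := by linear_combination hm1
  have key : ∀ X0 X1 X2 X3 Y0 Y1 Y2 Y3 : ℚ, X0 * b1 + Y0 * b0 = r * (b0 + p * m0) →
      X1 * b1 + Y1 * b0 = r * (b1 + p * m1 - s * m0) → X2 * b1 + Y2 * b0 = r * (m0 - s * m1) →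
      X3 * b1 + Y3 * b0 = r * m1 →
      (2 * X0 * X2 * b1 ^ 2 + (X0 * Y2 + X2 * Y0) * (2 * b1 * b0) + 2 * Y0 * Y2 * b0 ^ 2) *
        (r ^ 2 * a2) +
      (2 * X1 * X3 * b1 ^ 2 + (X1 * Y3 + X3 * Y1) * (2 * b1 * b0) + 2 * Y1 * Y3 * b0 ^ 2) *
        (r ^ 2 * a0) -
      (2 * X0 * X3 * b1 ^ 2 + (X0 * Y3 + X3 * Y0) * (2 * b1 * b0) + 2 * Y0 * Y3 * b0 ^ 2) *
        (r ^ 2 * a1) = r ^ 4 * (2 * (b0 + p * m0) * (m0 - s * m1) * a2 +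
      2 * (b1 + p * m1 - s * m0) * m1 * a0 - 2 * (b0 + p * m0) * m1 * a1) := by
    intro X0 X1 X2 X3 Y0 Y1 Y2 Y3 q0 q1 q2 q3
    calc _ = 2 * (X0 * b1 + Y0 * b0) * (X2 * b1 + Y2 * b0) * (r ^ 2 * a2) +
        2 * (X1 * b1 + Y1 * b0) * (X3 * b1 + Y3 * b0) * (r ^ 2 * a0) -
        2 * (X0 * b1 + Y0 * b0) * (X3 * b1 + Y3 * b0) * (r ^ 2 * a1) := by ring
      _ = _ := by rw [q0, q1, q2, q3]; ring
  rw [key _ _ _ _ _ _ _ _ k0 k1 k2 k3] at D4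
  apply mul_left_cancel₀ (pow_ne_zero 2 hr0)
  rw [D4]
  ring

section
variable {K : Type*} [Field K] [NumberField K] {w : K}

namespace IsGen

lemma isMumford_norm_ne_zero (hw : IsGen w) {s p b1 b0 e2 e1 e0 : ℚ}
    (h : IsMumford s p b1 b0 e2 e1 e0) : 2 * (b1 ^ 2 * p + b1 * b0 * s + b0 ^ 2) ≠ 0 := fun h0 => by
  have hn := hw.norm_of_isMumford h
  rw [show b1 ^ 2 * p + b1 * b0 * s + b0 ^ 2 = 0 by linarith, zero_div,
    zero_pow two_ne_zero, Algebra.norm_eq_zero_iff] at hn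
  exact one_ne_zero (hw.quadratic_eq_zero hn).1

lemma quartic_eq_zero (hw : IsGen w) {a b c d e : ℚ}
    (h : (a + b * hw.th + c * hw.th ^ 2 + d * hw.th ^ 3 + e * hw.th ^ 4 : K) = 0) :
    a = 0 ∧ b = 0 ∧ c = 0 ∧ d = 0 ∧ e = 0 := by
  have : (a + b * hw.th + c * hw.th ^ 2 + d * hw.th ^ 3 + e * hw.th ^ 4 : K) =
      (a - 2 * b + 4 * c - 16 * d + 112 * e : ℚ) +
      (2 * b - 4 * c + 10 * d - 76 * e : ℚ) * w + (-c + 10 * d - 55 * e : ℚ) * w ^ 2 +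
      (-b + 4 * c - 19 * d + 124 * e : ℚ) * w ^ 3 + (c - 10 * d + 67 * e : ℚ) * w ^ 4 := by
    rw [th, coe_el]
    push_cast
    linear_combination (c * w + d * (-2 - 6 * w + w ^ 2 - w ^ 4) +
      e * (24 + 27 * w - 4 * w ^ 2 + 4 * w ^ 3 + 8 * w ^ 4 - 3 * w ^ 5 + w ^ 7)) * hw.root
  rw [this] at h
  obtain ⟨h0, h1, h2, h3, h4⟩ := hw.coords_eq_zero h
  refine ⟨?_, ?_, ?_, ?_, ?_⟩ <;> linarith

/-- A quartic vanishing at `1 / θ` is zero. -/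
lemma quartic_inv_eq_zero (hw : IsGen w) {τ : K} (hτ : hw.th * τ = 1) {a b c d e : ℚ}
    (h : (a + b * τ + c * τ ^ 2 + d * τ ^ 3 + e * τ ^ 4 : K) = 0) :
    a = 0 ∧ b = 0 ∧ c = 0 ∧ d = 0 ∧ e = 0 := by
  have := hw.quartic_eq_zero (a := e) (b := d) (c := c) (d := b) (e := a) (by
    rw [show (e + d * hw.th + c * hw.th ^ 2 + b * hw.th ^ 3 + a * hw.th ^ 4 : K) =
      e * (hw.th * τ) ^ 4 + d * hw.th * (hw.th * τ) ^ 3 + c * hw.th ^ 2 * (hw.th * τ) ^ 2 +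
      b * hw.th ^ 3 * (hw.th * τ) + a * hw.th ^ 4 by simp only [hτ]; ring]
    linear_combination (hw.th : K) ^ 4 * h)
  tauto

/-- The equations satisfied by a nontrivial relation
`(c2 * τ ^ 2 + c1 * τ + c0) * β = κ * b(τ) + a(τ) * (m1 * τ + m0)`, where `β ^ 2 = a(τ)`. -/
lemma exists_relation (hw : IsGen w) {τ β : K} (hτ : hw.th * τ = 1)
    {a2 a1 a0 b1 b0 e4 e3 e2 e1 e0 : ℚ} (hβ : β ^ 2 = a2 * τ ^ 2 + a1 * τ + a0) (hβ0 : β ≠ 0)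
    (hg : (b1 * τ + b0) ^ 2 + (a2 * τ ^ 2 + a1 * τ + a0) *
      (e4 * τ ^ 4 + e3 * τ ^ 3 + e2 * τ ^ 2 + e1 * τ + e0) = 0) :
    ∃ c2 c1 c0 κ m1 m0 : ℚ, ¬ (c2 = 0 ∧ c1 = 0 ∧ c0 = 0 ∧ κ = 0 ∧ m1 = 0 ∧ m0 = 0) ∧
      κ ^ 2 * e4 = a2 * m1 ^ 2 - c2 ^ 2 ∧
      κ ^ 2 * e3 = 2 * a2 * m1 * m0 + a1 * m1 ^ 2 - 2 * c2 * c1 ∧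
      κ ^ 2 * e2 = 2 * κ * b1 * m1 + a2 * m0 ^ 2 + 2 * a1 * m1 * m0 + a0 * m1 ^ 2 - c1 ^ 2 -
        2 * c2 * c0 ∧
      κ ^ 2 * e1 = 2 * κ * (b1 * m0 + b0 * m1) + a1 * m0 ^ 2 + 2 * a0 * m1 * m0 - 2 * c1 * c0 ∧
      κ ^ 2 * e0 = 2 * κ * b0 * m0 + a0 * m0 ^ 2 - c0 ^ 2 := by
  let f : (Fin 6 → ℚ) →ₗ[ℚ] K := Fintype.linearCombination ℚ
    ![τ ^ 2 * β, τ * β, β, -(b1 * τ + b0), -(β ^ 2 * τ), -β ^ 2]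
  have hker : LinearMap.ker f ≠ ⊥ := LinearMap.ker_ne_bot_of_finrank_lt (by
    rw [hw.finrank]; simp)
  obtain ⟨v, hv, hv0⟩ := Submodule.exists_mem_ne_zero_of_ne_bot hker
  have hv' : (v 0 * τ ^ 2 + v 1 * τ + v 2) * β = v 3 * (b1 * τ + b0) + β ^ 2 * (v 4 * τ + v 5) := by
    have := LinearMap.mem_ker.mp hv
    simp only [f, Fintype.linearCombination_apply, Fin.sum_univ_six, Algebra.smul_def,
      eq_ratCast] at this
    simp at this
    linear_combination this
  have hQ := hw.quartic_inv_eq_zero hτ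
    (e := -v 3 ^ 2 * e4 + (a2 * v 4 ^ 2 - v 0 ^ 2))
    (d := -v 3 ^ 2 * e3 + (2 * a2 * v 4 * v 5 + a1 * v 4 ^ 2 - 2 * v 0 * v 1))
    (c := -v 3 ^ 2 * e2 + (2 * v 3 * b1 * v 4 + a2 * v 5 ^ 2 + 2 * a1 * v 4 * v 5 +
      a0 * v 4 ^ 2 - v 1 ^ 2 - 2 * v 0 * v 2))
    (b := -v 3 ^ 2 * e1 + (2 * v 3 * (b1 * v 5 + b0 * v 4) + a1 * v 5 ^ 2 + 2 * a0 * v 4 * v 5 -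
      2 * v 1 * v 2))
    (a := -v 3 ^ 2 * e0 + (2 * v 3 * b0 * v 5 + a0 * v 5 ^ 2 - v 2 ^ 2)) (by
      apply mul_left_cancel₀ (pow_ne_zero 2 hβ0)
      have h2 := congrArg (· ^ 2) hv'
      simp only [mul_pow] at h2
      rw [hβ] at h2 ⊢
      push_cast
      linear_combination -h2 - v 3 ^ 2 * hg)
  obtain ⟨q0, q1, q2, q3, q4⟩ := hQ
  refine ⟨v 0, v 1, v 2, v 3, v 4, v 5, fun ⟨h0, h1, h2, h3, h4, h5⟩ => hv0 ?_, ?_, ?_, ?_, ?_, ?_⟩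
  · ext i; fin_cases i <;> assumption
  all_goals linarith

end IsGen

end

/-- The image on the Kummer surface of a nonzero rational point of the Jacobian. -/
def IsImage (a b c d : ℚ) : Prop :=
  (∃ s p b1 b0 e2 e1 e0 l, IsMumford s p b1 b0 e2 e1 e0 ∧ l ≠ 0 ∧ a = l ∧ b = l * s ∧
    c = l * p ∧ d = l * -(e0 + e2 * p)) ∨
  ∃ t y l, IsPoint t y ∧ l ≠ 0 ∧ a = 0 ∧ b = l ∧ c = l * t ∧ d = l * (90 * t ^ 2)

lemma kummer_smul {R : Type*} [CommRing R] (l a b c d : R) :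
    kummer (l * a) (l * b) (l * c) (l * d) = l ^ 4 * kummer a b c d := by
  simp only [kummer]; ring

lemma dup_smul {R : Type*} [CommRing R] (l a b c d : R) :
    dup1 (l * a) (l * b) (l * c) (l * d) = l ^ 4 * dup1 a b c d ∧
    dup2 (l * a) (l * b) (l * c) (l * d) = l ^ 4 * dup2 a b c d ∧
    dup3 (l * a) (l * b) (l * c) (l * d) = l ^ 4 * dup3 a b c d ∧
    dup4 (l * a) (l * b) (l * c) (l * d) = l ^ 4 * dup4 a b c d := by
  simp only [dup1, dup2, dup3, dup4]
  refine ⟨?_, ?_, ?_, ?_⟩ <;> ring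

lemma IsImage.kummer_eq_zero {a b c d : ℚ} (h : IsImage a b c d) : kummer a b c d = 0 := by
  obtain ⟨s, p, b1, b0, e2, e1, e0, l, h, hl, rfl, rfl, rfl, rfl⟩ |
    ⟨t, y, l, h, hl, rfl, rfl, rfl, rfl⟩ := h
  · have := kummer_smul a 1 s p (-(e0 + e2 * p))
    rwa [mul_one, h.kummer_eq_zero, mul_zero] at this
  · simp only [kummer]; ring

lemma IsImage.ne_zero {a b c d : ℚ} (h : IsImage a b c d) : ¬ (a = 0 ∧ b = 0) := by
  obtain ⟨s, p, b1, b0, e2, e1, e0, l, h, hl, rfl, rfl, rfl, rfl⟩ |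
    ⟨t, y, l, h, hl, rfl, rfl, rfl, rfl⟩ := h
  · exact fun h => hl h.1
  · exact fun h => hl h.2

lemma IsImage.smul {a b c d : ℚ} (h : IsImage a b c d) {k : ℚ} (hk : k ≠ 0) :
    IsImage (k * a) (k * b) (k * c) (k * d) := by
  obtain ⟨s, p, b1, b0, e2, e1, e0, l, h, hl, rfl, rfl, rfl, rfl⟩ |
    ⟨t, y, l, h, hl, rfl, rfl, rfl, rfl⟩ := h
  · exact Or.inl ⟨s, p, b1, b0, e2, e1, e0, k * a, h, mul_ne_zero hk hl, rfl, by ring, by ring,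
      by ring⟩
  · exact Or.inr ⟨t, y, k * b, h, mul_ne_zero hk hl, by ring, rfl, by ring, by ring⟩

section
variable {K : Type*} [Field K] [NumberField K] {w : K}

namespace IsGen

/-- A representation of the quintic as `B ^ 2 - (t ^ 2 - s * t + p) ^ 2 * a` with `a` quadratic
gives a half of the class defined by `a`. -/
lemma exists_image_of_sq (hw : IsGen w) {B3 B2 B1 B0 s p a2 a1 a0 : ℚ}
    (h6 : B3 ^ 2 - a2 = 0) (h5 : 2 * B3 * B2 - (a1 - 2 * s * a2) = 90)
    (h4 : 2 * B3 * B1 + B2 ^ 2 - (a0 - 2 * s * a1 + (s ^ 2 + 2 * p) * a2) = 225)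
    (h3 : 2 * B3 * B0 + 2 * B2 * B1 - (-2 * s * a0 + (s ^ 2 + 2 * p) * a1 - 2 * s * p * a2) = 300)
    (h2 : 2 * B2 * B0 + B1 ^ 2 - ((s ^ 2 + 2 * p) * a0 - 2 * s * p * a1 + p ^ 2 * a2) = 150)
    (h1 : 2 * B1 * B0 - (-2 * s * p * a0 + p ^ 2 * a1) = 50) (h0 : B0 ^ 2 - p ^ 2 * a0 = 5) :
    ∃ d l, IsImage 1 s p d ∧ l ≠ 0 ∧ dup1 1 s p d = l * a2 ∧ dup2 1 s p d = l * -a1 ∧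
      dup3 1 s p d = l * a0 ∧ dup4 1 s p d = l * (-(2 * B0 * B2 * a2 + 2 * B1 * B3 * a0 -
        2 * B0 * B3 * a1) + p ^ 2 * a2 ^ 2 + (s ^ 2 + 2 * p) * a0 * a2 + a0 ^ 2) := by
  obtain ⟨m0, hm0⟩ : ∃ m0, m0 = B2 + s * B3 := ⟨_, rfl⟩
  obtain ⟨b1, hb1⟩ : ∃ b1, b1 = B1 - p * B3 + s * m0 := ⟨_, rfl⟩
  obtain ⟨b0, hb0⟩ : ∃ b0, b0 = B0 - p * m0 := ⟨_, rfl⟩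
  obtain rfl : B2 = m0 - s * B3 := by linarith
  obtain rfl : B1 = b1 + p * B3 - s * m0 := by linarith
  obtain rfl : B0 = b0 + p * m0 := by linarith
  obtain rfl : a2 = B3 ^ 2 := by linarith
  obtain rfl : a1 = 2 * B3 * m0 - 90 := by linarith
  have hM : IsMumford s p b1 b0 (2 * b1 * B3 + (m0 ^ 2 - a0) - 90 * s)
      (2 * (b1 * m0 + b0 * B3) - s * (m0 ^ 2 - a0) + 90 * p)
      (2 * b0 * m0 + p * (m0 ^ 2 - a0)) := by
    constructor
    · linear_combination h4
    · linear_combination h3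
    · linear_combination h2
    · linear_combination h1
    · linear_combination h0
  have hr := hw.isMumford_norm_ne_zero hM
  obtain ⟨q1, q2, q3, q4⟩ := hM.dup_eq (m1 := B3) (m0 := m0)
    (a2 := B3 ^ 2) (a1 := 2 * B3 * m0 - 90) (a0 := a0) rfl hr rfl rfl
    (by ring) rfl rfl rfl
  exact ⟨_, _, Or.inl ⟨_, _, _, _, _, _, _, 1, hM, one_ne_zero, rfl, (one_mul _).symm,
    (one_mul _).symm, (one_mul _).symm⟩, mul_ne_zero four_ne_zero (pow_ne_zero 2 hr), q1,
    by rw [q2]; ring, q3, q4⟩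

lemma quintic_inv (hw : IsGen w) {τ : K} (hτ : hw.th * τ = 1) :
    90 * τ ^ 5 + 225 * τ ^ 4 + 300 * τ ^ 3 + 150 * τ ^ 2 + 50 * τ + 5 = 0 := by
  have h := hw.th_root
  linear_combination 5 * τ ^ 5 * h - (5 * ((hw.th * τ) ^ 4 + (hw.th * τ) ^ 3 + (hw.th * τ) ^ 2 +
    hw.th * τ + 1) + 50 * τ * ((hw.th * τ) ^ 3 + (hw.th * τ) ^ 2 + hw.th * τ + 1) +
    150 * τ ^ 2 * ((hw.th * τ) ^ 2 + hw.th * τ + 1) + 300 * τ ^ 3 * (hw.th * τ + 1) +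
    225 * τ ^ 4) * hτ

lemma y_ne_zero (hw : IsGen w) {t y : ℚ} (h : IsPoint t y) : y ≠ 0 := by
  rintro rfl
  rw [IsPoint] at h
  have h0 : Algebra.norm ℚ (((1 : ℚ) : K) + (-t : ℚ) * hw.th + (0 : ℚ) * hw.th ^ 2) = 0 := by
    rw [hw.norm_quadratic]; linear_combination -h / 5
  rw [Algebra.norm_eq_zero_iff] at h0
  exact one_ne_zero (hw.quadratic_eq_zero h0).1

lemma exists_half_of_isPoint (hw : IsGen w) {t y : ℚ} (h : IsPoint t y) :
    ∃ a b c d l, IsImage a b c d ∧ l ≠ 0 ∧ dup1 a b c d = l * 0 ∧ dup2 a b c d = l * 1 ∧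
      dup3 a b c d = l * t ∧ dup4 a b c d = l * (90 * t ^ 2) := by
  obtain ⟨γ, hγ⟩ := hw.exists_sq_of_isPoint h
  obtain ⟨τ, hτ⟩ : ∃ τ : K, hw.th * τ = 1 := ⟨_, mul_inv_cancel₀ hw.th_ne_zero⟩
  have hg := hw.quintic_inv hτ
  rw [IsPoint] at h
  have hβ : (γ * τ) ^ 2 = (0 : ℚ) * τ ^ 2 + (-90 : ℚ) * τ + (90 * t : ℚ) := by
    push_cast
    linear_combination -τ ^ 2 * hγ - (90 * τ - 90 * t * (hw.th * τ + 1)) * hτ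
  have hβ0 : γ * τ ≠ 0 := fun h0 => by
    rw [h0] at hβ
    have := hw.quartic_inv_eq_zero hτ (a := 90 * t) (b := -90) (c := 0) (d := 0) (e := 0)
      (by push_cast at hβ ⊢; linear_combination -hβ)
    norm_num at this
  obtain ⟨c2, c1, c0, κ, m1, m0, hne, q4, q3, q2, q1, q0⟩ := hw.exists_relation hτ hβ hβ0
    (b1 := 0) (b0 := y) (e4 := -1) (e3 := -(90 * t + 225) / 90)
    (e2 := -(90 * t ^ 2 + 225 * t + 300) / 90)
    (e1 := -(90 * t ^ 3 + 225 * t ^ 2 + 300 * t + 150) / 90)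
    (e0 := -(90 * t ^ 4 + 225 * t ^ 3 + 300 * t ^ 2 + 150 * t + 50) / 90) (by
      have h' := congrArg (fun x : ℚ => (x : K)) h
      push_cast at h' ⊢
      linear_combination hg + h')
  by_cases hκ : κ = 0
  · subst hκ
    obtain rfl : c2 = 0 := pow_eq_zero_iff two_ne_zero |>.1 (by linear_combination q4)
    obtain rfl : m1 = 0 := pow_eq_zero_iff two_ne_zero |>.1 (by linear_combination q3 / 90)
    obtain rfl : c1 = 0 := pow_eq_zero_iff two_ne_zero |>.1 (by linear_combination q2)
    obtain rfl : m0 = 0 := pow_eq_zero_iff two_ne_zero |>.1 (by linear_combination q1 / 90)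
    obtain rfl : c0 = 0 := pow_eq_zero_iff two_ne_zero |>.1 (by linear_combination q0)
    simp at hne
  · obtain ⟨c2, rfl⟩ : ∃ x, c2 = κ * x := ⟨c2 / κ, by field_simp⟩
    obtain ⟨c1, rfl⟩ : ∃ x, c1 = κ * x := ⟨c1 / κ, by field_simp⟩
    obtain ⟨c0, rfl⟩ : ∃ x, c0 = κ * x := ⟨c0 / κ, by field_simp⟩
    obtain ⟨m1, rfl⟩ : ∃ x, m1 = κ * x := ⟨m1 / κ, by field_simp⟩
    obtain ⟨m0, rfl⟩ : ∃ x, m0 = κ * x := ⟨m0 / κ, by field_simp⟩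
    have hκ2 := pow_ne_zero 2 hκ
    have r4 : c2 ^ 2 = 1 := mul_left_cancel₀ hκ2 (by linear_combination q4)
    have r3 := mul_left_cancel₀ hκ2 (q3.trans (b := _)
      (c := κ ^ 2 * (-90 * m1 ^ 2 - 2 * c2 * c1)) (by ring))
    have r2 := mul_left_cancel₀ hκ2 (q2.trans (b := _)
      (c := κ ^ 2 * (-180 * m1 * m0 + 90 * t * m1 ^ 2 - c1 ^ 2 - 2 * c2 * c0)) (by ring))
    have r1 := mul_left_cancel₀ hκ2 (q1.trans (b := _)
      (c := κ ^ 2 * (2 * y * m1 - 90 * m0 ^ 2 + 180 * t * m1 * m0 - 2 * c1 * c0)) (by ring))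
    have r0 := mul_left_cancel₀ hκ2 (q0.trans (b := _)
      (c := κ ^ 2 * (2 * y * m0 + 90 * t * m0 ^ 2 - c0 ^ 2)) (by ring))
    obtain ⟨d, l, hI, hl, d1, d2, d3, d4⟩ := hw.exists_image_of_sq (B3 := 0) (B2 := -90 * m1)
      (B1 := -90 * m0 + 90 * t * m1) (B0 := y + 90 * t * m0) (s := -(c1 * c2)) (p := c0 * c2)
      (a2 := 0) (a1 := -90) (a0 := 90 * t) (by norm_num) (by norm_num)
      (by linear_combination 90 * r3)
      (by linear_combination 90 * r2 - 90 * t * r3 + 90 * c1 ^ 2 * r4)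
      (by linear_combination 90 * r1 - 90 * t * r2 - (90 * t * c1 ^ 2 - 180 * c1 * c0) * r4)
      (by linear_combination 90 * r0 - 90 * t * r1 - (180 * t * c1 * c0 - 90 * c0 ^ 2) * r4)
      (by linear_combination h - 90 * t * r0 - (90 * t * c0 ^ 2) * r4)
    exact ⟨1, _, _, d, l * 90, hI, mul_ne_zero hl (by norm_num), by rw [d1]; ring,
      by rw [d2]; ring, by rw [d3]; ring, by rw [d4]; ring⟩

end IsGen

end

lemma dup_point {x y u d : ℚ} (h : IsPoint x y)
    (hd : y ^ 2 * d = y ^ 2 * u + (225 * x ^ 4 + 450 * x ^ 3 + 450 * x ^ 2 + 150 * x + 25) ^ 2) :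
    dup1 0 1 x (90 * x ^ 2) = 32400 * y ^ 2 ∧ dup2 0 1 x (90 * x ^ 2) = 32400 * y ^ 2 * (2 * x) ∧
    dup3 0 1 x (90 * x ^ 2) = 32400 * y ^ 2 * x ^ 2 ∧
    (u = -(150 + 2 * x * (300 + 225 * (2 * x) + 90 * (4 * x ^ 2 - x ^ 2))) →
      dup4 0 1 x (90 * x ^ 2) = 32400 * y ^ 2 * d) := by
  rw [IsPoint] at h
  simp only [dup1, dup2, dup3, dup4]
  refine ⟨?_, ?_, ?_, ?_⟩
  · linear_combination -32400 * h
  · linear_combination -64800 * x * h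
  · linear_combination -32400 * x ^ 2 * h
  · intro hu
    rw [hu] at hd
    linear_combination -32400 * hd +
      32400 * (150 + 2 * x * (300 + 225 * (2 * x) + 90 * (4 * x ^ 2 - x ^ 2))) * h

section
variable {K : Type*} [Field K] [NumberField K] {w : K}

namespace IsGen

/-- If `a * m ^ 2 = c ^ 2` with `a = t ^ 2 - s * t + p`, then `a` is a square. -/
lemma disc_eq_zero {s p c2 c1 c0 m1 m0 : ℚ} (hne : ¬ (c2 = 0 ∧ c1 = 0 ∧ c0 = 0 ∧ m1 = 0 ∧ m0 = 0))
    (q4 : m1 ^ 2 - c2 ^ 2 = 0) (q3 : 2 * m1 * m0 - s * m1 ^ 2 - 2 * c2 * c1 = 0)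
    (q2 : m0 ^ 2 - 2 * s * m1 * m0 + p * m1 ^ 2 - c1 ^ 2 - 2 * c2 * c0 = 0)
    (q1 : -s * m0 ^ 2 + 2 * p * m1 * m0 - 2 * c1 * c0 = 0)
    (q0 : p * m0 ^ 2 - c0 ^ 2 = 0) : s ^ 2 = 4 * p := by
  by_cases hm1 : m1 = 0
  · subst hm1
    obtain rfl : c2 = 0 := pow_eq_zero_iff two_ne_zero |>.1 (by linear_combination -q4)
    have hm0 : m0 ≠ 0 := by
      rintro rfl
      exact hne ⟨rfl, pow_eq_zero_iff two_ne_zero |>.1 (by linear_combination -q2),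
        pow_eq_zero_iff two_ne_zero |>.1 (by linear_combination -q0), rfl, rfl⟩
    apply mul_left_cancel₀ (pow_ne_zero 4 hm0)
    linear_combination (-s * m0 ^ 2 + 2 * c1 * c0) * q1 - 4 * c0 ^ 2 * q2 - 4 * m0 ^ 2 * q0
  · obtain ⟨x, hx⟩ : ∃ x, m0 = -x * m1 := ⟨-m0 / m1, by field_simp⟩
    subst hx
    have hc : c2 * x ^ 2 + c1 * x + c0 = 0 := pow_eq_zero_iff two_ne_zero |>.1 (by
      linear_combination -x ^ 4 * q4 - x ^ 3 * q3 - x ^ 2 * q2 - x * q1 - q0)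
    obtain ⟨f, hf⟩ : ∃ f, f = c1 + c2 * x := ⟨_, rfl⟩
    obtain rfl : c1 = f - c2 * x := by linarith
    obtain rfl : c0 = -x * f := by linear_combination hc
    have h1 : -s * m1 ^ 2 = 2 * c2 * f := by linear_combination q3 + 2 * x * q4
    have h0 : p * m1 ^ 2 = f ^ 2 := by linear_combination q2 + 2 * x * h1 - x ^ 2 * q4
    apply mul_left_cancel₀ (pow_ne_zero 4 hm1)
    linear_combination (-s * m1 ^ 2 + 2 * c2 * f) * h1 - 4 * m1 ^ 2 * h0 - 4 * f ^ 2 * q4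

lemma exists_half_of_square (hw : IsGen w) {s p b1 b0 e2 e1 e0 : ℚ}
    (h : IsMumford s p b1 b0 e2 e1 e0) (hs : s ^ 2 = 4 * p) :
    ∃ a b c d l, IsImage a b c d ∧ l ≠ 0 ∧ dup1 a b c d = l * 1 ∧ dup2 a b c d = l * s ∧
      dup3 a b c d = l * p ∧ dup4 a b c d = l * -(e0 + e2 * p) := by
  obtain ⟨x, rfl⟩ : ∃ x, s = 2 * x := ⟨s / 2, by ring⟩
  obtain rfl : p = x ^ 2 := by linear_combination -hs / 4
  obtain ⟨h4, h3, h2, h1, h0⟩ := h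
  obtain rfl : e2 = 225 + 90 * (2 * x) := by linear_combination h4
  obtain rfl : e1 = 300 + 2 * x * (225 + 90 * (2 * x)) - 90 * x ^ 2 := by linear_combination h3
  have hP : IsPoint x (b1 * x + b0) := by
    rw [IsPoint]
    linear_combination x ^ 2 * h2 + x * h1 + h0
  have hy := hw.y_ne_zero hP
  have ht : b1 * (b1 * x + b0) = 225 * x ^ 4 + 450 * x ^ 3 + 450 * x ^ 2 + 150 * x + 25 := by
    linear_combination x * h2 + h1 / 2
  obtain ⟨d1, d2, d3, d4⟩ := dup_point hP (u := -(150 + 2 * x * (300 + 225 * (2 * x) +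
    90 * (4 * x ^ 2 - x ^ 2)))) (d := -(e0 + (225 + 90 * (2 * x)) * x ^ 2))
    (by
      rw [← ht]
      linear_combination -(b1 * x + b0) ^ 2 * h2)
  exact ⟨0, 1, x, 90 * x ^ 2, _, Or.inr ⟨x, _, 1, hP, one_ne_zero, rfl, rfl, (one_mul _).symm,
    (one_mul _).symm⟩, mul_ne_zero (by norm_num) (pow_ne_zero 2 hy), by rw [d1]; ring, d2, d3,
    d4 rfl⟩

lemma exists_half_of_isMumford (hw : IsGen w) {s p b1 b0 e2 e1 e0 : ℚ}
    (h : IsMumford s p b1 b0 e2 e1 e0) :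
    ∃ a b c d l, IsImage a b c d ∧ l ≠ 0 ∧ dup1 a b c d = l * 1 ∧ dup2 a b c d = l * s ∧
      dup3 a b c d = l * p ∧ dup4 a b c d = l * -(e0 + e2 * p) := by
  obtain ⟨γ, hγ⟩ := hw.exists_sq_of_isMumford h
  obtain ⟨τ, hτ⟩ : ∃ τ : K, hw.th * τ = 1 := ⟨_, mul_inv_cancel₀ hw.th_ne_zero⟩
  have hg := hw.quintic_inv hτ
  have hM := h
  obtain ⟨h4, h3, h2, h1, h0⟩ := h
  have hβ : (γ * τ) ^ 2 = (1 : ℚ) * τ ^ 2 + (-s : ℚ) * τ + (p : ℚ) := by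
    push_cast
    linear_combination -τ ^ 2 * hγ + (-s * τ + p * (hw.th * τ + 1)) * hτ
  have hβ0 : γ * τ ≠ 0 := fun h0 => by
    rw [h0] at hβ
    have := hw.quartic_inv_eq_zero hτ (a := p) (b := -s) (c := 1) (d := 0) (e := 0)
      (by push_cast at hβ ⊢; linear_combination -hβ)
    norm_num at this
  obtain ⟨c2, c1, c0, κ, m1, m0, hne, q4, q3, q2, q1, q0⟩ := hw.exists_relation hτ hβ hβ0
    (b1 := b1) (b0 := b0) (e4 := 0) (e3 := 90) (e2 := e2) (e1 := e1) (e0 := e0) (by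
      replace h4 := congrArg (fun x : ℚ => (x : K)) h4
      replace h3 := congrArg (fun x : ℚ => (x : K)) h3
      replace h2 := congrArg (fun x : ℚ => (x : K)) h2
      replace h1 := congrArg (fun x : ℚ => (x : K)) h1
      replace h0 := congrArg (fun x : ℚ => (x : K)) h0
      push_cast at h4 h3 h2 h1 h0 ⊢
      linear_combination hg + τ ^ 4 * h4 + τ ^ 3 * h3 + τ ^ 2 * h2 + τ * h1 + h0)
  by_cases hκ : κ = 0
  · subst hκ
    refine hw.exists_half_of_square hM (disc_eq_zero (c2 := c2) (c1 := c1) (c0 := c0) (m1 := m1)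
      (m0 := m0) (by tauto) ?_ ?_ ?_ ?_ ?_)
    · linear_combination -q4
    · linear_combination -q3
    · linear_combination -q2
    · linear_combination -q1
    · linear_combination -q0
  · obtain ⟨c2, rfl⟩ : ∃ x, c2 = κ * x := ⟨c2 / κ, by field_simp⟩
    obtain ⟨c1, rfl⟩ : ∃ x, c1 = κ * x := ⟨c1 / κ, by field_simp⟩
    obtain ⟨c0, rfl⟩ : ∃ x, c0 = κ * x := ⟨c0 / κ, by field_simp⟩
    obtain ⟨m1, rfl⟩ : ∃ x, m1 = κ * x := ⟨m1 / κ, by field_simp⟩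
    obtain ⟨m0, rfl⟩ : ∃ x, m0 = κ * x := ⟨m0 / κ, by field_simp⟩
    have hκ2 := pow_ne_zero 2 hκ
    have r4 : m1 ^ 2 = c2 ^ 2 := mul_left_cancel₀ hκ2 (by linear_combination -q4)
    have r3 := mul_left_cancel₀ hκ2 (q3.trans (b := _)
      (c := κ ^ 2 * (2 * m1 * m0 - s * m1 ^ 2 - 2 * c2 * c1)) (by ring))
    have r2 := mul_left_cancel₀ hκ2 (q2.trans (b := _)
      (c := κ ^ 2 * (2 * b1 * m1 + m0 ^ 2 - 2 * s * m1 * m0 + p * m1 ^ 2 - c1 ^ 2 - 2 * c2 * c0))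
      (by ring))
    have r1 := mul_left_cancel₀ hκ2 (q1.trans (b := _)
      (c := κ ^ 2 * (2 * (b1 * m0 + b0 * m1) - s * m0 ^ 2 + 2 * p * m1 * m0 - 2 * c1 * c0))
      (by ring))
    have r0 := mul_left_cancel₀ hκ2 (q0.trans (b := _)
      (c := κ ^ 2 * (2 * b0 * m0 + p * m0 ^ 2 - c0 ^ 2)) (by ring))
    have hc2 : c2 ≠ 0 := by
      rintro rfl
      obtain rfl : m1 = 0 := pow_eq_zero_iff two_ne_zero |>.1 (by linear_combination r4)
      norm_num at r3
    obtain ⟨S, hS⟩ : ∃ S, c1 = -S * c2 := ⟨-c1 / c2, by field_simp⟩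
    obtain ⟨P, hP⟩ : ∃ P, c0 = P * c2 := ⟨c0 / c2, by field_simp⟩
    subst hS hP
    obtain ⟨d, l, hI, hl, d1, d2, d3, d4⟩ := hw.exists_image_of_sq (B3 := m1) (B2 := m0 - s * m1)
      (B1 := b1 + p * m1 - s * m0) (B0 := b0 + p * m0) (s := S) (p := P)
      (a2 := c2 ^ 2) (a1 := -c2 ^ 2 * s) (a0 := c2 ^ 2 * p)
      (by linear_combination r4)
      (by linear_combination -r3 - s * r4)
      (by linear_combination h4 - r2 + s * r3 + p * r4)
      (by linear_combination h3 - r1 + s * r2 - p * r3)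
      (by linear_combination h2 - r0 + s * r1 - p * r2)
      (by linear_combination h1 + s * r0 - p * r1)
      (by linear_combination h0 - p * r0)
    exact ⟨1, _, _, d, l * c2 ^ 2, hI, mul_ne_zero hl (pow_ne_zero 2 hc2), by rw [d1]; ring,
      by rw [d2]; ring, by rw [d3]; ring, by
      rw [d4]
      linear_combination l * c2 ^ 2 * (r0 + p * r2 - p ^ 2 * r4)⟩

/-- Every nonzero rational point is divisible by two. -/
lemma exists_half (hw : IsGen w) {a b c d : ℚ} (h : IsImage a b c d) :
    ∃ a' b' c' d' l, IsImage a' b' c' d' ∧ l ≠ 0 ∧ dup1 a' b' c' d' = l * a ∧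
      dup2 a' b' c' d' = l * b ∧ dup3 a' b' c' d' = l * c ∧ dup4 a' b' c' d' = l * d := by
  obtain ⟨s, p, b1, b0, e2, e1, e0, k, h, hk, rfl, rfl, rfl, rfl⟩ |
    ⟨t, y, k, h, hk, rfl, rfl, rfl, rfl⟩ := h
  · obtain ⟨a', b', c', d', l, hI, hl, d1, d2, d3, d4⟩ := hw.exists_half_of_isMumford h
    refine ⟨a', b', c', d', l / a, hI, div_ne_zero hl hk, ?_, ?_, ?_, ?_⟩
    · rw [d1]; field_simp
    · rw [d2]; field_simp
    · rw [d3]; field_simp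
    · rw [d4]; field_simp
  · obtain ⟨a', b', c', d', l, hI, hl, d1, d2, d3, d4⟩ := hw.exists_half_of_isPoint h
    refine ⟨a', b', c', d', l / b, hI, div_ne_zero hl hk, ?_, ?_, ?_, ?_⟩
    · rw [d1]; simp
    · rw [d2]; field_simp
    · rw [d3]; field_simp
    · rw [d4]; field_simp

end IsGen

end

lemma two_mul_dvd_dup1 {g a b c d : ℤ} (ha : g ∣ a) (hb : g ∣ b) (hc : g ∣ c) :
    2 * g ∣ dup1 a b c d := by
  have : dup1 a b c d = 2 * (
    a * (675000 * a ^ 3 - 180000 * a ^ 2 * b - 1080000 * a ^ 2 * c + 21000 * a ^ 2 * d - 540000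
    * a * b ^ 2 - 3510000 * a * b * c - 7200 * a * b * d - 3726000 * a * c ^ 2 - 18000 * a * c *
    d + 300 * a * d ^ 2 - 324000 * b ^ 2 * c - 9000 * b ^ 2 * d - 1620000 * b * c ^ 2 - 54000 *
    b * c * d - 54000 * c ^ 2 * d + 2 * d ^ 3) + b * (81000 * b ^ 3 + 810000 * b ^ 2 * c +
    2430000 * b * c ^ 2 + 4860000 * c ^ 3 - 180 * c * d ^ 2) + c * (3645000 * c ^ 3 + 32400 * c
    ^ 2 * d)) := by
    rw [dup1]; ring
  rw [this]
  exact mul_dvd_mul_left 2 (dvd_add (dvd_add (ha.mul_right _) (hb.mul_right _)) (hc.mul_right _))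

lemma two_mul_dvd_dup2 {g a b c d : ℤ} (ha : g ∣ a) (hb : g ∣ b) (hc : g ∣ c) :
    2 * g ∣ dup2 a b c d := by
  have : dup2 a b c d = 2 * (
    a * (318000 * a ^ 3 + 3780000 * a ^ 2 * b + 12420000 * a ^ 2 * c + 18000 * a ^ 2 * d +
    3150000 * a * b ^ 2 + 20250000 * a * b * c + 99000 * a * b * d + 20250000 * a * c ^ 2 +
    266400 * a * c * d + 100 * a * d ^ 2 + 1080000 * b ^ 3 + 9720000 * b ^ 2 * c + 46800 * b ^ 2
    * d + 24948000 * b * c ^ 2 + 306000 * b * c * d + 600 * b * d ^ 2 + 19440000 * c ^ 3 +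
    378000 * c ^ 2 * d + 1800 * c * d ^ 2) + b * (162000 * b ^ 2 * c + 9000 * b ^ 2 * d + 810000
    * b * c ^ 2 + 54000 * b * c * d + 162000 * c ^ 2 * d + 900 * c * d ^ 2 + 2 * d ^ 3) + c *
    (-4860000 * c ^ 3 + 180 * c * d ^ 2)) := by
    rw [dup2]; ring
  rw [this]
  exact mul_dvd_mul_left 2 (dvd_add (dvd_add (ha.mul_right _) (hb.mul_right _)) (hc.mul_right _))

lemma two_mul_dvd_dup3 {g a b c d : ℤ} (ha : g ∣ a) (hb : g ∣ b) (hc : g ∣ c) :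
    2 * g ∣ dup3 a b c d := by
  have : dup3 a b c d = 2 * (
    a * (105000 * a ^ 3 - 336000 * a ^ 2 * b - 1980000 * a ^ 2 * c - 2000 * a ^ 2 * d - 315000 *
    a * b ^ 2 - 3600000 * a * b * c - 18000 * a * b * d - 3105000 * a * c ^ 2 - 39000 * a * c *
    d - 30 * a * d ^ 2 - 90000 * b ^ 3 - 1620000 * b ^ 2 * c - 9000 * b ^ 2 * d - 3510000 * b *
    c ^ 2 - 50400 * b * c * d - 100 * b * d ^ 2 - 324000 * c ^ 3 - 18000 * c ^ 2 * d) + b *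
    (-1800 * b ^ 2 * d + 243000 * b * c ^ 2 - 9000 * b * c * d + 1620000 * c ^ 3) + c * (2430000
    * c ^ 3 + 54000 * c ^ 2 * d + 450 * c * d ^ 2 + 2 * d ^ 3)) := by
    rw [dup3]; ring
  rw [this]
  exact mul_dvd_mul_left 2 (dvd_add (dvd_add (ha.mul_right _) (hb.mul_right _)) (hc.mul_right _))

lemma two_dvd_dup4 (a b c d : ℤ) : 2 ∣ dup4 a b c d ↔ 2 ∣ d := by
  have h : (2 : ℤ) ∣ dup4 a b c d - d ^ 4 :=
    (ZMod.intCast_zmod_eq_zero_iff_dvd _ 2).1 (by simp only [dup4]; push_cast; grind)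
  rw [(dvd_iff_dvd_of_dvd_sub h), Int.prime_two.dvd_pow_iff_dvd four_ne_zero]

lemma kummer_parity {a b c m : ℤ} (h : kummer a b c (2 * m) = 0) :
    2 ∣ a ^ 4 + a ^ 2 * b ^ 2 + b ^ 2 * m ^ 2 + c ^ 4 := by
  have h8 : (8 : ℤ) ∣ kummer a b c (2 * m) -
      4 * (a ^ 4 + a ^ 2 * b ^ 2 + b ^ 2 * m ^ 2 + c ^ 4) :=
    (ZMod.intCast_zmod_eq_zero_iff_dvd _ 8).1 (by simp only [kummer]; push_cast; grind)
  rw [h] at h8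
  omega

lemma kummer_ne_zero_of_odd_odd_odd (a b c m : ℤ) :
    kummer (2 * a + 1) (2 * b + 1) (2 * c + 1) (2 * (2 * m + 1)) ≠ 0 := by
  intro h
  have hK : 16 ∣ kummer (2 * a + 1) (2 * b + 1) (2 * c + 1) (2 * (2 * m + 1)) - 8 :=
    (ZMod.intCast_zmod_eq_zero_iff_dvd _ 16).1 (by simp only [kummer]; push_cast; grind)
  rw [h] at hK
  omega

lemma kummer_ne_zero_of_odd_even_odd_even (a b c m : ℤ) :
    kummer (2 * a + 1) (2 * b) (2 * c + 1) (2 * (2 * m)) ≠ 0 := by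
  intro h
  obtain ⟨k, rfl | rfl⟩ := b.even_or_odd'
  · have hK : 32 ∣ kummer (2 * a + 1) (2 * (2 * k)) (2 * c + 1) (2 * (2 * m)) - 16 :=
      (ZMod.intCast_zmod_eq_zero_iff_dvd _ 32).1 (by simp only [kummer]; push_cast; grind)
    rw [h] at hK
    omega
  · have hK : 64 ∣ kummer (2 * a + 1) (2 * (2 * k + 1)) (2 * c + 1) (2 * (2 * m)) -
        32 * (1 + a * (a + 1) + c * (c + 1)) :=
      (ZMod.intCast_zmod_eq_zero_iff_dvd _ 64).1 (by simp only [kummer]; push_cast; grind)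
    rw [h] at hK
    obtain ⟨i, hi⟩ := Int.even_mul_succ_self a
    obtain ⟨j, hj⟩ := Int.even_mul_succ_self c
    omega

lemma dup_of_even_odd_even (a b c m : ℤ) :
    32 ∣ dup1 (2 * a) (2 * b + 1) (2 * c) (2 * (2 * m)) - 16 ∧
    32 ∣ dup2 (2 * a) (2 * b + 1) (2 * c) (2 * (2 * m)) ∧
    32 ∣ dup3 (2 * a) (2 * b + 1) (2 * c) (2 * (2 * m)) ∧
    32 ∣ dup4 (2 * a) (2 * b + 1) (2 * c) (2 * (2 * m)) - 16 := by
  refine ⟨?_, ?_, ?_, ?_⟩ <;> refine (ZMod.intCast_zmod_eq_zero_iff_dvd _ 32).1 ?_ <;>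
    simp only [dup1, dup2, dup3, dup4] <;> push_cast <;> grind

lemma dup_of_even_odd_odd {a b c m : ℤ}
    (h : kummer (2 * a) (2 * b + 1) (2 * c + 1) (2 * (2 * m + 1)) = 0) :
    128 ∣ dup1 (2 * a) (2 * b + 1) (2 * c + 1) (2 * (2 * m + 1)) - 64 ∧
    128 ∣ dup2 (2 * a) (2 * b + 1) (2 * c + 1) (2 * (2 * m + 1)) ∧
    128 ∣ dup3 (2 * a) (2 * b + 1) (2 * c + 1) (2 * (2 * m + 1)) - 64 ∧
    128 ∣ dup4 (2 * a) (2 * b + 1) (2 * c + 1) (2 * (2 * m + 1)) := by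
  have hK : 32 ∣ kummer (2 * a) (2 * b + 1) (2 * c + 1) (2 * (2 * m + 1)) -
      16 * (a + b + m) ^ 2 :=
    (ZMod.intCast_zmod_eq_zero_iff_dvd _ 32).1 (by simp only [kummer]; push_cast; grind)
  have h3 : 128 ∣ dup3 (2 * a) (2 * b + 1) (2 * c + 1) (2 * (2 * m + 1)) -
      64 * (1 + (a + b + m) ^ 2) :=
    (ZMod.intCast_zmod_eq_zero_iff_dvd _ 128).1 (by simp only [dup3]; push_cast; grind)
  rw [h] at hK
  refine ⟨?_, ?_, by omega, ?_⟩ <;> refine (ZMod.intCast_zmod_eq_zero_iff_dvd _ 128).1 ?_ <;>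
    simp only [dup1, dup2, dup4] <;> push_cast <;> grind

lemma dup_of_odd_odd_even {a b c m : ℤ}
    (h : kummer (2 * a + 1) (2 * b + 1) (2 * c) (2 * (2 * m)) = 0) :
    128 ∣ dup1 (2 * a + 1) (2 * b + 1) (2 * c) (2 * (2 * m)) - 64 ∧
    128 ∣ dup2 (2 * a + 1) (2 * b + 1) (2 * c) (2 * (2 * m)) ∧
    128 ∣ dup3 (2 * a + 1) (2 * b + 1) (2 * c) (2 * (2 * m)) - 64 ∧
    128 ∣ dup4 (2 * a + 1) (2 * b + 1) (2 * c) (2 * (2 * m)) := by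
  have hK : 32 ∣ kummer (2 * a + 1) (2 * b + 1) (2 * c) (2 * (2 * m)) -
      16 * (a + b + m) ^ 2 :=
    (ZMod.intCast_zmod_eq_zero_iff_dvd _ 32).1 (by simp only [kummer]; push_cast; grind)
  have h3 : 128 ∣ dup3 (2 * a + 1) (2 * b + 1) (2 * c) (2 * (2 * m)) -
      64 * (1 + (a + b + m) ^ 2) :=
    (ZMod.intCast_zmod_eq_zero_iff_dvd _ 128).1 (by simp only [dup3]; push_cast; grind)
  rw [h] at hK
  refine ⟨?_, ?_, by omega, ?_⟩ <;> refine (ZMod.intCast_zmod_eq_zero_iff_dvd _ 128).1 ?_ <;>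
    simp only [dup1, dup2, dup4] <;> push_cast <;> grind

lemma dup_of_odd_even_odd {a b c m : ℤ}
    (h : kummer (2 * a + 1) (2 * b) (2 * c + 1) (2 * (2 * m + 1)) = 0) :
    256 ∣ dup1 (2 * a + 1) (2 * b) (2 * c + 1) (2 * (2 * m + 1)) ∧
    256 ∣ dup2 (2 * a + 1) (2 * b) (2 * c + 1) (2 * (2 * m + 1)) ∧
    256 ∣ dup3 (2 * a + 1) (2 * b) (2 * c + 1) (2 * (2 * m + 1)) ∧
    512 ∣ dup4 (2 * a + 1) (2 * b) (2 * c + 1) (2 * (2 * m + 1)) - 256 := by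
  have hK : 128 ∣ kummer (2 * a + 1) (2 * b) (2 * c + 1) (2 * (2 * m + 1)) -
      64 * (m ^ 2 + 3 * c ^ 2 * m + c ^ 4 + b * c ^ 2 + b ^ 2 * m + b ^ 2 * m ^ 2 + b ^ 3 +
        a * c ^ 2 + a * b ^ 2 + a ^ 2 + a ^ 2 * m + a ^ 2 * b + a ^ 2 * b ^ 2 + a ^ 3 + a ^ 4) :=
    (ZMod.intCast_zmod_eq_zero_iff_dvd _ 128).1 (by simp only [kummer]; push_cast; grind)
  have h4 : 512 ∣ dup4 (2 * a + 1) (2 * b) (2 * c + 1) (2 * (2 * m + 1)) -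
      256 * (1 + a + b + m) ^ 4 :=
    (ZMod.intCast_zmod_eq_zero_iff_dvd _ 512).1 (by simp only [dup4]; push_cast; grind)
  have hodd : Odd (1 + a + b + m) := by
    have h2 : (2 : ℤ) ∣ m ^ 2 + 3 * c ^ 2 * m + c ^ 4 + b * c ^ 2 + b ^ 2 * m + b ^ 2 * m ^ 2 +
        b ^ 3 + a * c ^ 2 + a * b ^ 2 + a ^ 2 + a ^ 2 * m + a ^ 2 * b + a ^ 2 * b ^ 2 + a ^ 3 +
        a ^ 4 := by
      rw [h] at hK
      omega
    have h2' := (ZMod.intCast_zmod_eq_zero_iff_dvd _ 2).2 h2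
    rw [← ZMod.intCast_eq_one_iff_odd]
    push_cast at h2' ⊢
    generalize (a : ZMod 2) = a, (b : ZMod 2) = b, (c : ZMod 2) = c, (m : ZMod 2) = m at h2' ⊢
    revert a b c m
    decide
  obtain ⟨k, hk⟩ := hodd.pow (n := 4)
  refine ⟨?_, ?_, ?_, by omega⟩ <;> refine (ZMod.intCast_zmod_eq_zero_iff_dvd _ 256).1 ?_ <;>
    simp only [dup1, dup2, dup3] <;> push_cast <;> grind

/-- Not all four integers are even. -/
def IsPrim (a b c d : ℤ) : Prop := ¬ (2 ∣ a ∧ 2 ∣ b ∧ 2 ∣ c ∧ 2 ∣ d)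

/-- `(a : b : c : d)` is the image of `(a' : b' : c' : d')` under the duplication map. -/
def IsDouble (a b c d a' b' c' d' : ℤ) : Prop :=
  ∃ (e : ℕ) (u v : ℤ), Odd u ∧ Odd v ∧ 2 ^ e * u * a = v * dup1 a' b' c' d' ∧
    2 ^ e * u * b = v * dup2 a' b' c' d' ∧ 2 ^ e * u * c = v * dup3 a' b' c' d' ∧
    2 ^ e * u * d = v * dup4 a' b' c' d'

lemma two_dvd_mul_odd {u : ℤ} (hu : Odd u) (x : ℤ) : 2 ∣ u * x ↔ 2 ∣ x := by
  rw [Int.prime_two.dvd_mul, or_iff_right]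
  exact Int.two_dvd_ne_zero.2 (Int.odd_iff.1 hu)

lemma pow_dvd_of_dvd_mul_odd {u : ℤ} (hu : Odd u) {x : ℤ} {n : ℕ} (h : 2 ^ n ∣ u * x) :
    2 ^ n ∣ x :=
  (IsCoprime.pow_left (Int.prime_two.coprime_iff_not_dvd.2
    (Int.two_dvd_ne_zero.2 (Int.odd_iff.1 hu)))).dvd_of_dvd_mul_left h

lemma eq_and_dvd_iff_of_mul_eq {e j : ℕ} {u v : ℤ} (hu : Odd u) (hv : Odd v) {a b c d A B C D : ℤ}
    (hp : IsPrim a b c d) (hP : IsPrim A B C D) (h1 : 2 ^ e * u * a = v * (2 ^ j * A))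
    (h2 : 2 ^ e * u * b = v * (2 ^ j * B)) (h3 : 2 ^ e * u * c = v * (2 ^ j * C))
    (h4 : 2 ^ e * u * d = v * (2 ^ j * D)) :
    e = j ∧ u * a = v * A ∧ u * b = v * B ∧ u * c = v * C ∧ u * d = v * D := by
  have key {x X : ℤ} (h : 2 ^ e * u * x = v * (2 ^ j * X)) :
      (e < j → 2 ∣ x) ∧ (j < e → 2 ∣ X) ∧ (e = j → u * x = v * X) := by
    refine ⟨fun hlt => ?_, fun hlt => ?_, fun he => ?_⟩
    · obtain ⟨k, rfl⟩ := Nat.exists_eq_add_of_lt hlt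
      rw [← two_dvd_mul_odd hu]
      refine ⟨v * (2 ^ k * X), mul_left_cancel₀ (pow_ne_zero e (two_ne_zero' ℤ)) ?_⟩
      rw [← mul_assoc, h]; ring
    · obtain ⟨k, rfl⟩ := Nat.exists_eq_add_of_lt hlt
      rw [← two_dvd_mul_odd hv]
      refine ⟨u * (2 ^ k * x), mul_left_cancel₀ (pow_ne_zero j (two_ne_zero' ℤ)) ?_⟩
      rw [mul_left_comm, ← h]; ring
    · subst he
      apply mul_left_cancel₀ (pow_ne_zero e (two_ne_zero' ℤ))
      rw [← mul_assoc, h]; ring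
  obtain hlt | rfl | hlt := lt_trichotomy e j
  · exact absurd ⟨(key h1).1 hlt, (key h2).1 hlt, (key h3).1 hlt, (key h4).1 hlt⟩ hp
  · exact ⟨rfl, (key h1).2.2 rfl, (key h2).2.2 rfl, (key h3).2.2 rfl, (key h4).2.2 rfl⟩
  · exact absurd ⟨(key h1).2.1 hlt, (key h2).2.1 hlt, (key h3).2.1 hlt, (key h4).2.1 hlt⟩ hP

lemma dvd_iff_of_mul_eq {u v : ℤ} (hu : Odd u) (hv : Odd v) {x X : ℤ} (h : u * x = v * X) :
    2 ∣ x ↔ 2 ∣ X := by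
  rw [← two_dvd_mul_odd hu, h, two_dvd_mul_odd hv]

lemma IsDouble.dvd_iff {a b c d a' b' c' d' : ℤ} (h : IsDouble a b c d a' b' c' d')
    (hp : IsPrim a b c d) {A B C D : ℤ} (hP : IsPrim A B C D) (j : ℕ)
    (h1 : dup1 a' b' c' d' = 2 ^ j * A) (h2 : dup2 a' b' c' d' = 2 ^ j * B)
    (h3 : dup3 a' b' c' d' = 2 ^ j * C) (h4 : dup4 a' b' c' d' = 2 ^ j * D) :
    (2 ∣ a ↔ 2 ∣ A) ∧ (2 ∣ b ↔ 2 ∣ B) ∧ (2 ∣ c ↔ 2 ∣ C) ∧ (2 ∣ d ↔ 2 ∣ D) := by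
  obtain ⟨e, u, v, hu, hv, q1, q2, q3, q4⟩ := h
  rw [h1] at q1; rw [h2] at q2; rw [h3] at q3; rw [h4] at q4
  obtain ⟨-, r1, r2, r3, r4⟩ := eq_and_dvd_iff_of_mul_eq hu hv hp hP q1 q2 q3 q4
  exact ⟨dvd_iff_of_mul_eq hu hv r1, dvd_iff_of_mul_eq hu hv r2, dvd_iff_of_mul_eq hu hv r3,
    dvd_iff_of_mul_eq hu hv r4⟩

lemma IsDouble.odd_of_odd {a b c d a' b' c' d' : ℤ} (h : IsDouble a b c d a' b' c' d')
    (hp : IsPrim a b c d) (hd : ¬ 2 ∣ d') : ¬ 2 ∣ d := by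
  have hd4 : ¬ 2 ∣ dup4 a' b' c' d' := by rwa [two_dvd_dup4]
  have := h.dvd_iff hp (j := 0) (A := dup1 a' b' c' d') (B := dup2 a' b' c' d')
    (C := dup3 a' b' c' d') (D := dup4 a' b' c' d') (fun h => hd4 h.2.2.2)
    (by rw [pow_zero, one_mul]) (by rw [pow_zero, one_mul]) (by rw [pow_zero, one_mul])
    (by rw [pow_zero, one_mul])
  exact fun hh => hd4 (this.2.2.2.1 hh)

lemma IsDouble.pow_succ_dvd {a b c d a' b' c' d' : ℤ} (h : IsDouble a b c d a' b' c' d')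
    {n : ℕ} (h1 : 2 ^ n ∣ a') (h2 : 2 ^ n ∣ b') (h3 : 2 ^ n ∣ c')
    (hp : IsPrim a b c d) (hd : ¬ 2 ∣ d') :
    2 ^ (n + 1) ∣ a ∧ 2 ^ (n + 1) ∣ b ∧ 2 ^ (n + 1) ∣ c := by
  have hd4 : ¬ 2 ∣ dup4 a' b' c' d' := by rwa [two_dvd_dup4]
  obtain ⟨e, u, v, hu, hv, q1, q2, q3, q4⟩ := h
  obtain ⟨-, r1, r2, r3, -⟩ := eq_and_dvd_iff_of_mul_eq (j := 0) hu hv hp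
    (A := dup1 a' b' c' d') (B := dup2 a' b' c' d') (C := dup3 a' b' c' d')
    (D := dup4 a' b' c' d') (fun h => hd4 h.2.2.2) (by rw [q1, pow_zero, one_mul])
    (by rw [q2, pow_zero, one_mul])
    (by rw [q3, pow_zero, one_mul]) (by rw [q4, pow_zero, one_mul])
  rw [pow_succ']
  refine ⟨?_, ?_, ?_⟩ <;> rw [← pow_succ'] <;> apply pow_dvd_of_dvd_mul_odd hu <;> rw [pow_succ']
  · rw [r1]
    exact (two_mul_dvd_dup1 h1 h2 h3).mul_left v
  · rw [r2]
    exact (two_mul_dvd_dup2 h1 h2 h3).mul_left v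
  · rw [r3]
    exact (two_mul_dvd_dup3 h1 h2 h3).mul_left v

lemma IsDouble.odd_of_class {a b c d a' b' c' d' : ℤ} (h : IsDouble a b c d a' b' c' d')
    (hp : IsPrim a b c d) (hk : kummer a' b' c' d' = 0) (h1 : ¬ 2 ∣ a') (h2 : 2 ∣ b')
    (h3 : ¬ 2 ∣ c') (h4 : 2 ∣ d') : ¬ 2 ∣ d := by
  obtain ⟨m, rfl⟩ := h4
  obtain ⟨B, rfl⟩ := h2
  obtain ⟨A, rfl⟩ : Odd a' := Int.odd_iff.2 (by omega)
  obtain ⟨C, rfl⟩ : Odd c' := Int.odd_iff.2 (by omega)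
  obtain ⟨m, rfl⟩ : Odd m := by
    by_contra hm
    obtain ⟨M, rfl⟩ := even_iff_two_dvd.1 (Int.not_odd_iff_even.1 hm)
    exact kummer_ne_zero_of_odd_even_odd_even A B C M hk
  obtain ⟨⟨W, hW⟩, ⟨X, hX⟩, ⟨Y, hY⟩, ⟨Z, hZ⟩⟩ := dup_of_odd_even_odd hk
  have := h.dvd_iff hp (A := W) (B := X) (C := Y) (D := 2 * Z + 1) (fun h => by
    have := h.2.2.2; omega) 8 (by linarith) (by linarith) (by linarith) (by linarith)
  omega

lemma IsDouble.odd_or_class {a b c d a' b' c' d' : ℤ} (h : IsDouble a b c d a' b' c' d')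
    (hp : IsPrim a b c d) (hp' : IsPrim a' b' c' d') (hk : kummer a' b' c' d' = 0) (h4 : 2 ∣ d') :
    ¬ 2 ∣ d ∨ ¬ 2 ∣ a ∧ 2 ∣ b ∧ ¬ 2 ∣ c ∧ 2 ∣ d := by
  have hdd := h4
  obtain ⟨m, rfl⟩ := h4
  have hm := kummer_parity hk
  have hE (x y : ℤ) : 2 ∣ x + y ↔ (2 ∣ x ↔ 2 ∣ y) := by omega
  simp only [hE, Int.prime_two.dvd_mul, Int.prime_two.dvd_pow_iff_dvd two_ne_zero,
    Int.prime_two.dvd_pow_iff_dvd four_ne_zero] at hm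
  rw [IsPrim] at hp'
  have odd {x : ℤ} (hx : ¬ 2 ∣ x) : ∃ k, x = 2 * k + 1 := Int.odd_iff.2 (by omega)
  by_cases ha : 2 ∣ a' <;> by_cases hb : 2 ∣ b'
  · tauto
  · by_cases hc : 2 ∣ c'
    · have hm2 : 2 ∣ m := by tauto
      obtain ⟨A, rfl⟩ := ha
      obtain ⟨B, rfl⟩ := odd hb
      obtain ⟨C, rfl⟩ := hc
      obtain ⟨M, rfl⟩ := hm2
      obtain ⟨⟨W, hW⟩, ⟨X, hX⟩, ⟨Y, hY⟩, ⟨Z, hZ⟩⟩ := dup_of_even_odd_even A B C M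
      have := h.dvd_iff hp (A := 2 * W + 1) (B := 2 * X) (C := 2 * Y) (D := 2 * Z + 1) (fun h => by
        have := h.2.2.2; omega) 4 (by linarith) (by linarith) (by linarith) (by linarith)
      omega
    · have hm2 : ¬ 2 ∣ m := by tauto
      obtain ⟨A, rfl⟩ := ha
      obtain ⟨B, rfl⟩ := odd hb
      obtain ⟨C, rfl⟩ := odd hc
      obtain ⟨M, rfl⟩ := odd hm2
      obtain ⟨⟨W, hW⟩, ⟨X, hX⟩, ⟨Y, hY⟩, ⟨Z, hZ⟩⟩ := dup_of_even_odd_odd hk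
      have := h.dvd_iff hp (A := 2 * W + 1) (B := 2 * X) (C := 2 * Y + 1) (D := 2 * Z) (fun h => by
        have := h.1; omega) 6 (by linarith) (by linarith) (by linarith) (by linarith)
      omega
  · have hc : ¬ 2 ∣ c' := by tauto
    exact Or.inl (h.odd_of_class hp hk ha hb hc hdd)
  · have hc : 2 ∣ c' := by
      by_contra hc
      have hm2 : ¬ 2 ∣ m := by tauto
      obtain ⟨A, rfl⟩ := odd ha
      obtain ⟨B, rfl⟩ := odd hb
      obtain ⟨C, rfl⟩ := odd hc
      obtain ⟨M, rfl⟩ := odd hm2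
      exact kummer_ne_zero_of_odd_odd_odd A B C M hk
    have hm2 : 2 ∣ m := by tauto
    obtain ⟨A, rfl⟩ := odd ha
    obtain ⟨B, rfl⟩ := odd hb
    obtain ⟨C, rfl⟩ := hc
    obtain ⟨M, rfl⟩ := hm2
    obtain ⟨⟨W, hW⟩, ⟨X, hX⟩, ⟨Y, hY⟩, ⟨Z, hZ⟩⟩ := dup_of_odd_odd_even hk
    have := h.dvd_iff hp (A := 2 * W + 1) (B := 2 * X) (C := 2 * Y + 1) (D := 2 * Z) (fun h => by
      have := h.1; omega) 6 (by linarith) (by linarith) (by linarith) (by linarith)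
    omega

lemma IsDouble.odd_of_isDouble {a b c d a' b' c' d' a'' b'' c'' d'' : ℤ}
    (h : IsDouble a b c d a' b' c' d') (h' : IsDouble a' b' c' d' a'' b'' c'' d'')
    (hp : IsPrim a b c d) (hp' : IsPrim a' b' c' d') (hp'' : IsPrim a'' b'' c'' d'')
    (hk' : kummer a' b' c' d' = 0) (hk'' : kummer a'' b'' c'' d'' = 0) : ¬ 2 ∣ d := by
  by_cases hd : 2 ∣ d''
  · obtain h1 | ⟨h1, h2, h3, h4⟩ := h'.odd_or_class hp' hp'' hk'' hd
    · exact h.odd_of_odd hp h1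
    · exact h.odd_of_class hp hk' h1 h2 h3 h4
  · exact h.odd_of_odd hp (h'.odd_of_odd hp' hd)

lemma exists_eq_two_pow_mul_odd {n : ℤ} (hn : n ≠ 0) :
    ∃ (k : ℕ) (u : ℤ), Odd u ∧ n = 2 ^ k * u := by
  obtain ⟨k, m, hm, h⟩ := Nat.exists_eq_two_pow_mul_odd (Int.natAbs_ne_zero.2 hn)
  obtain h' | h' := Int.natAbs_eq n
  · exact ⟨k, m, by exact_mod_cast hm, by rw [h', h]; push_cast; ring⟩
  · exact ⟨k, -m, by simpa using hm, by rw [h', h]; push_cast; ring⟩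

lemma exists_isPrim {a b : ℤ} (c d : ℤ) (h : ¬ (a = 0 ∧ b = 0)) :
    ∃ (n : ℕ) (a' b' c' d' : ℤ), IsPrim a' b' c' d' ∧ a = 2 ^ n * a' ∧ b = 2 ^ n * b' ∧
      c = 2 ^ n * c' ∧ d = 2 ^ n * d' := by
  induction hs : a.natAbs + b.natAbs using Nat.strong_induction_on generalizing a b c d with
  | _ s ih =>
  by_cases hp : IsPrim a b c d
  · exact ⟨0, a, b, c, d, hp, by simp⟩
  · obtain ⟨⟨a, rfl⟩, ⟨b, rfl⟩, ⟨c, rfl⟩, ⟨d, rfl⟩⟩ := not_not.1 hp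
    obtain ⟨n, a', b', c', d', hp', h1, h2, h3, h4⟩ :=
      ih (a.natAbs + b.natAbs) (by omega) c d (by omega) rfl
    exact ⟨n + 1, a', b', c', d', hp', by rw [h1]; ring, by rw [h2]; ring, by rw [h3]; ring,
      by rw [h4]; ring⟩

lemma isDouble_of_mul_eq {a b c d a' b' c' d' p q : ℤ} (hp : IsPrim a b c d) (hp0 : p ≠ 0)
    (hq0 : q ≠ 0) (h1 : p * a = q * dup1 a' b' c' d') (h2 : p * b = q * dup2 a' b' c' d')
    (h3 : p * c = q * dup3 a' b' c' d') (h4 : p * d = q * dup4 a' b' c' d') :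
    IsDouble a b c d a' b' c' d' := by
  obtain ⟨i, u, hu, rfl⟩ := exists_eq_two_pow_mul_odd hp0
  obtain ⟨j, v, hv, rfl⟩ := exists_eq_two_pow_mul_odd hq0
  rw [IsDouble]
  generalize dup1 a' b' c' d' = A, dup2 a' b' c' d' = B, dup3 a' b' c' d' = C,
    dup4 a' b' c' d' = D at *
  obtain hij | hij := lt_or_ge i j
  · obtain ⟨k, rfl⟩ := Nat.exists_eq_add_of_lt hij
    have key {x X : ℤ} (h : 2 ^ i * u * x = 2 ^ (i + k + 1) * v * X) : 2 ∣ x := by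
      rw [← two_dvd_mul_odd hu]
      refine ⟨v * (2 ^ k * X), mul_left_cancel₀ (pow_ne_zero i (two_ne_zero' ℤ)) ?_⟩
      rw [← mul_assoc, h]; ring
    exact absurd ⟨key h1, key h2, key h3, key h4⟩ hp
  · obtain ⟨k, rfl⟩ := Nat.exists_eq_add_of_le hij
    have key {x X : ℤ} (h : 2 ^ (j + k) * u * x = 2 ^ j * v * X) : 2 ^ k * u * x = v * X := by
      apply mul_left_cancel₀ (pow_ne_zero j (two_ne_zero' ℤ))
      linear_combination h
    exact ⟨k, u, v, hu, hv, key h1, key h2, key h3, key h4⟩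

/-- Integral coordinates, not all even, of the image of a nonzero point on the Kummer surface. -/
structure IsGood (a b c d : ℤ) : Prop where
  isPrim : IsPrim a b c d
  isImage : IsImage (a : ℚ) b c d

lemma IsImage.exists_isGood {a b c d : ℚ} (h : IsImage a b c d) :
    ∃ (k : ℚ) (a' b' c' d' : ℤ), k ≠ 0 ∧ IsGood a' b' c' d' ∧ (a' : ℚ) = k * a ∧
      (b' : ℚ) = k * b ∧ (c' : ℚ) = k * c ∧ (d' : ℚ) = k * d := by
  have ha := a.den_ne_zero
  have hb := b.den_ne_zero
  have hc := c.den_ne_zero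
  have hd := d.den_ne_zero
  obtain ⟨n, a', b', c', d', hp, h1, h2, h3, h4⟩ :=
    exists_isPrim (a := a.num * b.den * c.den * d.den) (b := b.num * a.den * c.den * d.den)
      (c.num * a.den * b.den * d.den) (d.num * a.den * b.den * c.den)
      (fun hab => h.ne_zero (by simpa [ha, hb, hc, hd] using hab))
  set k : ℚ := a.den * b.den * c.den * d.den / 2 ^ n
  have hk : k ≠ 0 := by positivity
  have e1 : (a' : ℚ) = k * a := by
    have := congrArg (Int.cast (R := ℚ)) h1
    push_cast at this
    rw [← Rat.mul_den_eq_num a] at this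
    simp only [k]
    field_simp
    linear_combination -this
  have e2 : (b' : ℚ) = k * b := by
    have := congrArg (Int.cast (R := ℚ)) h2
    push_cast at this
    rw [← Rat.mul_den_eq_num b] at this
    simp only [k]
    field_simp
    linear_combination -this
  have e3 : (c' : ℚ) = k * c := by
    have := congrArg (Int.cast (R := ℚ)) h3
    push_cast at this
    rw [← Rat.mul_den_eq_num c] at this
    simp only [k]
    field_simp
    linear_combination -this
  have e4 : (d' : ℚ) = k * d := by
    have := congrArg (Int.cast (R := ℚ)) h4
    push_cast at this
    rw [← Rat.mul_den_eq_num d] at this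
    simp only [k]
    field_simp
    linear_combination -this
  refine ⟨k, a', b', c', d', hk, ⟨hp, ?_⟩, e1, e2, e3, e4⟩
  rw [e1, e2, e3, e4]
  exact h.smul hk

lemma IsGood.kummer_eq_zero {a b c d : ℤ} (h : IsGood a b c d) : kummer a b c d = 0 := by
  have := h.isImage.kummer_eq_zero
  rw [kummer] at this ⊢
  exact_mod_cast this

section
variable {K : Type*} [Field K] [NumberField K] {w : K}

namespace IsGen

lemma exists_isDouble (hw : IsGen w) {a b c d : ℤ} (h : IsGood a b c d) :
    ∃ a' b' c' d', IsGood a' b' c' d' ∧ IsDouble a b c d a' b' c' d' := by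
  obtain ⟨r, s, t, z, l, hi, hl, h1, h2, h3, h4⟩ := hw.exists_half h.isImage
  obtain ⟨k, a', b', c', d', hk, hg, e1, e2, e3, e4⟩ := hi.exists_isGood
  obtain ⟨q1, q2, q3, q4⟩ := dup_smul k r s t z
  rw [← e1, ← e2, ← e3, ← e4] at q1 q2 q3 q4
  rw [h1, ← mul_assoc] at q1
  rw [h2, ← mul_assoc] at q2
  rw [h3, ← mul_assoc] at q3
  rw [h4, ← mul_assoc] at q4
  have hm : k ^ 4 * l ≠ 0 := by positivity
  generalize k ^ 4 * l = m at *
  have key {x : ℤ} {X : ℤ} (hx : (X : ℚ) = m * x) : m.num * x = m.den * X := by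
    have := m.mul_den_eq_num
    have : (m.num : ℚ) * x = m.den * X := by rw [hx, ← this]; ring
    exact_mod_cast this
  refine ⟨a', b', c', d', hg, isDouble_of_mul_eq h.isPrim (Rat.num_ne_zero.2 hm)
    (Int.natCast_ne_zero.2 m.den_ne_zero) (key (q1 ▸ ?_)) (key (q2 ▸ ?_)) (key (q3 ▸ ?_))
    (key (q4 ▸ ?_))⟩
  · simp only [dup1]; push_cast; rfl
  · simp only [dup2]; push_cast; rfl
  · simp only [dup3]; push_cast; rfl
  · simp only [dup4]; push_cast; rfl

lemma not_two_dvd (hw : IsGen w) {a b c d : ℤ} (h : IsGood a b c d) : ¬ 2 ∣ d := by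
  obtain ⟨a', b', c', d', hg, hd⟩ := hw.exists_isDouble h
  obtain ⟨a'', b'', c'', d'', hg', hd'⟩ := hw.exists_isDouble hg
  exact hd.odd_of_isDouble hd' h.isPrim hg.isPrim hg'.isPrim hg.kummer_eq_zero hg'.kummer_eq_zero

lemma two_pow_dvd (hw : IsGen w) (n : ℕ) {a b c d : ℤ} (h : IsGood a b c d) :
    2 ^ n ∣ a ∧ 2 ^ n ∣ b ∧ 2 ^ n ∣ c := by
  induction n generalizing a b c d with
  | zero => simp
  | succ n ih =>
    obtain ⟨a', b', c', d', hg, hd⟩ := hw.exists_isDouble h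
    obtain ⟨h1, h2, h3⟩ := ih hg
    exact hd.pow_succ_dvd h1 h2 h3 h.isPrim (hw.not_two_dvd hg)

lemma not_isImage (hw : IsGen w) {a b c d : ℚ} : ¬ IsImage a b c d := by
  intro h
  obtain ⟨k, a', b', c', d', -, hg, -⟩ := h.exists_isGood
  have zero {x : ℤ} (hx : ∀ n : ℕ, 2 ^ n ∣ x) : x = 0 :=
    Int.eq_zero_of_abs_lt_dvd (hx x.natAbs) (by
      rw [Int.abs_eq_natAbs]
      exact_mod_cast Nat.lt_two_pow_self)
  exact hg.isImage.ne_zero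
    ⟨by exact_mod_cast zero fun n => (hw.two_pow_dvd n hg).1,
      by exact_mod_cast zero fun n => (hw.two_pow_dvd n hg).2.1⟩

end IsGen

end

lemma pow_five_eq_of_genPoly_eval₂ {R : Type*} [CommRing R] {f : ℤ →+* R} {r : R}
    (h : genPoly.eval₂ f r = 0) : r ^ 5 = 5 * r ^ 3 - 5 * r + 4 := by
  simp [genPoly, eval₂_sub] at h
  linear_combination h

lemma exists_isGen : ∃ (K : Type) (_ : Field K) (_ : NumberField K) (w : K), IsGen w := by
  have hirr : Irreducible (genPoly.map (algebraMap ℤ ℚ)) :=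
    (genPoly_monic.irreducible_iff_irreducible_map_fraction_map (K := ℚ)).1 genPoly_irreducible
  have := Fact.mk hirr
  have : FiniteDimensional ℚ (AdjoinRoot (genPoly.map (algebraMap ℤ ℚ))) :=
    (AdjoinRoot.powerBasis hirr.ne_zero).finite
  refine ⟨AdjoinRoot (genPoly.map (algebraMap ℤ ℚ)), inferInstance, ⟨⟩,
    AdjoinRoot.root (genPoly.map (algebraMap ℤ ℚ)), ?_, ?_⟩
  · have h := AdjoinRoot.eval₂_root (genPoly.map (algebraMap ℤ ℚ))
    rw [eval₂_map] at h
    exact pow_five_eq_of_genPoly_eval₂ h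
  · rw [(AdjoinRoot.powerBasis hirr.ne_zero).finrank, AdjoinRoot.powerBasis_dim,
      genPoly_monic.natDegree_map, genPoly_natDegree]

end FiveYSq

open FiveYSq in
theorem rational_points_five_y_sq (x y : ℚ)
    (h : 5 * y ^ 2 = x * (x ^ 5 + 10 * x ^ 4 + 30 * x ^ 3 + 60 * x ^ 2 + 45 * x + 18)) :
    x = 0 ∧ y = 0 := by
  by_cases hx : x = 0
  · subst hx
    simpa using h
  · exfalso
    obtain ⟨K, _, _, w, hw⟩ := exists_isGen
    have hP : IsPoint (1 / x) (5 * y / x ^ 3) := by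
      rw [IsPoint]
      field_simp
      linear_combination 5 * h
    exact hw.not_isImage (Or.inr ⟨1 / x, 5 * y / x ^ 3, 1, hP, one_ne_zero, rfl, rfl, rfl, rfl⟩)
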